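/- Assume the abc-conjecture and let n ≥ 4 be an integer. Then there exists a finite set S₀ of primes such that for every prime p ∉ S₀ and every integer k with p ∤ k, there exists an irreducible polynomial f ∈ ℚ[X] of degree n whose Galois group (the Galois group of its splitting field over ℚ) is isomorphic to the alternating group Aₙ, such that the discriminant of the degree-n number field F = ℚ[X]/(f) is congruent to k² modulo p. -/

import Mathlib

/-- The radical of a natural number: the product of its distinct prime factors. -/
def Rad (m : ℕ) : ℕ := ∏ q ∈ m.primeFactors, q

/-- The abc-conjecture: for every `ε > 0` there is a constant `C > 0` such that
`c ≤ C · rad(abc)^(1+ε)` for all coprime positive integers `a + b = c`. -/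
def AbcConjecture : Prop :=
  ∀ ε : ℝ, 0 < ε → ∃ C : ℝ, 0 < C ∧ ∀ a b c : ℕ, 0 < a → 0 < b → 0 < c →
    Nat.Coprime a b → a + b = c → (c : ℝ) ≤ C * (Rad (a * b * c) : ℝ) ^ (1 + ε)

namespace AltDisc

open Finset

theorem primeCounting_mul_le (K : ℕ) (hK : 0 < K) {ε : ℝ} (hε : 0 < ε) :
    ∃ N₀ : ℕ, ∀ N ≥ N₀, (Nat.primeCounting (K * N) : ℝ) ≤ ε * N := by
  have h1 := Chebyshev.eventually_primeCounting_le (ε := 1) one_pos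
  have h2 : ∀ᶠ x : ℝ in Filter.atTop, (Real.log 4 + 1) * K / ε ≤ Real.log x :=
    Real.tendsto_log_atTop.eventually_ge_atTop _
  have h3 : Filter.Tendsto (fun N : ℕ => ((K * N : ℕ) : ℝ)) Filter.atTop Filter.atTop :=
    tendsto_natCast_atTop_atTop.comp (Filter.tendsto_id.const_mul_atTop' hK)
  obtain ⟨N₀, h⟩ := Filter.eventually_atTop.1 (h3.eventually (h1.and h2))
  refine ⟨N₀, fun N hN => ?_⟩
  obtain ⟨h4, h5⟩ := h N hN
  rw [Nat.floor_natCast] at h4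
  have h6 : 0 < (Real.log 4 + 1) * K / ε := by
    have : 0 < Real.log 4 := Real.log_pos (by norm_num)
    positivity
  refine h4.trans ?_
  rw [div_le_iff₀ (h6.trans_le h5)]
  have : (Real.log 4 + 1) * K ≤ Real.log (K * N : ℕ) * ε := by
    rwa [div_le_iff₀ hε] at h5
  push_cast at this ⊢
  nlinarith [mul_le_mul_of_nonneg_right this (Nat.cast_nonneg (α := ℝ) N)]

/-- An arithmetic progression with difference prime to `d` meets the multiples of `d` at most
`N / d + 1` times in its first `N` terms. -/
theorem card_dvd_linear_le (N : ℕ) {d : ℕ} (hd : 0 < d) (t M : ℤ) (h : IsCoprime (d : ℤ) M) :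
    #{j ∈ range N | (d : ℤ) ∣ t + M * (j : ℕ)} ≤ N / d + 1 := by
  rcases Finset.eq_empty_or_nonempty {j ∈ range N | (d : ℤ) ∣ t + M * (j : ℕ)} with h0 | ⟨v, hv⟩
  · simp [h0]
  have hv' := (mem_filter.1 hv).2
  have : #{j ∈ range N | (d : ℤ) ∣ t + M * (j : ℕ)} ≤ N.count (· ≡ v [MOD d]) := by
    rw [Nat.count_eq_card_filter_range]
    refine card_le_card fun j hj => ?_
    rw [mem_filter] at hj ⊢
    refine ⟨hj.1, ?_⟩
    have h2 : (d : ℤ) ∣ M * (v - j) := by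
      have := dvd_sub hv' hj.2
      ring_nf at this ⊢
      exact this
    rw [← Int.natCast_modEq_iff, Int.modEq_iff_dvd]
    exact h.dvd_of_dvd_mul_left h2
  refine this.trans ?_
  rw [Nat.count_modEq_card _ hd]
  split_ifs <;> omega

theorem card_sq_dvd_quadratic_le (N : ℕ) {q : ℕ} (hq : q.Prime) (c t M : ℤ) (h2 : ¬ (q : ℤ) ∣ 2)
    (hM : ¬ (q : ℤ) ∣ M) :
    #{j ∈ range N | (q ^ 2 : ℤ) ∣ 1 - c * (t + M * (j : ℕ)) ^ 2} ≤ 2 * (N / q ^ 2 + 1) := by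
  rcases Finset.eq_empty_or_nonempty
    {j ∈ range N | (q ^ 2 : ℤ) ∣ 1 - c * (t + M * (j : ℕ)) ^ 2} with h0 | ⟨v, hv⟩
  · simp [h0]
  have hv' := (mem_filter.1 hv).2
  have hqp : Prime (q : ℤ) := Nat.prime_iff_prime_int.1 hq
  have hcop : IsCoprime ((q ^ 2 : ℕ) : ℤ) M := by
    push_cast
    exact IsCoprime.pow_left ((Prime.coprime_iff_not_dvd hqp).2 hM)
  have hsub : ({j ∈ range N | (q ^ 2 : ℤ) ∣ 1 - c * (t + M * (j : ℕ)) ^ 2} : Finset ℕ) ⊆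
      {j ∈ range N | ((q ^ 2 : ℕ) : ℤ) ∣ (-M * v) + M * (j : ℕ)} ∪
      {j ∈ range N | ((q ^ 2 : ℕ) : ℤ) ∣ (2 * t + M * v) + M * (j : ℕ)} := by
    intro j hj
    rw [mem_filter] at hj
    rw [mem_union, mem_filter, mem_filter]
    set y := t + M * (v : ℤ) with hy
    set y' := t + M * (j : ℤ) with hy'
    have e1 : -M * v + M * j = y' - y := by rw [hy, hy']; ring
    have e2 : 2 * t + M * v + M * j = y' + y := by rw [hy, hy']; ring
    have hq1 : (q : ℤ) ∣ q ^ 2 := dvd_pow_self _ two_ne_zero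
    have hc : ¬ (q : ℤ) ∣ c := fun hc => by
      have := (dvd_sub_left (hc.mul_right (y ^ 2))).1 (hq1.trans hv')
      exact hqp.not_isUnit (isUnit_of_dvd_one this)
    have hyq : ¬ (q : ℤ) ∣ y := fun hc => by
      have := (dvd_sub_left ((hc.pow two_ne_zero).mul_left c)).1 (hq1.trans hv')
      exact hqp.not_isUnit (isUnit_of_dvd_one this)
    have h3 : (q ^ 2 : ℤ) ∣ c * ((y' - y) * (y' + y)) := by
      have := dvd_sub hv' hj.2
      ring_nf at this ⊢
      exact this
    have h4 : (q ^ 2 : ℤ) ∣ (y' - y) * (y' + y) :=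
      (IsCoprime.pow_left ((Prime.coprime_iff_not_dvd hqp).2 hc)).dvd_of_dvd_mul_left h3
    rw [e1, e2]
    push_cast
    by_cases h5 : (q : ℤ) ∣ y' - y
    · have h6 : ¬ (q : ℤ) ∣ y' + y := fun h6 => by
        have : (q : ℤ) ∣ 2 * y := by
          have := dvd_sub h6 h5
          ring_nf at this ⊢
          exact this
        exact (hqp.dvd_or_dvd this).elim h2 hyq
      exact .inl ⟨hj.1, (IsCoprime.pow_left
        ((Prime.coprime_iff_not_dvd hqp).2 h6)).dvd_of_dvd_mul_right h4⟩
    · exact .inr ⟨hj.1, (IsCoprime.pow_left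
        ((Prime.coprime_iff_not_dvd hqp).2 h5)).dvd_of_dvd_mul_left h4⟩
  refine (card_le_card hsub).trans ((card_union_le _ _).trans ?_)
  rw [two_mul (N / q ^ 2 + 1)]
  exact add_le_add (card_dvd_linear_le N (pow_pos hq.pos 2) _ _ hcop)
    (card_dvd_linear_le N (pow_pos hq.pos 2) _ _ hcop)

/-- A square of the form `1 / c` modulo `r` lifts to modulo `r ^ 2` but not modulo `r ^ 3`. -/
theorem exists_sq_exactly_dvd {r : ℕ} (hr : r.Prime) (h2 : ¬ (r : ℤ) ∣ 2) {c : ℤ}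
    (h : ∃ y : ℤ, (r : ℤ) ∣ 1 - c * y ^ 2) :
    ∃ y : ℤ, (r : ℤ) ^ 2 ∣ 1 - c * y ^ 2 ∧ ¬ (r : ℤ) ^ 3 ∣ 1 - c * y ^ 2 := by
  obtain ⟨y, u, hu⟩ := h
  have hp : Prime (r : ℤ) := Nat.prime_iff_prime_int.1 hr
  have hcy : ¬ (r : ℤ) ∣ 2 * c * y := fun hd => by
    have : (r : ℤ) ∣ c * y := (hp.dvd_or_dvd (by rwa [mul_assoc] at hd)).resolve_left h2
    have h3 : (r : ℤ) ∣ 1 := by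
      have e : (1 : ℤ) = r * u + c * y * y := by rw [← hu]; ring
      rw [e]
      exact dvd_add (dvd_mul_right _ _) (this.mul_right _)
    exact hp.not_isUnit (isUnit_of_dvd_one h3)
  obtain ⟨s, t, hst⟩ := (Prime.coprime_iff_not_dvd hp).2 hcy
  -- Newton step
  have h1 : ∃ z : ℤ, (r : ℤ) ^ 2 ∣ 1 - c * z ^ 2 ∧ ¬ (r : ℤ) ∣ 2 * c * z := by
    refine ⟨y + r * (u * t), ⟨u * s - c * (u * t) ^ 2, ?_⟩, ?_⟩
    · linear_combination hu - r * u * hst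
    · intro h
      apply hcy
      have := dvd_sub h (Dvd.intro (2 * c * (u * t)) (rfl : (r : ℤ) * (2 * c * (u * t)) = _))
      ring_nf at this ⊢
      exact this
  obtain ⟨z, hz, hz2⟩ := h1
  by_cases h3 : (r : ℤ) ^ 3 ∣ 1 - c * z ^ 2
  · refine ⟨z + r ^ 2, ?_, ?_⟩
    · have e : 1 - c * (z + r ^ 2) ^ 2 = (1 - c * z ^ 2) - r ^ 2 * (c * (2 * z + r ^ 2)) := by ring
      rw [e]
      exact dvd_sub hz (dvd_mul_right _ _)
    · intro h4
      have e : 1 - c * (z + r ^ 2) ^ 2 = (1 - c * z ^ 2) - r ^ 3 * (r * c) - r ^ 2 * (2 * c * z) := by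
        ring
      rw [e, dvd_sub_right (dvd_sub h3 (dvd_mul_right _ _)), pow_succ] at h4
      exact hz2 (Int.dvd_of_mul_dvd_mul_left (pow_ne_zero 2 hp.ne_zero) h4)
  · exact ⟨z, hz, h3⟩

theorem exists_avoiding_squares {c : ℤ} (W r : ℕ) (hr : r.Prime) {a₀ : ℤ} (ha₀ : 1 < a₀)
    (hW : 0 < W) (hz : ∀ q : ℕ, q.Prime → q ≤ 24 → q ∣ W * r) :
    ∃ j : ℕ, ∀ q : ℕ, q.Prime → ¬ q ∣ W → q ≠ r →
      ¬ (q : ℤ) ^ 2 ∣ a₀ + (W * r ^ 3 : ℕ) * j ∧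
      ¬ (q : ℤ) ^ 2 ∣ 1 - c * (a₀ + (W * r ^ 3 : ℕ) * j) ^ 2 := by
  set M : ℕ := W * r ^ 3 with hM
  have hMpos : 0 < M := Nat.mul_pos hW (pow_pos hr.pos 3)
  set K : ℕ := (c.natAbs + 1) * (a₀.natAbs + M) with hK
  have hKpos : 0 < K := by positivity
  obtain ⟨N₀, hN₀⟩ := primeCounting_mul_le K hKpos (ε := 1 / 12) (by norm_num)
  set N := N₀ + 1 with hN
  have hNpos : (0 : ℝ) < N := by positivity
  have hpi := hN₀ N (Nat.le_succ _)
  set T : Finset ℕ := {q ∈ range (K * N + 1) | q.Prime ∧ ¬ q ∣ W ∧ q ≠ r} with hT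
  set S : ℕ → Finset ℕ := fun q =>
    {j ∈ range N | ((q ^ 2 : ℕ) : ℤ) ∣ a₀ + (M : ℤ) * (j : ℕ)} ∪
    {j ∈ range N | (q ^ 2 : ℤ) ∣ 1 - c * (a₀ + (M : ℤ) * (j : ℕ)) ^ 2} with hS
  have hTq : ∀ q ∈ T, q.Prime ∧ 24 < q ∧ ¬ (q : ℤ) ∣ M := by
    intro q hq
    obtain ⟨-, hqp, hqW, hqr⟩ := mem_filter.1 hq
    have hqr' : ¬ q ∣ r := fun h => hqr ((Nat.prime_dvd_prime_iff_eq hqp hr).1 h)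
    refine ⟨hqp, ?_, ?_⟩
    · by_contra! h
      exact (hqp.dvd_mul.1 (hz q hqp h)).elim hqW hqr'
    · rw [Int.natCast_dvd_natCast, hM, hqp.dvd_mul]
      rintro (h | h)
      exacts [hqW h, hqr' (hqp.dvd_of_dvd_pow h)]
  have hScard : ∀ q ∈ T, ((#(S q) : ℕ) : ℝ) ≤ 3 * N * ((q : ℝ) ^ 2)⁻¹ + 3 := by
    intro q hq
    obtain ⟨hqp, h24, hqM⟩ := hTq q hq
    have h2 : ¬ (q : ℤ) ∣ 2 := by
      intro h
      have := Int.le_of_dvd (by norm_num) h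
      omega
    have h1 := card_dvd_linear_le N (pow_pos hqp.pos 2) a₀ M (by
      push_cast
      exact IsCoprime.pow_left
        ((Prime.coprime_iff_not_dvd (Nat.prime_iff_prime_int.1 hqp)).2 hqM))
    have h3 := card_sq_dvd_quadratic_le N hqp c a₀ M h2 hqM
    have h4 : #(S q) ≤ 3 * (N / q ^ 2) + 3 := by
      refine (card_union_le _ _).trans ((add_le_add h1 h3).trans ?_)
      omega
    have h5 : ((N / q ^ 2 : ℕ) : ℝ) ≤ N / ((q ^ 2 : ℕ) : ℝ) := Nat.cast_div_le
    have h6 : ((#(S q) : ℕ) : ℝ) ≤ 3 * ((N / q ^ 2 : ℕ) : ℝ) + 3 := by exact_mod_cast h4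
    push_cast at h5
    rw [div_eq_mul_inv] at h5
    linarith
  have hTcard : ((#T : ℕ) : ℝ) ≤ N / 12 := by
    refine le_trans ?_ (hpi.trans_eq (by ring))
    rw [Nat.cast_le, Nat.primeCounting, Nat.primeCounting', Nat.count_eq_card_filter_range]
    exact card_le_card (monotone_filter_right _ fun q _ h => h.1)
  have hsum : ∑ q ∈ T, ((q : ℝ) ^ 2)⁻¹ ≤ 2 / 25 := by
    have h1 := sum_Ioo_inv_sq_le (α := ℝ) 24 (K * N + 1)
    norm_num at h1
    refine le_trans (sum_le_sum_of_subset_of_nonneg ?_ fun _ _ _ => by positivity) h1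
    intro q hq
    rw [mem_Ioo]
    exact ⟨(hTq q hq).2.1, mem_range.1 (mem_filter.1 hq).1⟩
  have hbad : ((#(T.biUnion S) : ℕ) : ℝ) < N := by
    have h1 : ((#(T.biUnion S) : ℕ) : ℝ) ≤ ∑ q ∈ T, ((#(S q) : ℕ) : ℝ) := by
      exact_mod_cast card_biUnion_le
    have h2 := h1.trans (sum_le_sum hScard)
    rw [sum_add_distrib, ← mul_sum, sum_const, nsmul_eq_mul] at h2
    nlinarith
  have hlt : #(T.biUnion S) < #(range N) := by rw [card_range]; exact_mod_cast hbad
  obtain ⟨j, hjN, hj⟩ := exists_mem_notMem_of_card_lt_card hlt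
  refine ⟨j, fun q hq hqW hqr => ?_⟩
  have hjN' : (j : ℤ) < N := by exact_mod_cast mem_range.1 hjN
  have hNone : (1 : ℤ) ≤ N := by rw [hN]; push_cast; omega
  set a : ℤ := a₀ + M * j with ha
  have hapos : 0 < a := by positivity
  have hale : a ≤ (a₀.natAbs + M) * N := by
    rw [Int.natCast_natAbs, abs_of_pos (by omega), ha]
    nlinarith
  have key : ∀ x : ℤ, x ≠ 0 → |x| ≤ (K * N) ^ 2 → (q : ℤ) ^ 2 ∣ x → q ∈ T := by
    intro x hx hle hd
    refine mem_filter.2 ⟨mem_range.2 (Nat.lt_succ_of_le ?_), hq, hqW, hqr⟩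
    have h1 : (q : ℤ) ^ 2 ≤ |x| := Int.le_of_dvd (abs_pos.2 hx) ((dvd_abs _ _).2 hd)
    have := abs_le_of_sq_le_sq (h1.trans hle) (by positivity)
    rw [abs_of_nonneg (by positivity)] at this
    exact_mod_cast this
  have hKN : (K * N : ℤ) = (|c| + 1) * ((a₀.natAbs + M) * N) := by
    rw [hK]; push_cast; ring
  have hc : 0 ≤ |c| := abs_nonneg c
  have hKa : (|c| + 1) * a ≤ K * N := by
    rw [hKN]
    exact mul_le_mul_of_nonneg_left hale (by positivity)
  have hnot : ∀ h : q ∈ T, j ∉ S q := fun h hjS => hj (mem_biUnion.2 ⟨q, h, hjS⟩)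
  constructor
  · intro hd
    refine hnot (key a hapos.ne' ?_ hd) (mem_union_left _ (mem_filter.2 ⟨hjN, by exact_mod_cast hd⟩))
    rw [abs_of_pos hapos]
    have h1 : a ≤ K * N := le_trans (by nlinarith) hKa
    exact h1.trans (le_self_pow₀ (by omega) two_ne_zero)
  · intro hd
    refine hnot (key _ ?_ ?_ hd) (mem_union_right _ (mem_filter.2 ⟨hjN, hd⟩))
    · intro h
      have h1 : c * a ^ 2 = 1 := by omega
      have h2 : 2 ≤ a := by rw [ha]; nlinarith [mul_nonneg (Int.natCast_nonneg M) (Int.natCast_nonneg j)]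
      have h3 : a ∣ 1 := ⟨c * a, by rw [← h1]; ring⟩
      have := Int.le_of_dvd one_pos h3
      omega
    · have h1 : |1 - c * a ^ 2| ≤ 1 + |c| * a ^ 2 := by
        refine (abs_sub _ _).trans_eq ?_
        rw [abs_one, abs_mul, abs_of_nonneg (sq_nonneg a)]
      refine h1.trans (le_trans ?_ (pow_le_pow_left₀ (by positivity) hKa 2))
      nlinarith [mul_nonneg hc (sq_nonneg a), mul_nonneg (mul_nonneg hc hc) (sq_nonneg a)]

/-- The sieve: there is `a ≡ 1 mod W` such that `a` and `1 - c * a ^ 2` are squarefree away from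
`W` and `r`, while `r ^ 2` exactly divides `1 - c * a ^ 2`. -/
theorem exists_sieved {c : ℤ} {W r : ℕ} (hW : 0 < W) (h2W : 2 ∣ W)
    (hcW : 1 - c ∣ W) (hr : r.Prime) (hrW : ¬ r ∣ W) (hrc : ∃ y : ℤ, (r : ℤ) ∣ 1 - c * y ^ 2) :
    ∃ a : ℤ, 1 < a ∧ (W : ℤ) ∣ a - 1 ∧ (r : ℤ) ^ 2 ∣ 1 - c * a ^ 2 ∧
      ¬ (r : ℤ) ^ 3 ∣ 1 - c * a ^ 2 ∧
      ∀ q : ℕ, q.Prime → ¬ q ∣ W → q ≠ r →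
        ¬ (q : ℤ) ^ 2 ∣ a ∧ ¬ (q : ℤ) ^ 2 ∣ 1 - c * a ^ 2 := by
  have hr2 : ¬ (r : ℤ) ∣ 2 := by
    intro h
    exact hrW ((Int.natCast_dvd_natCast.1 (by exact_mod_cast h) : r ∣ 2).trans h2W)
  obtain ⟨y, hy2, hy3⟩ := exists_sq_exactly_dvd hr hr2 hrc
  set W' : ℕ := W * ∏ q ∈ range 25 with q.Prime ∧ q ≠ r, q with hW'
  have hW'pos : 0 < W' := by
    refine Nat.mul_pos hW (prod_pos fun q hq => ?_)
    exact (mem_filter.1 hq).2.1.pos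
  have hrW' : ¬ r ∣ W' := by
    rw [hW', hr.dvd_mul]
    rintro (h | h)
    · exact hrW h
    · obtain ⟨q, hq, hd⟩ := (hr.prime.dvd_finsetProd_iff _).1 h
      have := (mem_filter.1 hq).2
      exact this.2 ((Nat.prime_dvd_prime_iff_eq hr this.1).1 hd).symm
  have hcop : IsCoprime (W' : ℤ) ((r : ℤ) ^ 3) := by
    refine IsCoprime.pow_right ?_
    rw [Nat.isCoprime_iff_coprime, Nat.coprime_comm]
    exact (Nat.Prime.coprime_iff_not_dvd hr).2 hrW'
  obtain ⟨u, v, huv⟩ := hcop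
  set M : ℕ := W' * r ^ 3 with hM
  have hMpos : 0 < M := Nat.mul_pos hW'pos (pow_pos hr.pos 3)
  set a₁ : ℤ := 1 + u * W' * (y - 1) with ha₁
  set a₀ : ℤ := a₁ + M * (|a₁| + 2) with ha₀
  have ha₀pos : 1 < a₀ := by
    have h1 := neg_abs_le a₁
    have h2 : (1 : ℤ) ≤ M := by exact_mod_cast hMpos
    have h3 := abs_nonneg a₁
    nlinarith
  obtain ⟨j, hj⟩ := exists_avoiding_squares (c := c) W' r hr ha₀pos hW'pos (fun q hq h => by
    by_cases hqr : q = r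
    · exact hqr ▸ dvd_mul_left _ _
    · refine Dvd.dvd.mul_right (Dvd.dvd.mul_left (dvd_prod_of_mem _ ?_) _) _
      exact mem_filter.2 ⟨mem_range.2 (by omega), hq, hqr⟩)
  set a : ℤ := a₀ + (W' * r ^ 3 : ℕ) * j with ha
  have ha1 : (W' : ℤ) ∣ a - 1 := by
    refine ⟨u * (y - 1) + r ^ 3 * (|a₁| + 2) + r ^ 3 * j, ?_⟩
    rw [ha, ha₀, hM]
    nth_rw 1 [ha₁]
    push_cast
    ring
  have hay : (r : ℤ) ^ 3 ∣ a - y := by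
    refine ⟨-v * (y - 1) + W' * (|a₁| + 2) + W' * j, ?_⟩
    rw [ha, ha₀, hM]
    nth_rw 1 [ha₁]
    push_cast
    linear_combination (y - 1) * huv
  have hr3 : (r : ℤ) ^ 3 ∣ (1 - c * a ^ 2) - (1 - c * y ^ 2) := by
    obtain ⟨t, ht⟩ := hay
    exact ⟨-c * t * (a + y), by linear_combination (-c * (a + y)) * ht⟩
  refine ⟨a, ?_, ?_, ?_, ?_, ?_⟩
  · have : (0 : ℤ) ≤ (W' * r ^ 3 : ℕ) * j := by positivity
    omega
  · exact (Int.natCast_dvd_natCast.2 (dvd_mul_right _ _)).trans ha1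
  · have := dvd_add ((pow_dvd_pow (r : ℤ) (by norm_num : 2 ≤ 3)).trans hr3) hy2
    rwa [sub_add_cancel] at this
  · exact fun h => hy3 ((dvd_sub_right h).1 hr3)
  · intro q hq hqW hqr
    by_cases hqW' : q ∣ W'
    · have hqp : Prime (q : ℤ) := Nat.prime_iff_prime_int.1 hq
      have h1 : (q : ℤ) ∣ a - 1 := (Int.natCast_dvd_natCast.2 hqW').trans ha1
      have hqq : (q : ℤ) ∣ q ^ 2 := dvd_pow_self _ two_ne_zero
      refine ⟨fun h => ?_, fun h => ?_⟩
      · exact hqp.not_isUnit (isUnit_of_dvd_one ((dvd_sub_right (hqq.trans h)).1 h1))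
      · have h2 : (q : ℤ) ∣ 1 - c := by
          have e : 1 - c = (1 - c * a ^ 2) + (a - 1) * (c * (a + 1)) := by ring
          rw [e]
          exact dvd_add (hqq.trans h) (h1.mul_right _)
        exact hqW (Int.natCast_dvd_natCast.1 (h2.trans hcW))
    · exact hj q hq hqW' hqr

end AltDisc

namespace AltDisc

/-- If `r ≡ 1 mod 8 c` then `c` is a square modulo `r`. -/
theorem isSquare_of_modEq_one {c : ℤ} {r : ℕ} [Fact r.Prime]
    (h : r ≡ 1 [MOD 8 * c.natAbs]) : IsSquare (c : ZMod r) := by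
  have h8 : r ≡ 1 [MOD 8] := Nat.ModEq.of_mul_right _ h
  have h4 : r ≡ 1 [MOD 4] := h8.of_dvd (by norm_num)
  have hodd : Odd r := by
    rw [Nat.odd_iff]; exact h8.of_dvd (by norm_num : 2 ∣ 8)
  have h1 : jacobiSym c r = 1 := by
    rw [jacobiSym.mod_right c hodd]
    have : r % (4 * c.natAbs) = 1 % (4 * c.natAbs) := by
      refine h.of_dvd ?_
      exact Nat.mul_dvd_mul_right (by norm_num) _
    rw [this]
    rcases Nat.eq_zero_or_pos c.natAbs with h0 | h0
    · simp [h0]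
    · rw [Nat.mod_eq_of_lt (by omega)]; simp
  rw [← jacobiSym.legendreSym.to_jacobiSym] at h1
  by_cases hc : (c : ZMod r) = 0
  · rw [hc]; exact IsSquare.zero
  · exact (legendreSym.eq_one_iff r hc).1 h1

theorem exists_prime_modEq {c : ℤ} (hc : c ≠ 0) {p : ℕ} (hp : p.Prime)
    (hpc : ¬ p ∣ 8 * c.natAbs) {t : ℤ} (ht : ¬ (p : ℤ) ∣ t) (N : ℕ) :
    ∃ r : ℕ, r.Prime ∧ N < r ∧ (r : ℤ) ≡ t [ZMOD p] ∧ ∃ y : ℤ, (r : ℤ) ∣ 1 - c * y ^ 2 := by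
  have hcop : Nat.Coprime p (8 * c.natAbs) := (Nat.Prime.coprime_iff_not_dvd hp).2 hpc
  have hcpos : 0 < c.natAbs := Int.natAbs_pos.2 hc
  obtain ⟨t', ht'⟩ : ∃ t' : ℕ, (t' : ℤ) ≡ t [ZMOD p] := by
    refine ⟨(t % p).toNat, ?_⟩
    rw [Int.toNat_of_nonneg (Int.emod_nonneg _ (by exact_mod_cast hp.ne_zero))]
    exact Int.mod_modEq _ _
  obtain ⟨b, hb1, hb2⟩ := Nat.chineseRemainder hcop t' 1
  have hbp : Nat.Coprime b p := by
    rw [Nat.coprime_comm, Nat.Prime.coprime_iff_not_dvd hp]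
    intro h
    have h1 : (p : ℤ) ∣ t' := Int.natCast_dvd_natCast.2 ((hb1.dvd_iff dvd_rfl).1 h)
    exact ht (ht'.dvd_iff.1 h1)
  have hb8 : Nat.Coprime b (8 * c.natAbs) := by
    rw [Nat.Coprime, hb2.gcd_eq]; simp
  have : NeZero (p * (8 * c.natAbs)) := ⟨by have := hp.pos; positivity⟩
  obtain ⟨r, hrN, hr, hrb⟩ := Nat.forall_exists_prime_gt_and_eq_mod
    (q := p * (8 * c.natAbs)) (a := (b : ZMod _))
    ((ZMod.isUnit_iff_coprime _ _).2 (Nat.Coprime.mul_right hbp hb8)) (N + c.natAbs)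
  rw [ZMod.natCast_eq_natCast_iff] at hrb
  have : Fact r.Prime := ⟨hr⟩
  refine ⟨r, hr, by omega, ?_, ?_⟩
  · have h1 : r ≡ t' [MOD p] := (hrb.of_mul_right _).trans hb1
    exact (Int.natCast_modEq_iff.2 h1).trans ht'
  · obtain ⟨y, hy⟩ := isSquare_of_modEq_one (c := c) (r := r) ((hrb.of_mul_left _).trans hb2)
    have hc0 : (c : ZMod r) ≠ 0 := by
      rw [Ne, ZMod.intCast_zmod_eq_zero_iff_dvd]
      intro h
      have := Nat.le_of_dvd hcpos (Int.natCast_dvd.1 h)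
      omega
    obtain ⟨z, hz⟩ := ZMod.intCast_surjective (y⁻¹ : ZMod r)
    refine ⟨z, ?_⟩
    rw [← ZMod.intCast_zmod_eq_zero_iff_dvd]
    have hy0 : y ≠ 0 := by rintro rfl; simp at hy; exact hc0 hy
    push_cast
    rw [hz, hy]
    field_simp
    ring

end AltDisc

namespace AltDisc

open Ideal

section ord

variable {R : Type*} [CommRing R]

/-- The order of `y` at the prime ideal `P` (meaningful for `y ≠ 0`). -/
noncomputable def ord (P : Ideal R) (y : R) : ℕ := multiplicity P (span {y})

variable {P : Ideal R}

theorem ord_neg (y : R) : ord P (-y) = ord P y := by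
  rw [ord, ord, Ideal.span_singleton_neg]

variable [IsDedekindDomain R]

theorem finiteMultiplicity_ideal [P.IsPrime] {I : Ideal R} (hI : I ≠ ⊥) :
    FiniteMultiplicity P I :=
  FiniteMultiplicity.of_not_isUnit (by
    rw [Ideal.isUnit_iff]; exact IsPrime.ne_top ‹_›) hI

theorem le_ord_iff [P.IsPrime] {y : R} (hy : y ≠ 0) {k : ℕ} : k ≤ ord P y ↔ y ∈ P ^ k := by
  rw [ord, ← (finiteMultiplicity_ideal (P := P) (by simpa using hy)).pow_dvd_iff_le_multiplicity,
    Ideal.dvd_span_singleton]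

theorem ord_pos_iff [P.IsPrime] {y : R} (hy : y ≠ 0) : 0 < ord P y ↔ y ∈ P := by
  rw [Nat.lt_iff_add_one_le, le_ord_iff hy, zero_add, pow_one]

theorem ord_eq_zero_iff [P.IsPrime] {y : R} (hy : y ≠ 0) : ord P y = 0 ↔ y ∉ P := by
  rw [← ord_pos_iff hy]; omega

theorem ord_mul [P.IsPrime] (hP : P ≠ ⊥) {y z : R} (hy : y ≠ 0) (hz : z ≠ 0) :
    ord P (y * z) = ord P y + ord P z := by
  rw [ord, ← Ideal.span_singleton_mul_span_singleton]
  refine multiplicity_mul (Ideal.prime_of_isPrime hP ‹_›) ?_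
  rw [Ideal.span_singleton_mul_span_singleton]
  exact finiteMultiplicity_ideal (by simpa using ⟨hy, hz⟩)

theorem ord_pow [P.IsPrime] (hP : P ≠ ⊥) {y : R} (hy : y ≠ 0) (k : ℕ) :
    ord P (y ^ k) = k * ord P y := by
  rw [ord, ← Ideal.span_singleton_pow]
  exact (finiteMultiplicity_ideal (by simpa using hy)).multiplicity_pow
    (Ideal.prime_of_isPrime hP ‹_›)

theorem le_ord_add [P.IsPrime] {y z : R} (hy : y ≠ 0) (hz : z ≠ 0) (hyz : y + z ≠ 0) {k : ℕ}
    (h1 : k ≤ ord P y) (h2 : k ≤ ord P z) : k ≤ ord P (y + z) := by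
  rw [le_ord_iff ‹_›] at *
  exact add_mem h1 h2

omit [IsDedekindDomain R] in
theorem add_ne_zero_of_ord_lt {y z : R} (h : ord P y < ord P z) : y + z ≠ 0 := by
  intro h0
  rw [eq_neg_of_add_eq_zero_left h0, ord_neg] at h
  exact lt_irrefl _ h

theorem ord_add_eq [P.IsPrime] {y z : R} (hy : y ≠ 0) (hz : z ≠ 0) (h : ord P y < ord P z) :
    ord P (y + z) = ord P y := by
  have h0 := add_ne_zero_of_ord_lt h
  refine le_antisymm ?_ (le_ord_add hy hz h0 le_rfl h.le)
  by_contra! h1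
  have h2 : ord P y + 1 ≤ ord P (y + z + -z) := by
    refine le_ord_add h0 (neg_ne_zero.2 hz) (by simpa using hy) h1 ?_
    rw [ord_neg]; exact h
  rw [add_neg_cancel_right] at h2
  omega

theorem ord_le_of_dvd [P.IsPrime] {y z : R} (hz : z ≠ 0) (h : y ∣ z) : ord P y ≤ ord P z := by
  have hy : y ≠ 0 := fun h0 => hz (zero_dvd_iff.1 (h0 ▸ h))
  rw [le_ord_iff hz]
  exact Ideal.mem_of_dvd _ h ((le_ord_iff hy).1 le_rfl)

theorem ideal_dvd_of_multiplicity_le {I J : Ideal R} (hI : I ≠ ⊥) (hJ : J ≠ ⊥)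
    (h : ∀ P : Ideal R, P.IsPrime → P ≠ ⊥ → I ≤ P → multiplicity P I ≤ multiplicity P J) :
    I ∣ J := by
  classical
  rw [UniqueFactorizationMonoid.dvd_iff_normalizedFactors_le_normalizedFactors hI hJ,
    Multiset.le_iff_count]
  intro P
  by_cases hP : P ∈ UniqueFactorizationMonoid.normalizedFactors I
  · have hPp : Prime P := UniqueFactorizationMonoid.prime_of_normalized_factor P hP
    have hPprime := Ideal.isPrime_of_prime hPp
    have := h P hPprime hPp.ne_zero (Ideal.le_of_dvd
      (UniqueFactorizationMonoid.dvd_of_mem_normalizedFactors hP))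
    have h1 := UniqueFactorizationMonoid.emultiplicity_eq_count_normalizedFactors
      hPp.irreducible hI
    have h2 := UniqueFactorizationMonoid.emultiplicity_eq_count_normalizedFactors
      hPp.irreducible hJ
    rw [normalize_eq] at h1 h2
    rwa [multiplicity_eq_of_emultiplicity_eq_some h1,
      multiplicity_eq_of_emultiplicity_eq_some h2] at this
  · rw [Multiset.count_eq_zero_of_notMem hP]; exact Nat.zero_le _

theorem dvd_of_ord_le {y z : R} (hy : y ≠ 0) (hz : z ≠ 0)
    (h : ∀ P : Ideal R, P.IsPrime → P ≠ ⊥ → y ∈ P → ord P y ≤ ord P z) : y ∣ z := by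
  rw [← Ideal.span_singleton_le_span_singleton, ← Ideal.dvd_iff_le]
  exact ideal_dvd_of_multiplicity_le (by simpa using hy) (by simpa using hz)
    fun P hP hP0 hyP => h P hP hP0 ((Ideal.span_singleton_le_iff_mem _).1 hyP)

end ord

section rational

variable {R : Type*} [CommRing R] [CharZero R] {P : Ideal R} {q : ℕ}

theorem ne_bot_of_natCast_mem (hq : q.Prime) (hqP : (q : R) ∈ P) : P ≠ ⊥ := by
  rintro rfl
  exact hq.ne_zero (by exact_mod_cast (Ideal.mem_bot.1 hqP))

variable [P.IsPrime]

theorem intCast_mem_iff (hq : q.Prime) (hqP : (q : R) ∈ P) (k : ℤ) :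
    (k : R) ∈ P ↔ (q : ℤ) ∣ k := by
  constructor
  · intro hk
    by_contra h
    obtain ⟨u, v, huv⟩ := (Prime.coprime_iff_not_dvd (Nat.prime_iff_prime_int.1 hq)).2 h
    apply IsPrime.ne_top ‹P.IsPrime›
    rw [Ideal.eq_top_iff_one]
    have : (1 : R) = u * q + v * k := by exact_mod_cast congrArg (Int.cast : ℤ → R) huv.symm
    rw [this]
    exact add_mem (P.mul_mem_left _ hqP) (P.mul_mem_left _ hk)
  · rintro ⟨t, rfl⟩
    push_cast
    exact P.mul_mem_right _ hqP

theorem liesOver_span (hq : q.Prime) (hqP : (q : R) ∈ P) : P.LiesOver (span {(q : ℤ)}) := by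
  refine ⟨?_⟩
  ext k
  rw [Ideal.mem_span_singleton, Ideal.under_def, Ideal.mem_comap, eq_intCast,
    intCast_mem_iff hq hqP]

variable [IsDedekindDomain R]

theorem ord_natCast_pos (hq : q.Prime) (hqP : (q : R) ∈ P) : 0 < ord P (q : R) :=
  (ord_pos_iff (by exact_mod_cast hq.ne_zero)).2 hqP

theorem ord_intCast (hq : q.Prime) (hqP : (q : R) ∈ P) {k : ℤ} {v : ℕ} {u : ℤ}
    (hk : k = q ^ v * u) (hu : ¬ (q : ℤ) ∣ u) : ord P (k : R) = v * ord P (q : R) := by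
  have hP := ne_bot_of_natCast_mem hq hqP
  have hq0 : (q : R) ≠ 0 := by exact_mod_cast hq.ne_zero
  have hu0 : (u : R) ≠ 0 := by
    have : u ≠ 0 := by rintro rfl; exact hu (dvd_zero _)
    exact_mod_cast this
  rw [hk]
  push_cast
  rw [ord_mul hP (pow_ne_zero _ hq0) hu0, ord_pow hP hq0,
    (ord_eq_zero_iff hu0).2 fun h => hu ((intCast_mem_iff hq hqP u).1 h), add_zero]

theorem ord_natCast_eq_ramificationIdx (hq : q.Prime) (hqP : (q : R) ∈ P) :
    ord P (q : R) = P.ramificationIdx ℤ := by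
  have := liesOver_span hq hqP
  have h : (span {(q : ℤ)}).map (algebraMap ℤ R) = span {(q : R)} := by
    rw [Ideal.map_span, Set.image_singleton]; simp
  rw [Ideal.IsDedekindDomain.ramificationIdx_eq_multiplicity (span {(q : ℤ)}) P, ord, h]
  rw [h]
  simpa using hq.ne_zero

end rational

theorem ramificationIdx_le_finrank {A B : Type*} [CommRing A] [CommRing B] [Algebra A B]
    [IsDomain A] [Module.Finite A B] [Module.Flat A B] (P : Ideal B) [P.IsPrime] :
    P.ramificationIdx A ≤ Module.finrank A B := by
  have : Fintype ((P.under A).primesOver B) :=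
    (Algebra.QuasiFinite.finite_primesOver _).fintype
  rw [← Ideal.sum_ramification_inertia_eq_finrank (P.under A) ]
  refine le_trans ?_ (Finset.single_le_sum (fun _ _ => Nat.zero_le _)
    (Finset.mem_univ (⟨P, ‹_›, ⟨rfl⟩⟩ : (P.under A).primesOver B)))
  exact Nat.le_mul_of_pos_right _ (Ideal.inertiaDeg_pos _ _)

end AltDisc

namespace AltDisc

open Ideal NumberField

section different

variable {F : Type*} [Field F] [NumberField F]

theorem dvd_norm_int (y : 𝓞 F) : y ∣ (Algebra.norm ℤ y : 𝓞 F) := by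
  have h := (span {y}).absNorm_mem
  rw [Ideal.absNorm_span_singleton, Ideal.mem_span_singleton] at h
  rcases Int.natAbs_eq (Algebra.norm ℤ y) with h1 | h1 <;> rw [h1]
  · rwa [Int.cast_natCast]
  · rwa [Int.cast_neg, Int.cast_natCast, dvd_neg]

theorem ord_sub_one_le_multiplicity_differentIdeal {P : Ideal (𝓞 F)} [P.IsPrime] {q : ℕ}
    (hq : q.Prime) :
    ord P (q : 𝓞 F) - 1 ≤ multiplicity P (differentIdeal ℤ (𝓞 F)) := by
  have h0 : span {(q : ℤ)} ≠ ⊥ := by simpa using hq.ne_zero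
  have hmax : (span {(q : ℤ)}).IsMaximal :=
    PrincipalIdealRing.isMaximal_of_irreducible (Nat.prime_iff_prime_int.1 hq).irreducible
  have hd : differentIdeal ℤ (𝓞 F) ≠ ⊥ := differentIdeal_ne_bot
  have h : P ^ ord P (q : 𝓞 F) ∣ (span {(q : ℤ)}).map (algebraMap ℤ (𝓞 F)) := by
    rw [Ideal.map_span, Set.image_singleton, Ideal.dvd_span_singleton]
    simpa using (le_ord_iff (P := P) (y := (q : 𝓞 F)) (by exact_mod_cast hq.ne_zero)).1 le_rfl
  exact ((finiteMultiplicity_ideal (P := P) hd).pow_dvd_iff_le_multiplicity).1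
    (pow_sub_one_dvd_differentIdeal ℤ P _ h0 h)

theorem pow_dvd_discr {q : ℕ} (hq : q.Prime) {y : 𝓞 F} (hy : y ≠ 0) {s j : ℕ} {u : ℤ}
    (hN : Algebra.norm ℤ y = q ^ s * u) (hu : ¬ (q : ℤ) ∣ u)
    (h : ∀ P : Ideal (𝓞 F), P.IsPrime → (q : 𝓞 F) ∈ P → y ∈ P →
      j * ord P y + 1 ≤ ord P (q : 𝓞 F)) :
    (q : ℤ) ^ (j * s) ∣ discr F := by
  have hu0 : u ≠ 0 := by rintro rfl; exact hu (dvd_zero _)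
  have hu0' : (u : 𝓞 F) ≠ 0 := by exact_mod_cast hu0
  have hd : differentIdeal ℤ (𝓞 F) ≠ ⊥ := differentIdeal_ne_bot
  have hys : (span {y} : Ideal (𝓞 F)) ≠ ⊥ := by simpa using hy
  have hus : (span {(u : 𝓞 F)} : Ideal (𝓞 F)) ≠ ⊥ := by simpa using hu0'
  have hpr : differentIdeal ℤ (𝓞 F) * span {(u : 𝓞 F)} ^ j ≠ ⊥ :=
    mul_ne_zero hd (pow_ne_zero j hus)
  have hdvd : (span {y}) ^ j ∣ differentIdeal ℤ (𝓞 F) * span {(u : 𝓞 F)} ^ j := by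
    refine ideal_dvd_of_multiplicity_le (pow_ne_zero j hys) hpr fun P hP hP0 hyP => ?_
    have hyP' : y ∈ P := by
      have := IsPrime.le_of_pow_le hyP
      exact (Ideal.span_singleton_le_iff_mem _).1 this
    have hPp := Ideal.prime_of_isPrime hP0 hP
    rw [multiplicity_mul hPp (finiteMultiplicity_ideal hpr),
      (finiteMultiplicity_ideal hys).multiplicity_pow hPp,
      (finiteMultiplicity_ideal hus).multiplicity_pow hPp]
    change j * ord P y ≤ _ + j * ord P (u : 𝓞 F)
    by_cases hqP : (q : 𝓞 F) ∈ P
    · have h1 := h P hP hqP hyP'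
      have h2 := ord_sub_one_le_multiplicity_differentIdeal (P := P) hq
      omega
    · have hq0 : (q : 𝓞 F) ≠ 0 := by exact_mod_cast hq.ne_zero
      have h1 : ord P y ≤ ord P (u : 𝓞 F) := by
        have h2 := dvd_norm_int y
        rw [hN] at h2
        push_cast at h2
        have h3 := ord_le_of_dvd (P := P) (mul_ne_zero (pow_ne_zero s hq0) hu0') h2
        rwa [ord_mul hP0 (pow_ne_zero _ hq0) hu0', ord_pow hP0 hq0, (ord_eq_zero_iff hq0).2 hqP,
          mul_zero, zero_add] at h3
      exact le_add_left (Nat.mul_le_mul_left j h1)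
  have h1 := map_dvd (Ideal.absNorm (S := 𝓞 F)) hdvd
  rw [map_mul, map_pow, map_pow, NumberField.absNorm_differentIdeal F (𝓞 F),
    Ideal.absNorm_span_singleton, Ideal.absNorm_span_singleton, hN, Int.natAbs_mul, Int.natAbs_pow,
    Int.natAbs_natCast, mul_pow, ← pow_mul, mul_comm s j] at h1
  rw [← Int.natCast_pow, Int.natCast_dvd]
  refine Nat.Coprime.dvd_of_dvd_mul_right ?_ ((dvd_mul_right _ _).trans h1)
  have h2 : Algebra.norm ℤ (u : 𝓞 F) = u ^ Module.finrank ℤ (𝓞 F) := by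
    rw [← eq_intCast (algebraMap ℤ (𝓞 F)), Algebra.norm_algebraMap]
  rw [h2, Int.natAbs_pow]
  refine Nat.Coprime.pow _ _ (Nat.Coprime.pow_right _ ((Nat.Prime.coprime_iff_not_dvd hq).2 ?_))
  rwa [← Int.natCast_dvd]

end different

end AltDisc

namespace AltDisc

open NumberField Polynomial

section index

variable {F : Type*} [Field F] [NumberField F]

theorem minpoly_rat_eq_map (x : 𝓞 F) : minpoly ℚ (x : F) = (minpoly ℤ x).map (algebraMap ℤ ℚ) :=
  minpoly.isIntegrallyClosed_eq_field_fractions ℚ F (RingOfIntegers.isIntegral x)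

/-- The power basis of a number field generated by an algebraic integer of full degree. -/
noncomputable def powerBasisOfDegree (x : 𝓞 F)
    (hx : (minpoly ℤ x).natDegree = Module.finrank ℚ F) : PowerBasis ℚ F :=
  have hd : (minpoly ℤ x).natDegree = (minpoly ℚ (x : F)).natDegree := by
    rw [minpoly_rat_eq_map, (minpoly.monic (RingOfIntegers.isIntegral x)).natDegree_map]
  { gen := x
    dim := (minpoly ℤ x).natDegree
    basis := basisOfLinearIndependentOfCardEqFinrank'
      (fun i : Fin (minpoly ℤ x).natDegree => (x : F) ^ (i : ℕ))
      ((linearIndependent_pow (x : F)).comp (Fin.cast hd) (Fin.cast_injective hd))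
      (by rw [Fintype.card_fin, hx])
    basis_eq_pow := fun i => by simp }

/-- The index of `ℤ[x]` in the ring of integers. -/
noncomputable def polyIndex (x : 𝓞 F) : ℕ :=
  (Subalgebra.toSubmodule (Algebra.adjoin ℤ {x})).toAddSubgroup.index

/-- The powers of `x` as a basis of `ℤ[x]`. -/
noncomputable def adjoinBasis (x : 𝓞 F) :
    Module.Basis (Fin (minpoly ℤ x).natDegree) ℤ
      (Subalgebra.toSubmodule (Algebra.adjoin ℤ {x})).toAddSubgroup :=
  (Algebra.adjoin.powerBasis' (RingOfIntegers.isIntegral x)).basis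

theorem coe_adjoinBasis (x : 𝓞 F) (i : Fin (minpoly ℤ x).natDegree) :
    (adjoinBasis x i : 𝓞 F) = x ^ (i : ℕ) := by
  have h := congrArg Subtype.val
    ((Algebra.adjoin.powerBasis' (RingOfIntegers.isIntegral x)).basis_eq_pow i)
  rw [Algebra.adjoin.powerBasis'_gen] at h
  exact h

theorem polyIndex_eq_natAbs_det {x : 𝓞 F}
    (b : Module.Basis (Fin (minpoly ℤ x).natDegree) ℤ (𝓞 F)) :
    polyIndex x = (b.det fun i => x ^ (i : ℕ)).natAbs := by
  rw [polyIndex, AddSubgroup.index_eq_natAbs_det b _ (adjoinBasis x)]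
  simp_rw [coe_adjoinBasis]

/-- An integral basis indexed by `Fin n`. -/
noncomputable def integralFinBasis {n : ℕ} (hn : n = Module.finrank ℚ F) :
    Module.Basis (Fin n) ℤ (𝓞 F) :=
  (RingOfIntegers.basis F).reindex (Fintype.equivOfCardEq (by
    rw [← Module.finrank_eq_card_basis (RingOfIntegers.basis F), Fintype.card_fin, hn,
      RingOfIntegers.rank]))

theorem discr_pow_eq (x : 𝓞 F) (hx : (minpoly ℤ x).natDegree = Module.finrank ℚ F) :
    Algebra.discr ℤ (fun i : Fin (minpoly ℤ x).natDegree => x ^ (i : ℕ)) =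
      (polyIndex x : ℤ) ^ 2 * discr F := by
  classical
  set b : Module.Basis (Fin (minpoly ℤ x).natDegree) ℤ (𝓞 F) := integralFinBasis hx
  rw [polyIndex_eq_natAbs_det b, Int.natAbs_sq, ← discr_eq_discr F b, Module.Basis.det_apply,
    ← Algebra.discr_of_matrix_vecMul]
  congr 1
  ext1 i
  rw [b.toMatrix_map_vecMul]

theorem coe_discr_int {ι : Type*} [Fintype ι] [DecidableEq ι] (v : ι → 𝓞 F) :
    (Algebra.discr ℤ v : ℚ) = Algebra.discr ℚ fun i => (v i : F) := by
  rw [Algebra.discr_def, Algebra.discr_def, ← eq_intCast (algebraMap ℤ ℚ), RingHom.map_det]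
  congr 1
  ext i j
  simp only [RingHom.mapMatrix_apply, Matrix.map_apply, Algebra.traceMatrix_apply,
    Algebra.traceForm_apply, eq_intCast, Algebra.coe_trace_int, map_mul]

theorem coe_powerBasisOfDegree (x : 𝓞 F)
    (hx : (minpoly ℤ x).natDegree = Module.finrank ℚ F) :
    ⇑(powerBasisOfDegree x hx).basis =
      fun i : Fin (minpoly ℤ x).natDegree => ((x ^ (i : ℕ) : 𝓞 F) : F) := by
  funext i
  exact ((powerBasisOfDegree x hx).basis_eq_pow i).trans (map_pow (algebraMap (𝓞 F) F) x i).symm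

theorem norm_derivative_eq (x : 𝓞 F) (hx : (minpoly ℤ x).natDegree = Module.finrank ℚ F) :
    (-1) ^ (Module.finrank ℚ F * (Module.finrank ℚ F - 1) / 2) *
      Algebra.norm ℤ (aeval x (derivative (minpoly ℤ x))) = (polyIndex x : ℤ) ^ 2 * discr F := by
  rw [← discr_pow_eq x hx]
  have h1 := Algebra.discr_powerBasis_eq_norm ℚ (powerBasisOfDegree x hx)
  have h2 := coe_powerBasisOfDegree x hx
  have h3 : aeval (x : F) (derivative (minpoly ℚ (x : F))) =
      ((aeval x (derivative (minpoly ℤ x)) : 𝓞 F) : F) := by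
    rw [minpoly_rat_eq_map, derivative_map, aeval_map_algebraMap]
    exact aeval_algebraMap_apply F x _
  change Algebra.discr ℚ (powerBasisOfDegree x hx).basis =
    _ * Algebra.norm ℚ (aeval (x : F) (derivative (minpoly ℚ (x : F)))) at h1
  rw [h2, h3, ← Algebra.coe_norm_int] at h1
  have h4 := (coe_discr_int fun i : Fin (minpoly ℤ x).natDegree => x ^ (i : ℕ)).trans h1
  exact_mod_cast h4.symm

theorem polyIndex_ne_zero (x : 𝓞 F) (hx : (minpoly ℤ x).natDegree = Module.finrank ℚ F) :
    polyIndex x ≠ 0 := by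
  intro h0
  have h1 := discr_pow_eq x hx
  rw [h0, Nat.cast_zero, zero_pow two_ne_zero, zero_mul] at h1
  have h2 := coe_discr_int fun i : Fin (minpoly ℤ x).natDegree => x ^ (i : ℕ)
  have h3 := coe_powerBasisOfDegree x hx
  rw [h1, Int.cast_zero] at h2
  have h4 := Algebra.discr_not_zero_of_basis ℚ (powerBasisOfDegree x hx).basis
  rw [h3] at h4
  exact h4 h2.symm

theorem prod_dvd_polyIndex (x : 𝓞 F) (hx : (minpoly ℤ x).natDegree = Module.finrank ℚ F)
    (p : Fin (minpoly ℤ x).natDegree → ℤ[X]) (hp : ∀ i, (p i).Monic)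
    (hpd : ∀ i, (p i).natDegree = i) (d : Fin (minpoly ℤ x).natDegree → ℤ)
    (h : ∀ i, (d i : 𝓞 F) ∣ aeval x (p i)) : ∏ i, d i ∣ (polyIndex x : ℤ) := by
  choose θ hθ using h
  set b : Module.Basis (Fin (minpoly ℤ x).natDegree) ℤ (𝓞 F) := integralFinBasis hx
  have h1 : b.det (fun i => aeval x (p i)) = b.det fun i => x ^ (i : ℕ) := by
    have h2 : b.toMatrix (fun i => aeval x (p i)) = b.toMatrix (fun i : Fin (minpoly ℤ x).natDegree => x ^ (i : ℕ)) *
        Matrix.of fun i j : Fin (minpoly ℤ x).natDegree => (p j).coeff i := by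
      ext i j
      rw [Module.Basis.toMatrix_apply,
        aeval_eq_sum_range' (n := (minpoly ℤ x).natDegree) (by rw [hpd]; exact j.2),
        ← Fin.sum_univ_eq_sum_range (fun i => (p j).coeff i • x ^ i)]
      simp [Matrix.mul_apply, Module.Basis.toMatrix_apply, mul_comm, -zsmul_eq_mul]
    rw [Module.Basis.det_apply, h2, Matrix.det_mul, Matrix.det_matrixOfPolynomials p hpd hp,
      mul_one, Module.Basis.det_apply]
  have h3 : (fun i => aeval x (p i)) = fun i => d i • θ i := by
    funext i
    rw [hθ, zsmul_eq_mul]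
  rw [h3, AlternatingMap.map_smul_univ] at h1
  rw [polyIndex_eq_natAbs_det b, Int.dvd_natAbs, ← h1]
  exact dvd_mul_right _ _

end index

section group

variable {E : Type*} [AddCommGroup E]

theorem prime_dvd_of_smul_mem {H : AddSubgroup E} (hH : H.index ≠ 0) {p N : ℕ} (hp : p.Prime)
    (hpH : p ∣ H.index) (h : ∀ g : E, N • g ∈ H) : p ∣ N := by
  have : Fact p.Prime := ⟨hp⟩
  have : H.FiniteIndex := ⟨hH⟩
  have : Finite (E ⧸ H) := AddSubgroup.finite_quotient_of_finiteIndex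
  obtain ⟨g, hg⟩ := exists_prime_addOrderOf_dvd_card' (G := E ⧸ H) p hpH
  rw [← hg, addOrderOf_dvd_iff_nsmul_eq_zero]
  obtain ⟨g, rfl⟩ := QuotientAddGroup.mk_surjective g
  rw [← QuotientAddGroup.mk_nsmul, QuotientAddGroup.eq_zero_iff]
  exact h g

theorem relIndex_mul_eq_index {R D : AddSubgroup E} {A J N : ℕ} (hR : R.index = A * J)
    (hR0 : R.index ≠ 0) (hJN : J ∣ N) (hAN : A.Coprime N) (hDN : ∀ g : E, N • g ∈ D)
    (hND : ∀ g ∈ D, ∃ e, g = N • e) : D.relIndex R * J = D.index := by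
  have h1 : R.relIndex (R ⊔ D) * (R ⊔ D).index = A * J :=
    (AddSubgroup.relIndex_mul_index le_sup_left).trans hR
  have h0 : A * J ≠ 0 := hR ▸ hR0
  have hK0 : (R ⊔ D).index ≠ 0 := right_ne_zero_of_mul (h1 ▸ h0)
  have hK1 : R.relIndex (R ⊔ D) ≠ 0 := left_ne_zero_of_mul (h1 ▸ h0)
  have c1 : (R ⊔ D).index.Coprime A := by
    refine Nat.Coprime.symm (Nat.coprime_of_dvd fun p hp hpA hpK => ?_)
    have := prime_dvd_of_smul_mem hK0 (N := N) hp hpK fun g =>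
      (le_sup_right : D ≤ R ⊔ D) (hDN g)
    exact hp.one_lt.ne' (Nat.dvd_one.1 (hAN ▸ Nat.dvd_gcd hpA this))
  have c2 : (R.relIndex (R ⊔ D)).Coprime J := by
    refine Nat.Coprime.symm (Nat.coprime_of_dvd fun p hp hpJ hpK => ?_)
    have := prime_dvd_of_smul_mem (H := R.addSubgroupOf (R ⊔ D)) hK1 (N := A) hp hpK (by
      rintro ⟨g, hg⟩
      rw [AddSubgroup.mem_addSubgroupOf]
      obtain ⟨r, hr, d, hd, rfl⟩ := AddSubgroup.mem_sup.1 hg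
      obtain ⟨e, rfl⟩ := hND d hd
      change A • (r + N • e) ∈ R
      rw [smul_add]
      refine add_mem (R.nsmul_mem hr _) ?_
      obtain ⟨t, rfl⟩ := hJN
      rw [smul_smul, ← mul_assoc, ← hR, mul_comm, mul_smul]
      refine R.nsmul_mem ?_ _
      exact AddSubgroup.nsmul_index_mem R e)
    exact hp.one_lt.ne' (Nat.dvd_one.1 (hAN ▸ Nat.dvd_gcd this (hpJ.trans hJN)))
  have h2 : (R ⊔ D).index = J := by
    refine Nat.dvd_antisymm (c1.dvd_of_dvd_mul_left (h1 ▸ dvd_mul_left _ _)) ?_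
    exact (Nat.Coprime.symm c2).dvd_of_dvd_mul_left (h1.symm ▸ dvd_mul_left _ _)
  rw [← AddSubgroup.relIndex_sup_right, ← AddSubgroup.relIndex_mul_index
    (le_sup_right : D ≤ R ⊔ D), h2]

end group

section numberField

variable {F F' : Type*} [Field F] [NumberField F] [Field F'] [NumberField F']

theorem dvd_aeval_of_dvd_sub {x : 𝓞 F} {x' : 𝓞 F'} {Δ : ℤ} (hΔ : Δ ≠ 0) {n : ℕ}
    (hn : Module.finrank ℚ F ≤ n) (hf : C (Δ ^ n) ∣ minpoly ℤ x - minpoly ℤ x') {h : ℤ[X]}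
    (hd : (Δ : 𝓞 F) ∣ aeval x h) : (Δ : 𝓞 F') ∣ aeval x' h := by
  obtain ⟨z, hz⟩ := hd
  obtain ⟨g, hg⟩ := hf
  have hzi := RingOfIntegers.isIntegral z
  have hdeg : (minpoly ℤ z).natDegree ≤ n := by
    rw [← (minpoly.monic hzi).natDegree_map (algebraMap ℤ ℚ), ← minpoly_rat_eq_map]
    exact (minpoly.natDegree_le _).trans hn
  have h1 : minpoly ℤ x ∣ ((minpoly ℤ z).scaleRoots Δ).comp h := by
    refine minpoly.isIntegrallyClosed_dvd (RingOfIntegers.isIntegral x) ?_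
    rw [aeval_comp, hz]
    exact scaleRoots_aeval_eq_zero (minpoly.aeval ℤ z)
  obtain ⟨Q, hQ⟩ := h1
  have h2 := congrArg (aeval x') hQ
  rw [aeval_comp, map_mul, show minpoly ℤ x = minpoly ℤ x' + C (Δ ^ n) * g by rw [← hg]; ring,
    map_add, minpoly.aeval, zero_add, map_mul, aeval_C, eq_intCast] at h2
  have hΔ' : (Δ : F') ≠ 0 := by exact_mod_cast hΔ
  set z' : F' := ((aeval x' h : 𝓞 F') : F') / Δ with hz'
  have h3 : (Δ : F') * z' = ((aeval x' h : 𝓞 F') : F') := by rw [hz']; field_simp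
  have h4 := congrArg (algebraMap (𝓞 F') F') h2
  rw [← aeval_algebraMap_apply] at h4
  change aeval ((aeval x' h : 𝓞 F') : F') _ = _ at h4
  rw [← h3, aeval_def, show (Δ : F') = algebraMap ℤ F' Δ from (eq_intCast _ _).symm,
    scaleRoots_eval₂_mul, ← aeval_def] at h4
  have h5 : aeval z' (minpoly ℤ z) =
      ((((Δ ^ (n - (minpoly ℤ z).natDegree) : ℤ) : 𝓞 F') * aeval x' g * aeval x' Q : 𝓞 F') :
        F') := by
    refine mul_left_cancel₀ (pow_ne_zero (minpoly ℤ z).natDegree hΔ') ?_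
    rw [eq_intCast] at h4
    rw [h4]
    conv_lhs => rw [← Nat.add_sub_cancel' hdeg, pow_add]
    push_cast
    simp only [map_intCast]
    ring
  have h6 : IsIntegral ℤ z' := by
    refine IsIntegral.of_aeval_monic (minpoly.monic hzi) (minpoly.natDegree_pos hzi).ne' ?_
    rw [h5]
    exact RingOfIntegers.isIntegral_coe _
  obtain ⟨w, hw⟩ : ∃ w : 𝓞 F', algebraMap (𝓞 F') F' w = z' := ⟨⟨z', h6⟩, rfl⟩
  refine ⟨w, RingOfIntegers.coe_injective ?_⟩
  rw [map_mul, map_intCast, hw]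
  exact h3.symm

theorem index_dvd_aeval (x : 𝓞 F) (hx : (minpoly ℤ x).natDegree = Module.finrank ℚ F) {A J N : ℕ}
    (hR : polyIndex x = A * J) (hJN : J ∣ N) (hAN : A.Coprime N) :
    ((Ideal.span {(N : 𝓞 F)}).toAddSubgroup.comap
      (aeval (R := ℤ) x).toRingHom.toAddMonoidHom).index * J = N ^ Module.finrank ℚ F := by
  have h1 : (Ideal.span {(N : 𝓞 F)}).toAddSubgroup.index = N ^ Module.finrank ℚ F := by
    change (Ideal.span {(N : 𝓞 F)}).absNorm = _
    rw [Ideal.absNorm_span_singleton, ← map_natCast (algebraMap ℤ (𝓞 F)), Algebra.norm_algebraMap,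
      RingOfIntegers.rank, Int.natAbs_pow]
    simp
  rw [AddSubgroup.index_comap, ← h1]
  have h2 : (aeval (R := ℤ) x).toRingHom.toAddMonoidHom.range =
      (Subalgebra.toSubmodule (Algebra.adjoin ℤ {x})).toAddSubgroup := by
    ext y
    rw [Algebra.adjoin_singleton_eq_range_aeval]
    rfl
  rw [h2]
  refine relIndex_mul_eq_index hR (polyIndex_ne_zero x hx) hJN hAN ?_ ?_
  · intro g
    rw [nsmul_eq_mul]
    exact Ideal.mem_span_singleton.2 (dvd_mul_right _ _)
  · intro g hg
    obtain ⟨e, he⟩ := Ideal.mem_span_singleton.1 hg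
    exact ⟨e, by rw [nsmul_eq_mul, he]⟩

theorem index_cofactor_eq {x : 𝓞 F} {x' : 𝓞 F'} {n : ℕ} (hn : Module.finrank ℚ F = n)
    (hn' : Module.finrank ℚ F' = n) (hx : (minpoly ℤ x).natDegree = n)
    (hx' : (minpoly ℤ x').natDegree = n) {N : ℕ} (hN : N ≠ 0)
    (hf : C ((N : ℤ) ^ n) ∣ minpoly ℤ x - minpoly ℤ x') {A J A' J' : ℕ}
    (hR : polyIndex x = A * J) (hJ : J ∣ N) (hA : A.Coprime N)
    (hR' : polyIndex x' = A' * J') (hJ' : J' ∣ N) (hA' : A'.Coprime N) : J = J' := by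
  have h1 := index_dvd_aeval x (hx.trans hn.symm) hR hJ hA
  have h2 := index_dvd_aeval x' (hx'.trans hn'.symm) hR' hJ' hA'
  have hN' : (N : ℤ) ≠ 0 := by exact_mod_cast hN
  have h3 : (Ideal.span {(N : 𝓞 F)}).toAddSubgroup.comap
      (aeval (R := ℤ) x).toRingHom.toAddMonoidHom =
      (Ideal.span {(N : 𝓞 F')}).toAddSubgroup.comap
      (aeval (R := ℤ) x').toRingHom.toAddMonoidHom := by
    ext h
    change aeval x h ∈ Ideal.span _ ↔ aeval x' h ∈ Ideal.span _
    rw [Ideal.mem_span_singleton, Ideal.mem_span_singleton, ← Int.cast_natCast (R := 𝓞 F),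
      ← Int.cast_natCast (R := 𝓞 F')]
    exact ⟨dvd_aeval_of_dvd_sub hN' hn.le hf, dvd_aeval_of_dvd_sub hN' hn'.le
      ((dvd_sub_comm).1 hf)⟩
  rw [hn, h3] at h1
  rw [hn'] at h2
  have h4 : _ ≠ 0 := pow_ne_zero n hN
  rw [← h2] at h4
  exact Nat.eq_of_mul_eq_mul_left (Nat.pos_of_ne_zero (left_ne_zero_of_mul h4)) (h1.trans h2.symm)

end numberField

end AltDisc

namespace AltDisc

open Equiv MulAction

/-- A primitive group of even permutations containing a nontrivial permutation that moves at most
three points is the alternating group. -/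
theorem eq_alternatingGroup_of_card_support_le {α : Type*} [Fintype α] [DecidableEq α]
    {G : Subgroup (Perm α)} (hG : IsPreprimitive G α) (heven : G ≤ alternatingGroup α)
    {σ : Perm α} (hσ : σ ∈ G) (h1 : σ ≠ 1) (h3 : σ.support.card ≤ 3) :
    G = alternatingGroup α := by
  refine le_antisymm heven (Perm.alternatingGroup_le_of_isPreprimitive_of_isThreeCycle_mem hG (g := σ) ?_ hσ)
  rw [← card_support_eq_three_iff]
  refine le_antisymm h3 ?_
  by_contra hlt
  have h2 : σ.support.card = 2 := by
    have := Perm.two_le_card_support_of_ne_one h1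
    omega
  have hs : Perm.sign σ = -1 := by
    obtain ⟨i, j, hij, rfl⟩ := Perm.card_support_eq_two.mp h2
    exact Perm.sign_swap hij
  have := heven hσ
  rw [Perm.mem_alternatingGroup, hs] at this
  exact absurd this (by decide)

theorem nonempty_mulEquiv_alternatingGroup {n : ℕ} {G α : Type*} [Group G] [Fintype α] [DecidableEq α] [MulAction G α]
    [FaithfulSMul G α] (hα : Fintype.card α = n)
    (hG : IsPreprimitive G α) (heven : ∀ σ : G, Perm.sign (toPerm σ : Perm α) = 1)
    {σ : G} (h1 : σ ≠ 1) {s : Finset α} (hs : s.card ≤ 3) (hσ : ∀ a, σ • a ≠ a → a ∈ s) :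
    Nonempty (G ≃* alternatingGroup (Fin n)) := by
  have hinj : Function.Injective (toPermHom G α) := toPerm_injective
  have hr : (toPermHom G α).range = alternatingGroup α := by
    refine eq_alternatingGroup_of_card_support_le (σ := toPermHom G α σ) ?_ ?_ ⟨σ, rfl⟩ ?_ ?_
    · let f : α →ₑ[(toPermHom G α).rangeRestrict] α := { toFun := id, map_smul' := fun _ _ => rfl }
      exact IsPreprimitive.of_surjective (f := f) Function.surjective_id
    · rintro _ ⟨τ, rfl⟩
      exact heven τ
    · rwa [Ne, ← map_one (toPermHom G α), hinj.eq_iff]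
    · refine (Finset.card_le_card fun a ha => hσ a ?_).trans hs
      simpa using ha
  have e := Fintype.equivFinOfCardEq hα
  exact ⟨((MonoidHom.ofInjective hinj).trans (MulEquiv.subgroupCongr hr)).trans e.altCongrHom⟩
end AltDisc

namespace AltDisc

open Equiv MulAction Polynomial NumberField

/-- If `δ ^ 2` is the square of a rational number, where `δ` is the product of differences of the
roots, then every permutation of the roots induced by a field automorphism is even. -/
theorem sign_eq_one_of_sq_vandermonde {n : ℕ} {K : Type*} [Field K] [CharZero K] (v : Fin n → K)
    (hv : Function.Injective v) {d : ℚ}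
    (hd : (Matrix.vandermonde v).det ^ 2 = ((d ^ 2 : ℚ) : K)) (σ : K ≃+* K) (π : Perm (Fin n))
    (hπ : ∀ i, σ (v i) = v (π i)) : Perm.sign π = 1 := by
  have h0 : (Matrix.vandermonde v).det ≠ 0 := Matrix.det_vandermonde_ne_zero_iff.mpr hv
  have hδ : ∃ e : ℚ, (Matrix.vandermonde v).det = e := by
    push_cast at hd
    rcases sq_eq_sq_iff_eq_or_eq_neg.mp hd with h | h
    exacts [⟨d, h⟩, ⟨-d, by simpa using h⟩]
  obtain ⟨e, he⟩ := hδ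
  have h1 : σ (Matrix.vandermonde v).det = (Matrix.vandermonde v).det := by
    rw [he]; exact map_ratCast σ e
  have h2 : σ (Matrix.vandermonde v).det = Perm.sign π * (Matrix.vandermonde v).det := by
    rw [← Matrix.det_permute, ← RingEquiv.coe_toRingHom, RingHom.map_det]
    congr 1
    ext i j
    simp [Matrix.vandermonde_apply, hπ]
  rw [h1] at h2
  have h3 : ((Perm.sign π : ℤ) : K) = 1 := by
    refine mul_right_cancel₀ h0 ?_
    rw [one_mul]
    exact h2.symm
  have h4 : (Perm.sign π : ℤ) = 1 := by exact_mod_cast h3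
  exact Units.ext h4

variable {F : Type*} [Field F] [NumberField F]

theorem card_rootSet_eq {K : Type*} [Field K] [NumberField K] {f : ℤ[X]} (hf : f.Monic)
    (hirr : Irreducible (f.map (algebraMap ℤ ℚ))) (hs : (f.map (algebraMap ℤ K)).Splits) :
    Nat.card (f.rootSet K) = f.natDegree := by
  classical
  have hmap : f.map (algebraMap ℤ K) = (f.map (algebraMap ℤ ℚ)).map (algebraMap ℚ K) := by
    rw [Polynomial.map_map]; congr 1; exact RingHom.ext_int _ _
  have h1 : f.rootSet K = (f.map (algebraMap ℤ ℚ)).rootSet K := by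
    rw [rootSet_def, rootSet_def, aroots_def, aroots_def, hmap]
  rw [hmap] at hs
  have h2 := card_rootSet_eq_natDegree hirr.separable hs
  rw [← (hf.natDegree_map (algebraMap ℤ ℚ)), ← h2, ← Nat.card_eq_fintype_card, h1]

/-- The Vandermonde determinant of the conjugates of `x` squares to the discriminant of `ℤ[x]`. -/
theorem exists_equiv_vandermonde {K : Type*} [Field K] [NumberField K] {f : ℤ[X]} (hf : f.Monic)
    (hirr : Irreducible (f.map (algebraMap ℤ ℚ)))
    (hs : (f.map (algebraMap ℤ K)).Splits) (x : 𝓞 F) (hxf : minpoly ℤ x = f)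
    (hx : (minpoly ℤ x).natDegree = Module.finrank ℚ F) :
    ∃ (n : ℕ) (e : Fin n ≃ f.rootSet K),
      (Matrix.vandermonde fun i => (e i : K)).det ^ 2 = ((polyIndex x : ℤ) ^ 2 * discr F : ℤ) := by
  let pb := powerBasisOfDegree x hx
  have hgen : pb.gen = (x : F) := rfl
  let Ω := AlgebraicClosure K
  have hdim : pb.dim = (minpoly ℤ x).natDegree := rfl
  have hc : Fintype.card (F →ₐ[ℚ] Ω) = pb.dim := by
    convert AlgHom.card_of_powerBasis (L := Ω) pb (Algebra.IsSeparable.isSeparable ℚ _) (IsAlgClosed.splits _)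
  let e₀ : Fin pb.dim ≃ (F →ₐ[ℚ] Ω) := (Fintype.equivFinOfCardEq hc).symm
  have hdet := Algebra.discr_powerBasis_eq_prod ℚ Ω pb e₀
  have hex : ∀ i, ∃ z : f.rootSet K, algebraMap K Ω z = e₀ i (x : F) := by
    intro i
    have hcomp : (algebraMap K Ω).comp (algebraMap ℤ K) = algebraMap ℤ Ω := RingHom.ext_int _ _
    have hz : (e₀ i (x : F)) ∈ f.rootSet Ω := by
      rw [mem_rootSet']
      refine ⟨(hf.map _).ne_zero, ?_⟩
      have h1 : aeval (x : F) f = 0 := by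
        have h2 := minpoly.aeval ℤ x
        rw [hxf] at h2
        exact (aeval_algebraMap_apply F x f).trans (by rw [h2, map_zero])
      have h2 : aeval (e₀ i (x : F)) f = ((e₀ i).toRingHom.toIntAlgHom) (aeval (x : F) f) := by
        rw [← aeval_algHom_apply]; rfl
      rw [h2, h1, map_zero]
    have himg := hs.image_rootSet_of_map_ne_zero (algebraMap K Ω).toIntAlgHom (hf.map _).ne_zero
    obtain ⟨z, hz, hz'⟩ := himg.ge hz
    exact ⟨⟨z, hz⟩, hz'⟩
  choose g hg using hex
  have hginj : Function.Injective g := by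
    intro i j hij
    apply e₀.injective
    apply pb.algHom_ext
    rw [hgen, ← hg, ← hg, hij]
  have hbij : Function.Bijective g := by
    rw [Nat.bijective_iff_injective_and_card]
    refine ⟨hginj, ?_⟩
    rw [card_rootSet_eq hf hirr hs, Nat.card_fin, hdim, hxf]
  refine ⟨pb.dim, Equiv.ofBijective g hbij, ?_⟩
  apply (algebraMap K Ω).injective
  have hv : (Algebra.discr ℚ pb.basis : ℚ) = ((polyIndex x : ℤ) ^ 2 * discr F : ℤ) := by
    rw [← discr_pow_eq x hx, coe_discr_int, coe_powerBasisOfDegree]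
    congr!
  rw [hv] at hdet
  rw [map_intCast, ← map_intCast (algebraMap ℚ Ω), hdet, Matrix.det_vandermonde, map_pow, map_prod, ← Finset.prod_pow]
  refine Finset.prod_congr rfl fun i _ => ?_
  rw [map_prod, ← Finset.prod_pow]
  refine Finset.prod_congr rfl fun j _ => ?_
  rw [map_sub, Equiv.ofBijective_apply, Equiv.ofBijective_apply, hg, hg, hgen]
section

variable {K : Type} [Field K] [NumberField K] {f : ℤ[X]}

theorem sign_toPerm_eq_one {F : Type*} [Field F] [NumberField F] [DecidableEq (f.rootSet K)]
    [Fintype (f.rootSet K)] (hf : f.Monic)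
    (hirr : Irreducible (f.map (algebraMap ℤ ℚ)))
    (hs : (f.map (algebraMap ℤ K)).Splits) (x : 𝓞 F) (hxf : minpoly ℤ x = f)
    (hx : (minpoly ℤ x).natDegree = Module.finrank ℚ F) {s d : ℤ} (hs0 : s ≠ 0)
    (hd : s ^ 2 * discr F = d ^ 2) (σ : K ≃ₐ[ℚ] K) :
    Perm.sign (toPerm σ : Perm (f.rootSet K)) = 1 := by
  obtain ⟨n, e, he⟩ := exists_equiv_vandermonde (K := K) hf hirr hs x hxf hx
  have hd' : (((polyIndex x : ℤ) ^ 2 * discr F : ℤ) : K) = (((polyIndex x * d / s : ℚ) ^ 2 : ℚ) : K) := by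
    have h1 : (discr F : ℚ) = (d : ℚ) ^ 2 / s ^ 2 := by
      have : (s : ℚ) ≠ 0 := by exact_mod_cast hs0
      rw [eq_div_iff (pow_ne_zero 2 this), mul_comm]
      exact_mod_cast hd
    have h2 : (((polyIndex x : ℤ) ^ 2 * discr F : ℤ) : ℚ) = (polyIndex x * d / s : ℚ) ^ 2 := by
      push_cast
      rw [h1]; ring
    rw [← h2, Rat.cast_intCast]
  rw [hd'] at he
  have := sign_eq_one_of_sq_vandermonde (fun i => (e i : K))
    (Subtype.val_injective.comp e.injective) he σ.toRingEquiv
    (e.symm.permCongr (toPerm σ : Perm (f.rootSet K))) (fun i => by simp)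
  rwa [Perm.sign_permCongr] at this

theorem smul_def_rootSet (σ : K ≃ₐ[ℚ] K) (z : f.rootSet K) : ((σ • z : f.rootSet K) : K) = σ z := rfl

theorem rootSet_map_int : f.rootSet K = (f.map (algebraMap ℤ ℚ)).rootSet K := by
  classical
  rw [rootSet_def, rootSet_def, aroots_def, aroots_def, Polynomial.map_map]
  congr 4
  exact RingHom.ext_int _ _

theorem minpoly_of_mem_rootSet (hf : f.Monic) (hirr : Irreducible (f.map (algebraMap ℤ ℚ)))
    (z : f.rootSet K) : minpoly ℚ (z : K) = f.map (algebraMap ℤ ℚ) := by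
  have hz := rootSet_map_int.le z.2
  rw [mem_rootSet] at hz
  exact (minpoly.eq_of_irreducible_of_monic hirr hz.2 (hf.map _)).symm

theorem isPretransitive_rootSet [IsGalois ℚ K] (hf : f.Monic)
    (hirr : Irreducible (f.map (algebraMap ℤ ℚ))) :
    IsPretransitive (K ≃ₐ[ℚ] K) (f.rootSet K) := by
  refine ⟨fun y z => ?_⟩
  obtain ⟨g, hg⟩ := (Normal.minpoly_eq_iff_mem_orbit K).mp
    ((minpoly_of_mem_rootSet hf hirr z).trans (minpoly_of_mem_rootSet hf hirr y).symm)
  exact ⟨g, Subtype.ext hg⟩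

open IntermediateField in
theorem exists_ringOfIntegers_adjoin (hf : f.Monic) (hirr : Irreducible (f.map (algebraMap ℤ ℚ)))
    (z : f.rootSet K) : ∃ x : 𝓞 ℚ⟮(z : K)⟯, ((x : ℚ⟮(z : K)⟯) : K) = z ∧ minpoly ℤ x = f ∧
      Module.finrank ℚ ℚ⟮(z : K)⟯ = f.natDegree := by
  have hint : IsIntegral ℤ (z : K) := ⟨f, hf, (mem_rootSet'.mp z.2).2⟩
  let y : ℚ⟮(z : K)⟯ := ⟨z, mem_adjoin_simple_self ℚ _⟩
  have hy : IsIntegral ℤ y := by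
    refine (isIntegral_algHom_iff ((ℚ⟮(z : K)⟯.val).restrictScalars ℤ) Subtype.val_injective).mp hint
  refine ⟨⟨y, hy⟩, rfl, ?_, ?_⟩
  · have h1 := minpoly_rat_eq_map (⟨y, hy⟩ : 𝓞 ℚ⟮(z : K)⟯)
    have h2 : minpoly ℚ ((⟨y, hy⟩ : 𝓞 ℚ⟮(z : K)⟯) : ℚ⟮(z : K)⟯) = minpoly ℚ (z : K) :=
      (minpoly.algebraMap_eq (A := ℚ) (B := ℚ⟮(z : K)⟯) (B' := K) Subtype.val_injective y).symm
    have h3 := (minpoly_of_mem_rootSet hf hirr z).symm.trans (h2.symm.trans h1)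
    exact (map_injective _ (algebraMap ℤ ℚ).injective_int h3).symm
  · rw [adjoin.finrank (IsIntegral.tower_top hint), minpoly_of_mem_rootSet hf hirr,
      hf.natDegree_map]

theorem faithfulSMul_rootSet (hK : IsSplittingField ℚ K (f.map (algebraMap ℤ ℚ))) :
    FaithfulSMul (K ≃ₐ[ℚ] K) (f.rootSet K) := by
  constructor
  intro σ τ h
  have h1 : (σ : K →ₐ[ℚ] K) = τ := by
    refine AlgHom.ext_of_adjoin_eq_top hK.adjoin_rootSet' fun z hz => ?_
    rw [← rootSet_map_int] at hz
    exact congrArg Subtype.val (h ⟨z, hz⟩)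
  ext z
  exact DFunLike.congr_fun h1 z

open IntermediateField in
theorem isPreprimitive_rootSet (hf : f.Monic) (hf2 : 2 ≤ f.natDegree)
    (hirr : Irreducible (f.map (algebraMap ℤ ℚ)))
    (hK : IsSplittingField ℚ K (f.map (algebraMap ℤ ℚ))) 
    (hprim : ∀ (F : Type) [Field F] [NumberField F] (x : 𝓞 F), minpoly ℤ x = f →
      Module.finrank ℚ F = f.natDegree → ∀ E : IntermediateField ℚ F, E = ⊥ ∨ E = ⊤) :
    IsPreprimitive (K ≃ₐ[ℚ] K) (f.rootSet K) := by
  have hgal : IsGalois ℚ K := IsGalois.of_separable_splitting_field hirr.separable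
  have hs : (f.map (algebraMap ℤ K)).Splits := by
    have := hK.splits'
    rw [Polynomial.map_map] at this
    convert this
    exact RingHom.ext_int _ _
  have hcard : Nat.card (f.rootSet K) = f.natDegree := card_rootSet_eq hf hirr hs
  have := isPretransitive_rootSet (K := K) hf hirr
  have : Nontrivial (f.rootSet K) := by
    have : Finite (f.rootSet K) := Nat.finite_of_card_ne_zero (by omega)
    rw [← Finite.one_lt_card_iff_nontrivial]
    omega
  obtain ⟨z⟩ : Nonempty (f.rootSet K) := inferInstance
  rw [← isCoatom_stabilizer_iff_preprimitive (K ≃ₐ[ℚ] K) z]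
  have hstab : (ℚ⟮(z : K)⟯).fixingSubgroup = stabilizer (K ≃ₐ[ℚ] K) z := by
    ext σ
    rw [IntermediateField.mem_fixingSubgroup_iff, mem_stabilizer_iff, Subtype.ext_iff, smul_def_rootSet]
    refine ⟨fun h => h z (mem_adjoin_simple_self ℚ _), fun h => ?_⟩
    have h1 : ℚ⟮(z : K)⟯ ≤ fixedField (Subgroup.zpowers σ) := by
      rw [adjoin_simple_le_iff]
      rintro ⟨_, k, rfl⟩
      have h2 : Subgroup.zpowers σ ≤ stabilizer (K ≃ₐ[ℚ] K) (z : K) := Subgroup.zpowers_le.mpr h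
      exact h2 ⟨k, rfl⟩
    rw [IntermediateField.le_iff_le, Subgroup.zpowers_le] at h1
    exact (IntermediateField.mem_fixingSubgroup_iff _ _).mp h1
  refine ⟨fun htop => ?_, fun H hH => ?_⟩
  · obtain ⟨w, hw⟩ := exists_ne z
    obtain ⟨σ, rfl⟩ := exists_smul_eq (K ≃ₐ[ℚ] K) z w
    exact hw (mem_stabilizer_iff.mp (htop ▸ Subgroup.mem_top σ))
  have hE : fixedField H ≤ ℚ⟮(z : K)⟯ := by
    rw [← IsGalois.fixedField_fixingSubgroup ℚ⟮(z : K)⟯, hstab]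
    exact fixedField_le hH.le
  obtain ⟨x, -, hxf, hx⟩ := exists_ringOfIntegers_adjoin hf hirr z
  rcases hprim _ x hxf hx (IntermediateField.restrict hE) with h | h
  · have h' : lift (restrict hE) = lift ⊥ := congrArg lift h
    rw [lift_restrict, lift_bot] at h'
    rw [← fixingSubgroup_fixedField H, h', fixingSubgroup_bot]
  · have h' : lift (restrict hE) = lift ⊤ := congrArg lift h
    rw [lift_restrict, lift_top] at h'
    refine absurd ?_ hH.ne
    rw [← fixingSubgroup_fixedField H, h', hstab]
end
end AltDisc

namespace AltDisc

open Ideal Equiv MulAction Polynomial NumberField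

section

variable {K : Type} [Field K] [NumberField K] {f : ℤ[X]}

theorem derivative_aeval_mem_of_sub_mem {R : Type*} [CommRing R] [IsDomain R] (f : ℤ[X]) {Q : Ideal R} {y z : R} (hyz : z ≠ y) (h : z - y ∈ Q)
    (hy : aeval y f = 0) (hz : aeval z f = 0) : aeval y (derivative f) ∈ Q := by
  have h1 : (f.map (algebraMap ℤ R)).IsRoot y := by rwa [IsRoot, eval_map_algebraMap]
  obtain ⟨g, hg⟩ := dvd_iff_isRoot.mpr h1
  have h2 : g.eval z = 0 := by
    have h3 : (f.map (algebraMap ℤ R)).eval z = 0 := by rwa [eval_map_algebraMap]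
    rw [hg, eval_mul] at h3
    simpa [sub_eq_zero, hyz] using h3
  have h4 : aeval y (derivative f) = g.eval y := by
    rw [← eval_map_algebraMap, ← derivative_map, hg]
    simp
  rw [h4]
  have h5 : z - y ∣ g.eval z - g.eval y := sub_dvd_eval_sub z y g
  rw [h2, zero_sub, dvd_neg] at h5
  exact Ideal.mem_of_dvd _ h5 h

theorem card_le_three_of_sub_mem {R : Type*} [CommRing R] [IsDomain R] {f g : ℤ[X]} (hf : f.Monic) {Q : Ideal R} [Q.IsPrime] {r ρ : ℤ}
    (hrQ : (r : R) ∈ Q) (hg : C r ∣ f - (X - C ρ) ^ 3 * g) (hgρ : ((g.eval ρ : ℤ) : R) ∉ Q)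
    {s : Finset R} (hs : ∀ y ∈ s, aeval y f = 0 ∧ y - ρ ∈ Q) : s.card ≤ 3 := by
  have h0 : f.map (algebraMap ℤ R) ≠ 0 := (hf.map _).ne_zero
  have h1 : (s.val.map fun a => X - C a).prod ∣ f.map (algebraMap ℤ R) := by
    rw [Multiset.prod_X_sub_C_dvd_iff_le_roots h0, Multiset.le_iff_subset s.nodup]
    intro y hy
    rw [mem_roots h0, IsRoot, eval_map_algebraMap]
    exact (hs y hy).1
  have h2 := Polynomial.map_dvd (Ideal.Quotient.mk Q) h1
  have h3 : ((s.val.map fun a => X - C a).prod).map (Ideal.Quotient.mk Q) =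
      (X - C (ρ : R ⧸ Q)) ^ s.card := by
    rw [Polynomial.map_multiset_prod, Multiset.map_map, Multiset.map_congr rfl (g := fun _ => X - C (ρ : R ⧸ Q))]
    · simp
    · intro y hy
      have h4 : Ideal.Quotient.mk Q y = (ρ : R ⧸ Q) := by
        rw [← map_intCast (Ideal.Quotient.mk Q), Ideal.Quotient.eq]
        exact (hs y hy).2
      simp [h4]
  have hr0 : (r : R ⧸ Q) = 0 := by
    rw [← map_intCast (Ideal.Quotient.mk Q)]
    exact Ideal.Quotient.eq_zero_iff_mem.mpr hrQ
  have h5 : (f.map (algebraMap ℤ R)).map (Ideal.Quotient.mk Q) =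
      (X - C (ρ : R ⧸ Q)) ^ 3 * g.map (algebraMap ℤ (R ⧸ Q)) := by
    obtain ⟨w, hw⟩ := hg
    have h6 : f = (X - C ρ) ^ 3 * g + C r * w := by rw [← hw]; ring
    rw [Polynomial.map_map, RingHom.ext_int ((Ideal.Quotient.mk Q).comp (algebraMap ℤ R)) (algebraMap ℤ (R ⧸ Q)), h6]
    simp only [Polynomial.map_add, Polynomial.map_mul, Polynomial.map_pow, Polynomial.map_sub,
      map_X, map_C]
    simp only [eq_intCast, hr0, map_zero, zero_mul, add_zero]
  rw [h3, h5] at h2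
  by_contra hlt
  push Not at hlt
  have h6 := (pow_dvd_pow (X - C (ρ : R ⧸ Q)) hlt).trans h2
  rw [pow_succ, mul_dvd_mul_iff_left (pow_ne_zero _ (X_sub_C_ne_zero _)), dvd_iff_isRoot, IsRoot,
    eval_map_algebraMap] at h6
  apply hgρ
  rw [← Ideal.Quotient.eq_zero_iff_mem, map_intCast, ← h6]
  rw [← eq_intCast (algebraMap ℤ (R ⧸ Q)) ρ, aeval_algebraMap_apply]
  simp

theorem exists_inertia_ne_one [IsGalois ℚ K] {F : Type*} [Field F] [NumberField F] [Algebra F K] {r : ℕ} (hr : r.Prime) {P : Ideal (𝓞 F)}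
    [P.IsPrime] (hrP : (r : 𝓞 F) ∈ P) (hP : 1 < P.ramificationIdx ℤ) : 
    ∃ Q : Ideal (𝓞 K), Q.IsPrime ∧ (r : 𝓞 K) ∈ Q ∧ ∃ σ : K ≃ₐ[ℚ] K, σ ≠ 1 ∧ ∀ y : 𝓞 K, σ • y - y ∈ Q := by
  obtain ⟨Q, -, hQ, hQP⟩ := Ideal.exists_ideal_over_prime_of_isIntegral P (⊥ : Ideal (𝓞 K)) (by
    intro y hy
    rw [Ideal.mem_comap, Ideal.mem_bot, FaithfulSMul.algebraMap_eq_zero_iff] at hy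
    rw [hy]; exact P.zero_mem)
  have : Q.LiesOver P := ⟨hQP.symm⟩
  have hrQ : (r : 𝓞 K) ∈ Q := by
    have : algebraMap (𝓞 F) (𝓞 K) r ∈ Q := by rw [← Ideal.mem_comap, hQP]; exact hrP
    simpa using this
  refine ⟨Q, hQ, hrQ, ?_⟩
  have := liesOver_span hr hrQ
  have : (Ideal.span {(r : ℤ)}).IsPrime := by
    rw [Ideal.span_singleton_prime (by exact_mod_cast hr.ne_zero)]
    exact Nat.prime_iff_prime_int.mp hr
  have : Fact r.Prime := ⟨hr⟩
  have : PerfectField (Ideal.span {(r : ℤ)}).ResidueField := by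
    have : (Ideal.span {(r : ℤ)}).IsMaximal :=
      IsPrime.isMaximal inferInstance (by simpa using hr.ne_zero)
    have : Finite (ℤ ⧸ Ideal.span {(r : ℤ)}) :=
      Finite.of_equiv _ (Int.quotientSpanNatEquivZMod r).toEquiv.symm
    have : Finite (Ideal.span {(r : ℤ)}).ResidueField :=
      Finite.of_surjective _ (Ideal.bijective_algebraMap_quotient_residueField _).2
    infer_instance
  have h1 := Ideal.card_inertia_eq_ramificationIdxIn (G := K ≃ₐ[ℚ] K) (Ideal.span {(r : ℤ)}) Q
  rw [Ideal.ramificationIdxIn_eq_ramificationIdx _ Q (K ≃ₐ[ℚ] K),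
    Ideal.ramificationIdx_tower P Q] at h1
  have h2 : 0 < Q.ramificationIdx (𝓞 F) := by
    have : Module.Finite (𝓞 F) (𝓞 K) := Module.Finite.of_restrictScalars_finite ℤ _ _
    exact Q.ramificationIdx_pos (𝓞 F)
  have h3 : 1 < Nat.card (Q.inertia (K ≃ₐ[ℚ] K)) := by
    rw [h1]; nlinarith
  have := (Finite.one_lt_card_iff_nontrivial (α := Q.inertia (K ≃ₐ[ℚ] K))).mp h3
  obtain ⟨σ, hσ⟩ := exists_ne (1 : Q.inertia (K ≃ₐ[ℚ] K))
  exact ⟨σ, by simpa using hσ, σ.2⟩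

/-- A criterion for the Galois group of a monic integral polynomial to be the alternating group:
the field generated by a root has no proper subfields, its discriminant is a square, and some prime
ramifies in it at a place where the polynomial has a single multiple root, of multiplicity three. -/
theorem nonempty_gal_mulEquiv_alternatingGroup {g : ℤ[X]} {n r : ℕ} {ρ : ℤ}
    (hf : f.Monic) (hn : f.natDegree = n) (hn2 : 2 ≤ n)
    (hirr : Irreducible (f.map (algebraMap ℤ ℚ)))
    (hK : IsSplittingField ℚ K (f.map (algebraMap ℤ ℚ)))
    (hprim : ∀ (F : Type) [Field F] [NumberField F] (x : 𝓞 F), minpoly ℤ x = f →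
      Module.finrank ℚ F = n → ∀ E : IntermediateField ℚ F, E = ⊥ ∨ E = ⊤)
    (hdisc : ∀ (F : Type) [Field F] [NumberField F] (x : 𝓞 F), minpoly ℤ x = f →
      Module.finrank ℚ F = n → ∃ s d : ℤ, s ≠ 0 ∧ s ^ 2 * discr F = d ^ 2)
    (hr : r.Prime) (hfg : C (r : ℤ) ∣ f - (X - C ρ) ^ 3 * g) (hgρ : ¬ (r : ℤ) ∣ g.eval ρ)
    (hdouble : ∀ (k : Type) [CommRing k] [IsDomain k] (z : k), (r : k) = 0 → aeval z f = 0 →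
      aeval z (derivative f) = 0 → z = ρ)
    (hram : ∀ (F : Type) [Field F] [NumberField F] (x : 𝓞 F), minpoly ℤ x = f →
      Module.finrank ℚ F = n → ∃ P : Ideal (𝓞 F), P.IsPrime ∧ (r : 𝓞 F) ∈ P ∧
        1 < P.ramificationIdx ℤ) :
    Nonempty ((K ≃ₐ[ℚ] K) ≃* alternatingGroup (Fin n)) := by
  classical
  subst hn
  have hgal : IsGalois ℚ K := IsGalois.of_separable_splitting_field hirr.separable
  have hsp : (f.map (algebraMap ℤ K)).Splits := by
    have := hK.splits'
    rw [Polynomial.map_map] at this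
    convert this
    exact RingHom.ext_int _ _
  have hcard : Nat.card (f.rootSet K) = f.natDegree := card_rootSet_eq hf hirr hsp
  have : Finite (f.rootSet K) := Nat.finite_of_card_ne_zero (by omega)
  have : Fintype (f.rootSet K) := Fintype.ofFinite _
  rw [Nat.card_eq_fintype_card] at hcard
  obtain ⟨z⟩ : Nonempty (f.rootSet K) := Fintype.card_pos_iff.mp (by omega)
  obtain ⟨x, -, hxf, hx⟩ := exists_ringOfIntegers_adjoin hf hirr z
  have := faithfulSMul_rootSet hK
  obtain ⟨P, hP, hrP, hP1⟩ := hram _ x hxf hx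
  obtain ⟨Q, hQ, hrQ, σ, hσ1, hσ⟩ := exists_inertia_ne_one (K := K) hr hrP hP1
  have hlift : ∀ y : f.rootSet K, ∃ y' : 𝓞 K, (y' : K) = y ∧ aeval y' f = 0 := by
    intro y
    have hint : IsIntegral ℤ (y : K) := ⟨f, hf, (mem_rootSet'.mp y.2).2⟩
    refine ⟨⟨y, hint⟩, rfl, ?_⟩
    apply RingOfIntegers.coe_injective
    refine (aeval_algebraMap_apply K (⟨y, hint⟩ : 𝓞 K) f).symm.trans ?_
    exact (mem_rootSet'.mp y.2).2.trans (map_zero _).symm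
  choose L hL hL0 using hlift
  have hLinj : Function.Injective L := fun y y' h => Subtype.ext (by rw [← hL, ← hL, h])
  have hsmul : ∀ y, L (σ • y) = σ • L y := by
    intro y
    apply RingOfIntegers.coe_injective
    refine (hL _).trans ?_
    rw [smul_def_rootSet, ← hL]
    rfl
  obtain ⟨s, d, hs, hd⟩ := hdisc _ x hxf hx
  refine nonempty_mulEquiv_alternatingGroup hcard
    (isPreprimitive_rootSet hf hn2 hirr hK hprim)
    (sign_toPerm_eq_one hf hirr hsp x hxf (by rw [hxf, hx]) hs hd) hσ1
    (s := Finset.univ.filter fun y => L y - ρ ∈ Q) ?_ ?_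
  · rw [← Finset.card_map ⟨L, hLinj⟩]
    refine card_le_three_of_sub_mem (Q := Q) hf (r := r) (ρ := ρ) (g := g) (by exact_mod_cast hrQ) hfg ?_ ?_
    · rwa [intCast_mem_iff hr hrQ]
    · intro y hy
      simp only [Finset.mem_map, Finset.mem_filter, Finset.mem_univ, true_and,
        Function.Embedding.coeFn_mk] at hy
      obtain ⟨w, hw, rfl⟩ := hy
      exact ⟨hL0 w, hw⟩
  · intro y hy
    rw [Finset.mem_filter]
    refine ⟨Finset.mem_univ _, ?_⟩
    have h1 := derivative_aeval_mem_of_sub_mem f (Q := Q) (hLinj.ne hy) (by rw [hsmul]; exact hσ _) (hL0 y) (hL0 _)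
    have h2 := hdouble (𝓞 K ⧸ Q) (Ideal.Quotient.mk Q (L y)) ?_ ?_ ?_
    · rwa [← map_intCast (Ideal.Quotient.mk Q), Ideal.Quotient.eq] at h2
    · rw [← map_natCast (Ideal.Quotient.mk Q)]
      exact Ideal.Quotient.eq_zero_iff_mem.mpr hrQ
    · refine (aeval_algebraMap_apply (𝓞 K ⧸ Q) (L y) f).trans ?_
      rw [hL0, map_zero]
    · refine (aeval_algebraMap_apply (𝓞 K ⧸ Q) (L y) (derivative f)).trans ?_
      exact Ideal.Quotient.eq_zero_iff_mem.mpr h1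
end
end AltDisc

namespace AltDisc

open Polynomial NumberField

section
variable {F : Type*} [Field F] [NumberField F]

theorem norm_sub_intCast {x : 𝓞 F} {f : ℤ[X]} {n : ℕ} (hxf : minpoly ℤ x = f)
    (hn : Module.finrank ℚ F = n) (hfn : f.natDegree = n) (t : ℤ) : Algebra.norm ℤ (x - t) = (-1) ^ n * f.eval t := by
  have h1 : minpoly ℤ (x - (t : 𝓞 F)) = f.comp (X + C t) := by
    apply map_injective (algebraMap ℤ ℚ) Int.cast_injective
    have h := minpoly.sub_algebraMap (A := ℚ) (B := F) (x : F) (t : ℚ)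
    rw [map_intCast, minpoly_rat_eq_map, hxf] at h
    rw [← minpoly_rat_eq_map, map_comp]
    simpa using h
  have h2 : (minpoly ℤ (x - (t : 𝓞 F))).natDegree = Module.finrank ℚ F := by
    rw [h1, natDegree_comp, hn, hfn, natDegree_X_add_C, mul_one]
  have h3 := Algebra.PowerBasis.norm_gen_eq_coeff_zero_minpoly (powerBasisOfDegree (x - (t : 𝓞 F)) h2)
  have hdim : (powerBasisOfDegree (x - (t : 𝓞 F)) h2).dim = n := h2.trans hn
  have hgen : (powerBasisOfDegree (x - (t : 𝓞 F)) h2).gen = ((x - (t : 𝓞 F) : 𝓞 F) : F) := rfl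
  rw [hdim, hgen, minpoly_rat_eq_map, h1, ← Algebra.coe_norm_int] at h3
  rw [coeff_map, coeff_zero_eq_eval_zero, eval_comp] at h3
  rw [eval_add, eval_X, eval_C, zero_add, eq_intCast] at h3
  exact_mod_cast h3

theorem pow_dvd_of_forall_prime {a : ℕ} (ha : Squarefree a) {k : ℕ} {N : ℤ}
    (h : ∀ q : ℕ, q.Prime → q ∣ a → (q : ℤ) ^ k ∣ N) : (a : ℤ) ^ k ∣ N := by
  rw [← Nat.prod_primeFactors_of_squarefree ha, Nat.cast_prod, ← Finset.prod_pow]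
  refine Finset.prod_dvd_of_coprime ?_ fun q hq => h q (Nat.prime_of_mem_primeFactors hq) (Nat.dvd_of_mem_primeFactors hq)
  intro q hq q' hq' hne
  have := (Nat.coprime_primes (Nat.prime_of_mem_primeFactors hq) (Nat.prime_of_mem_primeFactors hq')).mpr hne
  exact IsCoprime.pow (Nat.isCoprime_iff_coprime.mpr this)

theorem exists_prime_mem_of_dvd_norm {r : ℕ} (hr : r.Prime) {y : 𝓞 F}
    (h : (r : ℤ) ∣ Algebra.norm ℤ y) : ∃ P : Ideal (𝓞 F), P.IsPrime ∧ (r : 𝓞 F) ∈ P ∧ y ∈ P := by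
  obtain ⟨P, hP, hPr, hPy⟩ := Ideal.exists_isMaximal_dvd_of_dvd_absNorm' hr (Ideal.span {y}) (by
    rw [Ideal.absNorm_span_singleton]
    exact Int.natCast_dvd.1 h)
  refine ⟨P, hP.isPrime, ?_, (Ideal.dvd_span_singleton).1 hPy⟩
  have h1 : (r : ℤ) ∈ P.under ℤ := hPr ▸ Ideal.mem_span_singleton_self _
  simpa using h1
end
section localization
variable {R : Type*} [CommRing R]

theorem sub_intCast_dvd_aeval_sub (x : R) (t : ℤ) (p : ℤ[X]) :
    x - t ∣ aeval x p - ((p.eval t : ℤ) : R) := by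
  have h := sub_dvd_eval_sub x (t : R) (p.map (algebraMap ℤ R))
  rwa [eval_map_algebraMap, algebraMap_int_eq, eval_intCast_map, eq_intCast] at h

theorem aeval_mem_iff [IsDedekindDomain R] [CharZero R] {P : Ideal R} [P.IsPrime] {q : ℕ}
    (hq : q.Prime) (hqP : (q : R) ∈ P) {x : R} {t : ℤ} (hx : x - t ∈ P) (p : ℤ[X]) :
    aeval x p ∈ P ↔ (q : ℤ) ∣ p.eval t := by
  rw [← intCast_mem_iff hq hqP]
  have h := P.mem_of_dvd (sub_intCast_dvd_aeval_sub x t p) hx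
  exact ⟨fun h1 => by simpa using P.sub_mem h1 h, fun h1 => by simpa using P.add_mem h h1⟩

theorem mul_ord_eq [IsDedekindDomain R] [CharZero R] {P : Ideal R} [P.IsPrime] {q : ℕ}
    (hq : q.Prime) (hqP : (q : R) ∈ P) {y z z' : R} {e v : ℕ} {k u : ℤ} (he : e ≠ 0)
    (h : y ^ e * z = k * z') (hz : z ∉ P) (hz' : z' ∉ P) (hk : k = q ^ v * u)
    (hu : ¬ (q : ℤ) ∣ u) : e * ord P y = v * ord P (q : R) := by
  have hP := ne_bot_of_natCast_mem hq hqP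
  have hz0 : z ≠ 0 := by rintro rfl; exact hz P.zero_mem
  have hz0' : z' ≠ 0 := by rintro rfl; exact hz' P.zero_mem
  have hk0 : (k : R) ≠ 0 := by
    rw [hk]
    refine Int.cast_ne_zero.2 (mul_ne_zero (pow_ne_zero _ (by exact_mod_cast hq.ne_zero)) ?_)
    rintro rfl
    exact hu (dvd_zero _)
  have hy0 : y ≠ 0 := by
    rintro rfl
    rw [zero_pow he, zero_mul] at h
    exact mul_ne_zero hk0 hz0' h.symm
  have h1 := congrArg (ord P) h
  rwa [ord_mul hP (pow_ne_zero _ hy0) hz0, ord_mul hP hk0 hz0', ord_pow hP hy0,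
    (ord_eq_zero_iff hz0).2 hz, (ord_eq_zero_iff hz0').2 hz', ord_intCast hq hqP hk hu] at h1

end localization

/-- The data of a one-parameter family `X ^ (2 * m) * ℓ - c * a ^ 2 * B` of degree `n`, ramified
over three points with indices `2 * m`, `3` and a square discriminant. -/
structure Family (n : ℕ) where
  /-- Half of the ramification index at `0`. -/
  m : ℕ
  /-- The cofactor of the numerator. -/
  ℓ : ℤ[X]
  /-- The denominator. -/
  B : ℤ[X]
  /-- The cofactor of `(X - ρ) ^ 3` in the fibre over `1`. -/
  g : ℤ[X]
  /-- The twisting constant. -/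
  c : ℤ
  /-- The ramification point over `1`. -/
  ρ : ℤ
  /-- The leading constant of the Wronskian. -/
  lam : ℤ
  /-- The constant of the discriminant. -/
  κ : ℤ
  /-- The denominator of the discriminant. -/
  s : ℤ
  two_le_m : 2 ≤ m
  monic_ℓ : ℓ.Monic
  natDegree_ℓ : 2 * m + ℓ.natDegree = n
  monic_g : g.Monic
  natDegree_g : g.natDegree + 3 = n
  degree_B : B.degree < n
  sub_eq : X ^ (2 * m) * ℓ - B = (X - C ρ) ^ 3 * g
  wronskian : derivative (X ^ (2 * m) * ℓ) * B - X ^ (2 * m) * ℓ * derivative B =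
    C lam * X ^ (2 * m - 1) * (X - C ρ) ^ 2
  ne_zero : 2 * c * lam * B.eval 0 * ℓ.eval 0 * B.eval ρ * g.eval ρ * κ * s * (1 - c) ≠ 0

namespace Family

variable {n : ℕ} (Φ : Family n)

/-- The product of the bad constants of the family. -/
noncomputable def bad : ℤ :=
  2 * Φ.c * Φ.lam * Φ.B.eval 0 * Φ.ℓ.eval 0 * Φ.B.eval Φ.ρ * Φ.g.eval Φ.ρ * Φ.κ * Φ.s * (1 - Φ.c)

/-- The member of the family with parameter `a`. -/
noncomputable def poly (a : ℤ) : ℤ[X] := X ^ (2 * Φ.m) * Φ.ℓ - C (Φ.c * a ^ 2) * Φ.B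

theorem bad_ne_zero : Φ.bad ≠ 0 := Φ.ne_zero

theorem two_dvd_bad : 2 ∣ Φ.bad := by unfold bad; simp only [mul_assoc]; exact dvd_mul_right _ _
theorem c_dvd_bad : Φ.c ∣ Φ.bad := ⟨2 * Φ.lam * Φ.B.eval 0 * Φ.ℓ.eval 0 * Φ.B.eval Φ.ρ *
  Φ.g.eval Φ.ρ * Φ.κ * Φ.s * (1 - Φ.c), by unfold bad; ring⟩
theorem lam_dvd_bad : Φ.lam ∣ Φ.bad := ⟨2 * Φ.c * Φ.B.eval 0 * Φ.ℓ.eval 0 * Φ.B.eval Φ.ρ *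
  Φ.g.eval Φ.ρ * Φ.κ * Φ.s * (1 - Φ.c), by unfold bad; ring⟩
theorem B_zero_dvd_bad : Φ.B.eval 0 ∣ Φ.bad := ⟨2 * Φ.c * Φ.lam * Φ.ℓ.eval 0 * Φ.B.eval Φ.ρ *
  Φ.g.eval Φ.ρ * Φ.κ * Φ.s * (1 - Φ.c), by unfold bad; ring⟩
theorem ℓ_zero_dvd_bad : Φ.ℓ.eval 0 ∣ Φ.bad := ⟨2 * Φ.c * Φ.lam * Φ.B.eval 0 * Φ.B.eval Φ.ρ *
  Φ.g.eval Φ.ρ * Φ.κ * Φ.s * (1 - Φ.c), by unfold bad; ring⟩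
theorem B_ρ_dvd_bad : Φ.B.eval Φ.ρ ∣ Φ.bad := ⟨2 * Φ.c * Φ.lam * Φ.B.eval 0 * Φ.ℓ.eval 0 *
  Φ.g.eval Φ.ρ * Φ.κ * Φ.s * (1 - Φ.c), by unfold bad; ring⟩
theorem g_ρ_dvd_bad : Φ.g.eval Φ.ρ ∣ Φ.bad := ⟨2 * Φ.c * Φ.lam * Φ.B.eval 0 * Φ.ℓ.eval 0 *
  Φ.B.eval Φ.ρ * Φ.κ * Φ.s * (1 - Φ.c), by unfold bad; ring⟩
theorem κ_mul_dvd_bad : Φ.κ * (1 - Φ.c) ∣ Φ.bad := ⟨2 * Φ.c * Φ.lam * Φ.B.eval 0 * Φ.ℓ.eval 0 *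
  Φ.B.eval Φ.ρ * Φ.g.eval Φ.ρ * Φ.s, by unfold bad; ring⟩
theorem s_dvd_bad : Φ.s ∣ Φ.bad := ⟨2 * Φ.c * Φ.lam * Φ.B.eval 0 * Φ.ℓ.eval 0 * Φ.B.eval Φ.ρ *
  Φ.g.eval Φ.ρ * Φ.κ * (1 - Φ.c), by unfold bad; ring⟩
theorem one_sub_c_dvd_bad : 1 - Φ.c ∣ Φ.bad := (dvd_mul_left _ _).trans Φ.κ_mul_dvd_bad
theorem four_le (Φ : Family n) : 4 ≤ n := by have := Φ.natDegree_ℓ; have := Φ.two_le_m; omega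

theorem monic_num : (X ^ (2 * Φ.m) * Φ.ℓ).Monic := (monic_X_pow _).mul Φ.monic_ℓ

theorem natDegree_num : (X ^ (2 * Φ.m) * Φ.ℓ).natDegree = n := by
  rw [Monic.natDegree_mul (monic_X_pow _) Φ.monic_ℓ, natDegree_X_pow, Φ.natDegree_ℓ]

theorem degree_num : (X ^ (2 * Φ.m) * Φ.ℓ).degree = (n : WithBot ℕ) := by
  rw [degree_eq_natDegree Φ.monic_num.ne_zero, Φ.natDegree_num]

theorem degree_C_mul_B_lt (k : ℤ) : (C k * Φ.B).degree < (X ^ (2 * Φ.m) * Φ.ℓ).degree := by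
  rw [degree_num]
  rw [← smul_eq_C_mul]
  exact (degree_smul_le k Φ.B).trans_lt Φ.degree_B

theorem monic_poly (a : ℤ) : (Φ.poly a).Monic := Φ.monic_num.sub_of_left (Φ.degree_C_mul_B_lt _)

theorem natDegree_poly (a : ℤ) : (Φ.poly a).natDegree = n := by
  rw [poly, natDegree_sub_eq_left_of_natDegree_lt, natDegree_num]
  by_cases h : C (Φ.c * a ^ 2) * Φ.B = 0
  · rw [h, natDegree_zero, natDegree_num]
    have := Φ.four_le
    omega
  · exact natDegree_lt_natDegree h (Φ.degree_C_mul_B_lt _)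

theorem poly_eq (a : ℤ) :
    Φ.poly a = (X - C Φ.ρ) ^ 3 * Φ.g + C (1 - Φ.c * a ^ 2) * Φ.B := by
  rw [poly, ← Φ.sub_eq, C_sub, C_1]
  ring

theorem eval_zero_poly (a : ℤ) : (Φ.poly a).eval 0 = -(Φ.c * a ^ 2 * Φ.B.eval 0) := by
  have := Φ.two_le_m
  simp [poly, show Φ.m ≠ 0 by omega]

theorem eval_ρ_poly (a : ℤ) : (Φ.poly a).eval Φ.ρ = (1 - Φ.c * a ^ 2) * Φ.B.eval Φ.ρ := by
  simp [poly_eq]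

section root

variable {R : Type*} [CommRing R] {a : ℤ} {x : R}

theorem pow_mul_aeval_ℓ (hx : aeval x (Φ.poly a) = 0) :
    x ^ (2 * Φ.m) * aeval x Φ.ℓ = ((Φ.c * a ^ 2 : ℤ) : R) * aeval x Φ.B := by
  rw [poly] at hx
  simpa [sub_eq_zero] using hx

theorem pow_mul_aeval_g (hx : aeval x (Φ.poly a) = 0) :
    (x - Φ.ρ) ^ 3 * aeval x Φ.g = ((-(1 - Φ.c * a ^ 2) : ℤ) : R) * aeval x Φ.B := by
  rw [poly_eq] at hx
  simp only [map_add, map_mul, map_pow, map_sub, aeval_X, eq_intCast, map_intCast,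
    map_one] at hx
  push_cast at hx ⊢
  linear_combination hx

theorem aeval_derivative_mul (hx : aeval x (Φ.poly a) = 0) :
    aeval x (derivative (Φ.poly a)) * aeval x Φ.B =
      Φ.lam * x ^ (2 * Φ.m - 1) * (x - Φ.ρ) ^ 2 := by
  have h := congrArg (aeval x) Φ.wronskian
  have h1 := Φ.pow_mul_aeval_ℓ hx
  rw [poly, derivative_sub, derivative_C_mul]
  simp only [map_sub, map_mul, map_pow, aeval_X, eq_intCast, map_intCast] at h ⊢
  push_cast at h1
  linear_combination h + aeval x (derivative Φ.B) * h1

end root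

end Family
theorem isCoprime_of_dvd_sub_one {a b : ℤ} (h : b ∣ a - 1) : IsCoprime a b := by
  obtain ⟨k, hk⟩ := h
  exact ⟨1, -k, by linear_combination hk⟩

theorem not_natCast_dvd_of_isCoprime {a b : ℤ} (h : IsCoprime a b) {q : ℕ} (hq : q.Prime)
    (ha : (q : ℤ) ∣ a) : ¬ (q : ℤ) ∣ b := fun hb =>
  (Nat.prime_iff_prime_int.1 hq).not_isUnit (h.isUnit_of_dvd' ha hb)

theorem exists_eq_mul_of_squarefree {a : ℤ} (ha : Squarefree a) {q : ℕ} (hq : q.Prime)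
    (h : (q : ℤ) ∣ a) : ∃ u, a = q * u ∧ ¬ (q : ℤ) ∣ u := by
  obtain ⟨u, rfl⟩ := h
  refine ⟨u, rfl, fun h => (Nat.prime_iff_prime_int.1 hq).not_isUnit (ha _ (mul_dvd_mul_left _ h))⟩

theorem int_pow_dvd_of_forall_prime {a : ℤ} (ha : Squarefree a) {k : ℕ} {N : ℤ}
    (h : ∀ q : ℕ, q.Prime → (q : ℤ) ∣ a → (q : ℤ) ^ k ∣ N) : a ^ k ∣ N := by
  rw [← Int.natAbs_dvd, Int.natAbs_pow, Nat.cast_pow]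
  exact pow_dvd_of_forall_prime (Int.squarefree_natAbs.2 ha) fun q hq hqa =>
    h q hq (Int.natCast_dvd.2 hqa)

theorem int_not_dvd_neg_one_pow_mul {q : ℤ} {k : ℕ} {u : ℤ} (hu : ¬ q ∣ u) :
    ¬ q ∣ (-1) ^ k * u := by
  rcases neg_one_pow_eq_or ℤ k with h | h <;> simpa [h] using hu

namespace Family

variable {n : ℕ} (Φ : Family n)

/-- Admissible parameters: `a` is squarefree, congruent to `1` modulo the bad constants, and
`1 - c * a ^ 2` is squarefree apart from the square of the prime `r`. -/
structure Valid (a : ℤ) (r : ℕ) (D : ℤ) : Prop where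
  one_lt : 1 < a
  bad_pow_dvd : Φ.bad ^ n ∣ a - 1
  squarefree_a : Squarefree a
  prime : r.Prime
  not_dvd_bad : ¬ (r : ℤ) ∣ Φ.bad
  eq : 1 - Φ.c * a ^ 2 = (1 - Φ.c) * r ^ 2 * D
  squarefree_D : Squarefree D
  not_dvd_D : ¬ (r : ℤ) ∣ D
  bad_dvd : Φ.bad ∣ r ^ 2 * D - 1

section field

variable {Φ} {F : Type} [Field F] [NumberField F] {x : 𝓞 F} {a : ℤ}

omit [NumberField F] in
theorem aeval_eq_zero (hf : minpoly ℤ x = Φ.poly a) : aeval x (Φ.poly a) = 0 :=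
  hf ▸ minpoly.aeval ℤ x

theorem norm_root (hf : minpoly ℤ x = Φ.poly a) (hn : Module.finrank ℚ F = n) :
    Algebra.norm ℤ x = (-1) ^ n * (-(Φ.c * a ^ 2 * Φ.B.eval 0)) := by
  have h := norm_sub_intCast hf hn (Φ.natDegree_poly a) 0
  rwa [Int.cast_zero, sub_zero, eval_zero_poly] at h

theorem norm_root_sub_ρ (hf : minpoly ℤ x = Φ.poly a) (hn : Module.finrank ℚ F = n) :
    Algebra.norm ℤ (x - (Φ.ρ : 𝓞 F)) = (-1) ^ n * ((1 - Φ.c * a ^ 2) * Φ.B.eval Φ.ρ) := by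
  rw [norm_sub_intCast hf hn (Φ.natDegree_poly a), eval_ρ_poly]

variable {P : Ideal (𝓞 F)} [P.IsPrime] {q : ℕ}

theorem mul_ord_root (hf : minpoly ℤ x = Φ.poly a) (hq : q.Prime) (hqP : (q : 𝓞 F) ∈ P)
    (hqb : ¬ (q : ℤ) ∣ Φ.bad) (hxP : x ∈ P) {u : ℤ} (ha : a = q * u) (hu : ¬ (q : ℤ) ∣ u) :
    Φ.m * ord P x = ord P (q : 𝓞 F) := by
  have hq' := Nat.prime_iff_prime_int.1 hq
  have hx0 : x - ((0 : ℤ) : 𝓞 F) ∈ P := by simpa using hxP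
  have h := mul_ord_eq (v := 2) (u := Φ.c * u ^ 2) hq hqP
    (mul_ne_zero two_ne_zero (by have := Φ.two_le_m; omega)) (Φ.pow_mul_aeval_ℓ (aeval_eq_zero hf))
    ((aeval_mem_iff hq hqP hx0 _).not.2 fun h => hqb (h.trans Φ.ℓ_zero_dvd_bad))
    ((aeval_mem_iff hq hqP hx0 _).not.2 fun h => hqb (h.trans Φ.B_zero_dvd_bad))
    (by rw [ha]; ring) fun h => (hq'.dvd_or_dvd h).elim (fun h => hqb (h.trans Φ.c_dvd_bad))
      fun h => hu (hq'.dvd_of_dvd_pow h)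
  rw [mul_assoc] at h
  omega

theorem mul_ord_root_sub_ρ (hf : minpoly ℤ x = Φ.poly a) (hq : q.Prime) (hqP : (q : 𝓞 F) ∈ P)
    (hqb : ¬ (q : ℤ) ∣ Φ.bad) (hxP : x - Φ.ρ ∈ P) {v : ℕ} {u : ℤ}
    (ha : 1 - Φ.c * a ^ 2 = q ^ v * u) (hu : ¬ (q : ℤ) ∣ u) :
    3 * ord P (x - (Φ.ρ : 𝓞 F)) = v * ord P (q : 𝓞 F) :=
  mul_ord_eq (u := -u) hq hqP three_ne_zero (Φ.pow_mul_aeval_g (aeval_eq_zero hf))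
    ((aeval_mem_iff hq hqP hxP _).not.2 fun h => hqb (h.trans Φ.g_ρ_dvd_bad))
    ((aeval_mem_iff hq hqP hxP _).not.2 fun h => hqb (h.trans Φ.B_ρ_dvd_bad))
    (by rw [ha]; ring) (by rwa [dvd_neg])

omit [P.IsPrime] in
theorem pow_dvd_discr_of_dvd (hf : minpoly ℤ x = Φ.poly a) (hn : Module.finrank ℚ F = n)
    (hq : q.Prime) (hqb : ¬ (q : ℤ) ∣ Φ.bad) {u : ℤ} (ha : a = q * u) (hu : ¬ (q : ℤ) ∣ u) :
    (q : ℤ) ^ ((Φ.m - 1) * 2) ∣ discr F := by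
  have hq' := Nat.prime_iff_prime_int.1 hq
  have hqu : ¬ (q : ℤ) ∣ Φ.c * u ^ 2 * Φ.B.eval 0 := fun h => by
    rcases hq'.dvd_or_dvd h with h | h
    · exact (hq'.dvd_or_dvd h).elim (fun h => hqb (h.trans Φ.c_dvd_bad))
        fun h => hu (hq'.dvd_of_dvd_pow h)
    · exact hqb (h.trans Φ.B_zero_dvd_bad)
  have hN : Algebra.norm ℤ x = q ^ 2 * ((-1) ^ n * -(Φ.c * u ^ 2 * Φ.B.eval 0)) := by
    rw [norm_root hf hn, ha]; ring
  have hu' : ¬ (q : ℤ) ∣ (-1) ^ n * -(Φ.c * u ^ 2 * Φ.B.eval 0) :=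
    int_not_dvd_neg_one_pow_mul (by rwa [dvd_neg])
  have hx : x ≠ 0 := by
    rintro rfl
    rw [Algebra.norm_zero] at hN
    refine mul_ne_zero (pow_ne_zero 2 hq'.ne_zero) (fun h => hu' (by rw [h]; exact dvd_zero _)) hN.symm
  refine pow_dvd_discr hq hx hN hu' fun P _ hqP hxP => ?_
  have h1 := mul_ord_root hf hq hqP hqb hxP ha hu
  have h2 := (ord_pos_iff hx).2 hxP
  have h3 := Φ.two_le_m
  obtain ⟨k, hk⟩ : ∃ k, Φ.m = k + 1 := ⟨Φ.m - 1, by omega⟩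
  rw [← h1, hk, Nat.add_sub_cancel, add_mul, one_mul]
  omega

omit [P.IsPrime] in
theorem root_sub_ρ_data (hf : minpoly ℤ x = Φ.poly a) (hn : Module.finrank ℚ F = n)
    (hq : q.Prime) (hqb : ¬ (q : ℤ) ∣ Φ.bad) {v : ℕ} {u : ℤ}
    (ha : 1 - Φ.c * a ^ 2 = q ^ v * u) (hu : ¬ (q : ℤ) ∣ u) :
    x - Φ.ρ ≠ 0 ∧ ∃ u', Algebra.norm ℤ (x - (Φ.ρ : 𝓞 F)) = q ^ v * u' ∧ ¬ (q : ℤ) ∣ u' := by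
  have hq' := Nat.prime_iff_prime_int.1 hq
  have hu' : ¬ (q : ℤ) ∣ (-1) ^ n * (u * Φ.B.eval Φ.ρ) :=
    int_not_dvd_neg_one_pow_mul fun h => (hq'.dvd_or_dvd h).elim hu
      fun h => hqb (h.trans Φ.B_ρ_dvd_bad)
  have hN : Algebra.norm ℤ (x - (Φ.ρ : 𝓞 F)) = q ^ v * ((-1) ^ n * (u * Φ.B.eval Φ.ρ)) := by
    rw [norm_root_sub_ρ hf hn, ha]; ring
  refine ⟨fun h => ?_, _, hN, hu'⟩
  rw [h, Algebra.norm_zero] at hN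
  exact mul_ne_zero (pow_ne_zero v hq'.ne_zero) (fun h => hu' (by rw [h]; exact dvd_zero _)) hN.symm

omit [P.IsPrime] in
theorem pow_dvd_discr_of_dvd_one_sub (hf : minpoly ℤ x = Φ.poly a) (hn : Module.finrank ℚ F = n)
    (hq : q.Prime) (hqb : ¬ (q : ℤ) ∣ Φ.bad) {v j : ℕ} {u : ℤ}
    (ha : 1 - Φ.c * a ^ 2 = q ^ v * u) (hu : ¬ (q : ℤ) ∣ u) (hj : v * j < 3) :
    (q : ℤ) ^ (j * v) ∣ discr F := by
  obtain ⟨hx, u', hN, hu'⟩ := root_sub_ρ_data hf hn hq hqb ha hu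
  refine pow_dvd_discr hq hx hN hu' fun P _ hqP hxP => ?_
  have h1 := mul_ord_root_sub_ρ hf hq hqP hqb hxP ha hu
  have h2 := (ord_pos_iff hx).2 hxP
  by_contra! h3
  have h4 : v * ord P (q : 𝓞 F) ≤ v * j * ord P (x - (Φ.ρ : 𝓞 F)) := by
    rw [mul_assoc]
    exact Nat.mul_le_mul_left v (by omega)
  have h5 : v * j * ord P (x - (Φ.ρ : 𝓞 F)) ≤ 2 * ord P (x - (Φ.ρ : 𝓞 F)) :=
    Nat.mul_le_mul_right _ (by omega)
  omega

end field

namespace Valid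

variable {Φ} {a : ℤ} {r : ℕ} {D : ℤ} (V : Φ.Valid a r D)
include V

theorem bad_dvd_sub_one : Φ.bad ∣ a - 1 :=
  (dvd_pow_self _ (by have := Φ.four_le; omega)).trans V.bad_pow_dvd

theorem isCoprime_a_bad : IsCoprime a Φ.bad := isCoprime_of_dvd_sub_one V.bad_dvd_sub_one

theorem isCoprime_sq_mul_D_bad : IsCoprime ((r : ℤ) ^ 2 * D) Φ.bad :=
  isCoprime_of_dvd_sub_one V.bad_dvd

theorem isCoprime_a_sq_mul_D : IsCoprime a ((r : ℤ) ^ 2 * D) := by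
  have h : IsCoprime a (1 - Φ.c * a ^ 2) := ⟨Φ.c * a, 1, by ring⟩
  rw [V.eq, mul_assoc] at h
  exact h.of_mul_right_right

theorem isCoprime_a_r : IsCoprime a r :=
  (IsCoprime.pow_right_iff two_pos).1 V.isCoprime_a_sq_mul_D.of_mul_right_left

theorem isCoprime_r_D : IsCoprime (r : ℤ) D :=
  (Nat.prime_iff_prime_int.1 V.prime).coprime_iff_not_dvd.2 V.not_dvd_D

theorem isCoprime_r_bad : IsCoprime (r : ℤ) Φ.bad :=
  (Nat.prime_iff_prime_int.1 V.prime).coprime_iff_not_dvd.2 V.not_dvd_bad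

theorem not_dvd_one_sub_c_mul_D : ¬ (r : ℤ) ∣ (1 - Φ.c) * D := fun h =>
  ((Nat.prime_iff_prime_int.1 V.prime).dvd_or_dvd h).elim
    (fun h => V.not_dvd_bad (h.trans Φ.one_sub_c_dvd_bad)) V.not_dvd_D

theorem eq_r_pow_mul : 1 - Φ.c * a ^ 2 = r ^ 2 * ((1 - Φ.c) * D) := by rw [V.eq]; ring

variable {F : Type} [Field F] [NumberField F] {x : 𝓞 F} (hf : minpoly ℤ x = Φ.poly a)
  (hn : Module.finrank ℚ F = n)
include hf hn

theorem dvd_discr : (a ^ (Φ.m - 1) * D * r) ^ 2 ∣ discr F := by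
  have ha : a ^ ((Φ.m - 1) * 2) ∣ discr F :=
    int_pow_dvd_of_forall_prime V.squarefree_a fun q hq hqa => by
      obtain ⟨u, hu, hu'⟩ := exists_eq_mul_of_squarefree V.squarefree_a hq hqa
      exact pow_dvd_discr_of_dvd hf hn hq
        (not_natCast_dvd_of_isCoprime V.isCoprime_a_bad hq hqa) hu hu'
  have hD : D ^ 2 ∣ discr F :=
    int_pow_dvd_of_forall_prime V.squarefree_D fun q hq hqD => by
      obtain ⟨u, hu, hu'⟩ := exists_eq_mul_of_squarefree V.squarefree_D hq hqD
      have hqb := not_natCast_dvd_of_isCoprime V.isCoprime_sq_mul_D_bad hq (hqD.mul_left _)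
      have hq' := Nat.prime_iff_prime_int.1 hq
      refine pow_dvd_discr_of_dvd_one_sub (v := 1) (j := 2) (u := (1 - Φ.c) * r ^ 2 * u) hf hn hq
        hqb (by rw [V.eq, hu]; ring) (fun h => ?_) (by norm_num)
      rcases hq'.dvd_or_dvd h with h | h
      · rcases hq'.dvd_or_dvd h with h | h
        · exact hqb (h.trans Φ.one_sub_c_dvd_bad)
        · exact not_natCast_dvd_of_isCoprime V.isCoprime_r_D.symm hq hqD (hq'.dvd_of_dvd_pow h)
      · exact hu' h
  have hr : (r : ℤ) ^ 2 ∣ discr F := pow_dvd_discr_of_dvd_one_sub (v := 2) (j := 1) hf hn V.prime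
    V.not_dvd_bad V.eq_r_pow_mul V.not_dvd_one_sub_c_mul_D (by norm_num)
  rw [mul_pow, mul_pow, ← pow_mul]
  have h1 := V.isCoprime_a_sq_mul_D
  refine IsCoprime.mul_dvd (IsCoprime.mul_left ?_ ?_) (IsCoprime.mul_dvd ?_ ha hD) hr
  · exact h1.of_mul_right_left.pow_left
  · exact V.isCoprime_r_D.symm.pow
  · exact h1.of_mul_right_right.pow

theorem exists_prime_ramified :
    ∃ P : Ideal (𝓞 F), P.IsPrime ∧ (r : 𝓞 F) ∈ P ∧ 1 < P.ramificationIdx ℤ := by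
  obtain ⟨hx, u, hN, hu⟩ := root_sub_ρ_data hf hn V.prime V.not_dvd_bad V.eq_r_pow_mul
    V.not_dvd_one_sub_c_mul_D
  obtain ⟨P, hP, hrP, hxP⟩ := exists_prime_mem_of_dvd_norm V.prime (y := x - (Φ.ρ : 𝓞 F))
    (by rw [hN, sq, mul_assoc]; exact dvd_mul_right _ _)
  refine ⟨P, hP, hrP, ?_⟩
  have h1 := mul_ord_root_sub_ρ hf V.prime hrP V.not_dvd_bad hxP V.eq_r_pow_mul
    V.not_dvd_one_sub_c_mul_D
  have h2 := (ord_pos_iff hx).2 hxP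
  rw [← ord_natCast_eq_ramificationIdx V.prime hrP]
  omega

end Valid
end Family
theorem dvd_of_sq_mul_eq {R : Type*} [CommRing R] [IsDomain R] [IsIntegrallyClosed R] {y z : R}
    {a k : ℤ} (hk : a ^ 2 ∣ k) (h : y ^ 2 = k * z) : (a : R) ∣ y := by
  rw [← IsIntegrallyClosed.pow_dvd_pow_iff two_ne_zero, h, ← Int.cast_pow]
  exact (_root_.map_dvd (Int.castRingHom R) hk).mul_right _

namespace Family

variable {n : ℕ} {Φ : Family n} {F : Type} [Field F] [NumberField F] {x : 𝓞 F} {a : ℤ}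

theorem dvd_pow_mul_aeval (hf : minpoly ℤ x = Φ.poly a) :
    (a : 𝓞 F) ∣ x ^ Φ.m * aeval x Φ.ℓ := by
  refine dvd_of_sq_mul_eq (dvd_mul_left (a ^ 2) Φ.c) (z := aeval x Φ.B * aeval x Φ.ℓ) ?_
  have h := Φ.pow_mul_aeval_ℓ (aeval_eq_zero hf)
  rw [← mul_assoc, ← h]
  ring

theorem dvd_sq_mul_aeval {r : ℤ} (hf : minpoly ℤ x = Φ.poly a) (hr : r ^ 2 ∣ 1 - Φ.c * a ^ 2) :
    (r : 𝓞 F) ∣ (x - Φ.ρ) ^ 2 * aeval x Φ.g := by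
  refine dvd_of_sq_mul_eq ((dvd_neg).2 hr)
    (z := aeval x Φ.B * ((x - Φ.ρ) * aeval x Φ.g)) ?_
  have h := Φ.pow_mul_aeval_g (aeval_eq_zero hf)
  rw [← mul_assoc, ← h]
  ring

omit [NumberField F] in
theorem natDegree_minpoly (hf : minpoly ℤ x = Φ.poly a) : (minpoly ℤ x).natDegree = n := by
  rw [hf, natDegree_poly]

theorem pow_dvd_polyIndex (hf : minpoly ℤ x = Φ.poly a) (hn : Module.finrank ℚ F = n) :
    a ^ Φ.m ∣ (polyIndex x : ℤ) := by
  have hdeg := natDegree_minpoly hf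
  have hm := Φ.natDegree_ℓ
  have h := prod_dvd_polyIndex x (hdeg.trans hn.symm)
    (fun i => if n - Φ.m ≤ i then X ^ (i - Φ.ℓ.natDegree) * Φ.ℓ else X ^ (i : ℕ))
    (fun i => by
      split_ifs
      exacts [(monic_X_pow _).mul Φ.monic_ℓ, monic_X_pow _])
    (fun i => by
      split_ifs
      · rw [Monic.natDegree_mul (monic_X_pow _) Φ.monic_ℓ, natDegree_X_pow]
        omega
      · rw [natDegree_X_pow])
    (fun i => if n - Φ.m ≤ i then a else 1)
    (fun i => by
      split_ifs with hi
      · obtain ⟨k, hk⟩ : ∃ k, (i : ℕ) - Φ.ℓ.natDegree = k + Φ.m :=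
          ⟨i - Φ.ℓ.natDegree - Φ.m, by omega⟩
        rw [hk, pow_add, mul_assoc, map_mul, map_mul, map_pow, map_pow, aeval_X]
        exact (dvd_pow_mul_aeval hf).mul_left _
      · simp)
  convert h
  have h1 := Fin.prod_univ_eq_prod_range (fun i => if n - Φ.m ≤ i then a else 1)
    (minpoly ℤ x).natDegree
  rw [h1, hdeg]
  obtain ⟨k, hk⟩ : ∃ k, n = k + Φ.m := ⟨n - Φ.m, by omega⟩
  rw [show n - Φ.m = k by omega, show Finset.range n = Finset.range (k + Φ.m) by rw [← hk],
    Finset.prod_range_add, Finset.prod_eq_one, one_mul]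
  · simp
  · intro i hi
    rw [if_neg (by simpa using hi)]

theorem dvd_polyIndex {r : ℤ} (hf : minpoly ℤ x = Φ.poly a) (hn : Module.finrank ℚ F = n)
    (hr : r ^ 2 ∣ 1 - Φ.c * a ^ 2) : r ∣ (polyIndex x : ℤ) := by
  have hdeg := natDegree_minpoly hf
  have hg := Φ.natDegree_g
  have h := prod_dvd_polyIndex x (hdeg.trans hn.symm)
    (fun i => if (i : ℕ) = n - 1 then (X - C Φ.ρ) ^ 2 * Φ.g else X ^ (i : ℕ))
    (fun i => by
      split_ifs
      exacts [((monic_X_sub_C _).pow 2).mul Φ.monic_g, monic_X_pow _])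
    (fun i => by
      split_ifs
      · rw [Monic.natDegree_mul ((monic_X_sub_C _).pow 2) Φ.monic_g, natDegree_pow,
          natDegree_X_sub_C]
        omega
      · rw [natDegree_X_pow])
    (fun i => if (i : ℕ) = n - 1 then r else 1)
    (fun i => by
      split_ifs with hi
      · have := dvd_sq_mul_aeval hf hr
        simpa only [map_mul, map_pow, map_sub, aeval_X, eq_intCast, map_intCast] using this
      · simp)
  refine dvd_trans ?_ h
  have hn' : n - 1 < (minpoly ℤ x).natDegree := by omega
  refine dvd_trans ?_ (Finset.dvd_prod_of_mem _ (Finset.mem_univ (⟨n - 1, hn'⟩ : Fin _)))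
  simp

/-- The discriminant identity expected from the roots of the members of the family. -/
def DiscrFormula (Φ : Family n) : Prop :=
  ∀ (a : ℤ), 1 < a → ∀ (F : Type) [Field F] [NumberField F] (x : 𝓞 F),
    minpoly ℤ x = Φ.poly a → Module.finrank ℚ F = n →
    Φ.s ^ 2 * ((polyIndex x : ℤ) ^ 2 * discr F) =
      (Φ.κ * a ^ (2 * Φ.m - 1) * (1 - Φ.c * a ^ 2)) ^ 2

namespace Valid

variable {r : ℕ} {D : ℤ} (V : Φ.Valid a r D)
include V

theorem a_ne_zero : a ≠ 0 := by have := V.one_lt; omega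

theorem D_ne_zero : D ≠ 0 := fun h => V.not_dvd_D (by rw [h]; exact dvd_zero _)

theorem r_ne_zero : (r : ℤ) ≠ 0 := by exact_mod_cast V.prime.ne_zero

theorem coprime_bad : (a ^ Φ.m * r).natAbs.Coprime Φ.bad.natAbs := by
  rw [← Int.isCoprime_iff_nat_coprime]
  exact V.isCoprime_a_bad.pow_left.mul_left V.isCoprime_r_bad

theorem mul_dvd_polyIndex (hf : minpoly ℤ x = Φ.poly a) (hn : Module.finrank ℚ F = n) :
    a ^ Φ.m * r ∣ (polyIndex x : ℤ) :=
  V.isCoprime_a_r.pow_left.mul_dvd (pow_dvd_polyIndex hf hn)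
    (dvd_polyIndex hf hn (V.eq_r_pow_mul ▸ dvd_mul_right _ _))

theorem exists_polyIndex_eq (hΦ : Φ.DiscrFormula) (hf : minpoly ℤ x = Φ.poly a)
    (hn : Module.finrank ℚ F = n) :
    ∃ J : ℕ, polyIndex x = (a ^ Φ.m * r).natAbs * J ∧ J ∣ Φ.bad.natAbs := by
  obtain ⟨J, hJ⟩ := V.mul_dvd_polyIndex hf hn
  refine ⟨J.natAbs, by rw [← Int.natAbs_mul, ← hJ, Int.natAbs_natCast], ?_⟩
  obtain ⟨E, hE⟩ := V.dvd_discr hf hn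
  have h := hΦ a V.one_lt F x hf hn
  have hne : (a ^ (2 * Φ.m - 1) * r ^ 2 * D) ^ 2 ≠ 0 :=
    pow_ne_zero 2 (mul_ne_zero (mul_ne_zero (pow_ne_zero _ V.a_ne_zero)
      (pow_ne_zero _ V.r_ne_zero)) V.D_ne_zero)
  have h1 : (Φ.s * J) ^ 2 * E = (Φ.κ * (1 - Φ.c)) ^ 2 := by
    refine mul_left_cancel₀ hne ?_
    rw [V.eq, hJ, hE] at h
    obtain ⟨k, hk⟩ : ∃ k, Φ.m = k + 1 := ⟨Φ.m - 1, by have := Φ.two_le_m; omega⟩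
    rw [hk, show 2 * (k + 1) - 1 = k + (k + 1) by omega, Nat.add_sub_cancel, pow_add] at h
    rw [hk, show 2 * (k + 1) - 1 = k + (k + 1) by omega, pow_add]
    linear_combination h
  have h2 : Φ.s * J ∣ Φ.κ * (1 - Φ.c) :=
    (Int.pow_dvd_pow_iff two_ne_zero).1 (h1 ▸ dvd_mul_right _ _)
  exact Int.natAbs_dvd_natAbs.2 (((dvd_mul_left _ _).trans h2).trans Φ.κ_mul_dvd_bad)

end Valid

theorem exists_cofactor (hΦ : Φ.DiscrFormula) :
    ∃ J : ℕ, J ∣ Φ.bad.natAbs ∧ ∀ (a : ℤ) (r : ℕ) (D : ℤ), Φ.Valid a r D →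
      ∀ (F : Type) [Field F] [NumberField F] (x : 𝓞 F),
        minpoly ℤ x = Φ.poly a → Module.finrank ℚ F = n →
        polyIndex x = (a ^ Φ.m * r).natAbs * J := by
  by_cases! hex : ∃ (a : ℤ) (r : ℕ) (D : ℤ) (_ : Φ.Valid a r D) (F : Type) (_ : Field F)
      (_ : NumberField F) (x : 𝓞 F), minpoly ℤ x = Φ.poly a ∧ Module.finrank ℚ F = n
  · obtain ⟨a, r, D, V, F, _, _, x, hf, hn⟩ := hex
    obtain ⟨J, hJ, hJb⟩ := V.exists_polyIndex_eq hΦ hf hn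
    refine ⟨J, hJb, fun a' r' D' V' F' _ _ x' hf' hn' => ?_⟩
    obtain ⟨J', hJ', hJb'⟩ := V'.exists_polyIndex_eq hΦ hf' hn'
    rw [hJ', index_cofactor_eq hn hn' (natDegree_minpoly hf) (natDegree_minpoly hf')
      (Int.natAbs_ne_zero.2 Φ.bad_ne_zero) ?_ hJ hJb V.coprime_bad hJ' hJb' V'.coprime_bad]
    have h : Φ.bad ^ n ∣ Φ.c * a ^ 2 - Φ.c * a' ^ 2 := by
      have h1 := dvd_sub V.bad_pow_dvd V'.bad_pow_dvd
      have h2 : Φ.c * a ^ 2 - Φ.c * a' ^ 2 = (a - 1 - (a' - 1)) * (Φ.c * (a + a')) := by ring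
      rw [h2]
      exact h1.mul_right _
    have h3 : minpoly ℤ x - minpoly ℤ x' = -(C (Φ.c * a ^ 2 - Φ.c * a' ^ 2) * Φ.B) := by
      rw [hf, hf', poly, poly, C_sub]
      ring
    rw [h3, dvd_neg]
    refine Dvd.dvd.mul_right (_root_.map_dvd C ?_) _
    rw [Int.natCast_natAbs]
    exact (abs_pow Φ.bad n ▸ (abs_dvd _ _).2 h)
  · exact ⟨1, one_dvd _, fun a r D V F h1 h2 x hf hn => absurd hn (hex a r D V F h1 h2 x hf)⟩

theorem Valid.discr_modEq (hΦ : Φ.DiscrFormula) {r : ℕ} {D : ℤ} (V : Φ.Valid a r D)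
    (hf : minpoly ℤ x = Φ.poly a) (hn : Module.finrank ℚ F = n) {J : ℕ}
    (hJ : polyIndex x = (a ^ Φ.m * r).natAbs * J) {p : ℤ} (hpa : p ∣ a - 1)
    (hpD : p ∣ r ^ 2 * D - 1) :
    (Φ.s * J * r) ^ 2 * discr F ≡ (Φ.κ * (1 - Φ.c)) ^ 2 [ZMOD p] := by
  have h := hΦ a V.one_lt F x hf hn
  have hne : (a ^ Φ.m * r) ^ 2 ≠ 0 :=
    pow_ne_zero 2 (mul_ne_zero (pow_ne_zero _ V.a_ne_zero) V.r_ne_zero)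
  have h1 : (Φ.s * J) ^ 2 * discr F = (Φ.κ * (1 - Φ.c) * a ^ (Φ.m - 1) * D * r) ^ 2 := by
    refine mul_left_cancel₀ hne ?_
    rw [V.eq, hJ, Nat.cast_mul, mul_pow ((_ : ℕ) : ℤ), Int.natAbs_sq] at h
    obtain ⟨k, hk⟩ : ∃ k, Φ.m = k + 1 := ⟨Φ.m - 1, by have := Φ.two_le_m; omega⟩
    rw [hk, show 2 * (k + 1) - 1 = k + (k + 1) by omega, pow_add] at h
    rw [hk, Nat.add_sub_cancel]
    linear_combination h
  have ha : a ≡ 1 [ZMOD p] := (Int.modEq_iff_dvd.2 hpa).symm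
  have hD : r ^ 2 * D ≡ 1 [ZMOD p] := (Int.modEq_iff_dvd.2 hpD).symm
  calc (Φ.s * J * r) ^ 2 * discr F = (Φ.κ * (1 - Φ.c) * a ^ (Φ.m - 1) * (r ^ 2 * D)) ^ 2 := by
        linear_combination (r : ℤ) ^ 2 * h1
    _ ≡ (Φ.κ * (1 - Φ.c) * 1 ^ (Φ.m - 1) * 1) ^ 2 [ZMOD p] := by gcongr
    _ = (Φ.κ * (1 - Φ.c)) ^ 2 := by ring

end Family
theorem int_squarefree_of_forall_prime {a : ℤ} (h : ∀ q : ℕ, q.Prime → ¬ (q : ℤ) ^ 2 ∣ a) :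
    Squarefree a := by
  rw [← Int.squarefree_natAbs, Nat.squarefree_iff_prime_squarefree]
  intro q hq hqa
  exact h q hq (by rw [← sq] at hqa; exact_mod_cast Int.natCast_dvd.2 hqa)

/-- An irreducible monic integer polynomial is the minimal polynomial of an integer of a number
field of the same degree. -/
theorem exists_minpoly_eq {h : ℤ[X]} (hm : h.Monic) (hi : Irreducible h) :
    ∃ (F : Type) (_ : Field F) (_ : NumberField F) (x : 𝓞 F),
      minpoly ℤ x = h ∧ Module.finrank ℚ F = h.natDegree := by
  set f : ℚ[X] := h.map (algebraMap ℤ ℚ) with hf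
  have hfi : Irreducible f := (hm.irreducible_iff_irreducible_map_fraction_map).1 hi
  have : Fact (Irreducible f) := ⟨hfi⟩
  have hfd : FiniteDimensional ℚ (AdjoinRoot f) := (AdjoinRoot.powerBasis hfi.ne_zero).finite
  have hroot : aeval (AdjoinRoot.root f) f = 0 := AdjoinRoot.eval₂_root f ▸ rfl
  have hint : IsIntegral ℤ (AdjoinRoot.root f) :=
    ⟨h, hm, (aeval_map_algebraMap ℚ (AdjoinRoot.root f) h).symm.trans hroot⟩
  have hNF : NumberField (AdjoinRoot f) := { to_finiteDimensional := hfd }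
  let x : 𝓞 (AdjoinRoot f) := ⟨AdjoinRoot.root f, hint⟩
  refine ⟨AdjoinRoot f, inferInstance, hNF, x, ?_, ?_⟩
  · apply map_injective (algebraMap ℤ ℚ) Int.cast_injective
    rw [← minpoly_rat_eq_map]
    exact (minpoly.eq_of_irreducible_of_monic hfi hroot (hm.map _)).symm
  · rw [(AdjoinRoot.powerBasis hfi.ne_zero).finrank, AdjoinRoot.powerBasis_dim,
      hm.natDegree_map]

namespace Family

variable {n : ℕ} (Φ : Family n)

theorem exists_valid {p r : ℕ} (hp : p.Prime) (hr : r.Prime) (hrb : ¬ (r : ℤ) ∣ Φ.bad)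
    (hrp : r ≠ p) (hy : ∃ y : ℤ, (r : ℤ) ∣ 1 - Φ.c * y ^ 2) :
    ∃ (a : ℤ) (D : ℤ), Φ.Valid a r D ∧ (p : ℤ) ∣ a - 1 ∧ (p : ℤ) ∣ r ^ 2 * D - 1 := by
  have hr' := Nat.prime_iff_prime_int.1 hr
  have hn : n ≠ 0 := by have := Φ.four_le; omega
  have h1c := Φ.one_sub_c_dvd_bad
  have h1c0 : 1 - Φ.c ≠ 0 := ne_zero_of_dvd_ne_zero Φ.bad_ne_zero h1c
  have hr1c : ¬ (r : ℤ) ∣ 1 - Φ.c := fun h => hrb (h.trans h1c)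
  set w : ℤ := Φ.bad ^ n * (1 - Φ.c) * p with hw
  have hw0 : w ≠ 0 := mul_ne_zero (mul_ne_zero (pow_ne_zero _ Φ.bad_ne_zero) h1c0)
    (by exact_mod_cast hp.ne_zero)
  have hbw : Φ.bad ∣ w := ((dvd_pow_self _ hn).mul_right _).mul_right _
  have hprime : ∀ q : ℕ, q.Prime → (q : ℤ) ∣ w → (q : ℤ) ∣ Φ.bad * p := fun q hq h => by
    have hq' := Nat.prime_iff_prime_int.1 hq
    rcases hq'.dvd_or_dvd h with h | h
    · rcases hq'.dvd_or_dvd h with h | h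
      · exact (hq'.dvd_of_dvd_pow h).mul_right _
      · exact (h.trans h1c).mul_right _
    · exact h.mul_left _
  obtain ⟨a, ha1, haW, hra, hra', hq⟩ := exists_sieved (W := w.natAbs) (r := r)
    (Int.natAbs_pos.2 hw0) (Int.natCast_dvd.1 (Φ.two_dvd_bad.trans hbw))
    (Int.dvd_natAbs.2 (h1c.trans hbw)) hr (fun h => by
      rcases hr'.dvd_or_dvd (hprime r hr (Int.natCast_dvd.2 h)) with h | h
      · exact hrb h
      · exact hrp ((Nat.prime_dvd_prime_iff_eq hr hp).1 (Int.natCast_dvd_natCast.1 h))) hy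
  replace haW : w ∣ a - 1 := Int.natAbs_dvd.1 haW
  obtain ⟨k, hk⟩ := haW
  have hD : 1 - Φ.c * a ^ 2 = (1 - Φ.c) * (1 - Φ.c * Φ.bad ^ n * p * k * (a + 1)) := by
    rw [hw] at hk
    linear_combination -Φ.c * (a + 1) * hk
  have hrD : (r : ℤ) ^ 2 ∣ 1 - Φ.c * Φ.bad ^ n * p * k * (a + 1) := by
    refine IsCoprime.dvd_of_dvd_mul_left ?_ (hD ▸ hra)
    exact (hr'.coprime_iff_not_dvd.2 hr1c).pow_left
  obtain ⟨D, hD'⟩ := hrD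
  have heq : 1 - Φ.c * a ^ 2 = (1 - Φ.c) * r ^ 2 * D := by rw [hD, hD', mul_assoc]
  have hbpD : Φ.bad * p ∣ r ^ 2 * D - 1 := by
    rw [← hD']
    have h2 : Φ.bad * p ∣ Φ.bad ^ n * p := mul_dvd_mul_right (dvd_pow_self _ hn) _
    exact h2.trans ⟨-(Φ.c * k * (a + 1)), by ring⟩
  have hnat : ∀ q : ℕ, q ∣ w.natAbs ↔ (q : ℤ) ∣ w := fun q => Int.natCast_dvd.symm
  refine ⟨a, D, ⟨ha1, ?_, ?_, hr, hrb, heq, ?_, ?_, (dvd_mul_right _ _).trans hbpD⟩, ?_,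
    (dvd_mul_left _ _).trans hbpD⟩
  · rw [hk]
    exact (((dvd_mul_right _ _).mul_right _).mul_right _)
  · refine int_squarefree_of_forall_prime fun q hq1 hqa => ?_
    have hq' := Nat.prime_iff_prime_int.1 hq1
    replace hqa' : (q : ℤ) ∣ a := (dvd_pow_self _ two_ne_zero).trans hqa
    by_cases hqw : (q : ℤ) ∣ w
    · have h2 := dvd_sub hqa' (hqw.trans ⟨k, hk⟩)
      rw [sub_sub_cancel] at h2
      exact hq'.not_isUnit (isUnit_of_dvd_one h2)
    · by_cases hqr : q = r
      · subst hqr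
        have h2 := (dvd_add_left ((hqa'.pow two_ne_zero).mul_left Φ.c)).2
          ((dvd_pow_self _ two_ne_zero).trans hra)
        rw [sub_add_cancel] at h2
        exact hq'.not_isUnit (isUnit_of_dvd_one h2)
      · exact (hq q hq1 (by rwa [hnat]) hqr).1 hqa
  · refine int_squarefree_of_forall_prime fun q hq1 hqD => ?_
    have hq' := Nat.prime_iff_prime_int.1 hq1
    replace hqD' : (q : ℤ) ∣ D := (dvd_pow_self _ two_ne_zero).trans hqD
    by_cases hqw : (q : ℤ) ∣ w
    · have h2 := dvd_sub (hqD'.mul_left (r ^ 2)) ((hprime q hq1 hqw).trans hbpD)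
      rw [sub_sub_cancel] at h2
      exact hq'.not_isUnit (isUnit_of_dvd_one h2)
    · by_cases hqr : q = r
      · subst hqr
        refine hra' ?_
        rw [heq, pow_succ]
        exact mul_dvd_mul (dvd_mul_left _ _) hqD'
      · exact (hq q hq1 (by rwa [hnat]) hqr).2 (heq ▸ hqD.mul_left _)
  · intro h
    refine hra' ?_
    rw [heq, pow_succ]
    exact mul_dvd_mul (dvd_mul_left _ _) h
  · rw [hk]
    exact (dvd_mul_left _ _).mul_right _

/-- The members of the family with squarefree parameter congruent to `1` are irreducible. -/
def IrreducibleMembers : Prop :=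
  ∀ a : ℤ, 1 < a → Φ.bad ∣ a - 1 → Squarefree a →
    Irreducible ((Φ.poly a).map (algebraMap ℤ ℚ))

/-- The root fields of the members of the family have no proper intermediate fields. -/
def PrimitiveMembers : Prop :=
  ∀ a : ℤ, 1 < a → Φ.bad ∣ a - 1 → Squarefree a →
    ∀ (F : Type) [Field F] [NumberField F] (x : 𝓞 F), minpoly ℤ x = Φ.poly a →
      Module.finrank ℚ F = n → ∀ E : IntermediateField ℚ F, E = ⊥ ∨ E = ⊤

variable {Φ}

theorem Valid.nonempty_gal_mulEquiv (hdisc : Φ.DiscrFormula) (hirr : Φ.IrreducibleMembers)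
    (hprim : Φ.PrimitiveMembers) {a : ℤ} {r : ℕ} {D : ℤ} (V : Φ.Valid a r D) {K : Type} [Field K]
    [NumberField K] (hK : IsSplittingField ℚ K ((Φ.poly a).map (algebraMap ℤ ℚ))) :
    Nonempty ((K ≃ₐ[ℚ] K) ≃* alternatingGroup (Fin n)) := by
  have hr' := Nat.prime_iff_prime_int.1 V.prime
  refine nonempty_gal_mulEquiv_alternatingGroup (g := Φ.g) (r := r) (ρ := Φ.ρ) (Φ.monic_poly a)
    (Φ.natDegree_poly a) (by have := Φ.four_le; omega)
    (hirr a V.one_lt V.bad_dvd_sub_one V.squarefree_a) hK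
    (hprim a V.one_lt V.bad_dvd_sub_one V.squarefree_a) (fun F _ _ x hf hn => ?_) V.prime ?_
    (fun h => V.not_dvd_bad (h.trans Φ.g_ρ_dvd_bad)) (fun k _ _ z hk hz hz' => ?_)
    (fun F _ _ x hf hn => V.exists_prime_ramified hf hn)
  · refine ⟨Φ.s * polyIndex x, Φ.κ * a ^ (2 * Φ.m - 1) * (1 - Φ.c * a ^ 2), ?_, ?_⟩
    · refine mul_ne_zero (ne_zero_of_dvd_ne_zero Φ.bad_ne_zero Φ.s_dvd_bad) ?_
      exact_mod_cast polyIndex_ne_zero x ((natDegree_minpoly hf).trans hn.symm)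
    · rw [← hdisc a V.one_lt F x hf hn]
      ring
  · rw [poly_eq, add_sub_cancel_left, V.eq_r_pow_mul, sq, mul_assoc, C_mul, mul_assoc]
    exact dvd_mul_right _ _
  · have hne : ∀ t : ℤ, ¬ (r : ℤ) ∣ t → (t : k) ≠ 0 := fun t ht h => by
      obtain ⟨u, v, huv⟩ := hr'.coprime_iff_not_dvd.2 ht
      have h2 := congrArg (Int.cast : ℤ → k) huv
      push_cast at h2
      rw [hk, h, mul_zero, mul_zero, add_zero] at h2
      exact zero_ne_one h2
    have h1 := Φ.aeval_derivative_mul hz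
    rw [hz', zero_mul] at h1
    have hlam := hne Φ.lam fun h => V.not_dvd_bad (h.trans Φ.lam_dvd_bad)
    have hz0 : z ≠ 0 := by
      rintro rfl
      rw [← coeff_zero_eq_aeval_zero', coeff_zero_eq_eval_zero, eval_zero_poly, eq_intCast] at hz
      refine hne _ (fun h => ?_) hz
      rw [dvd_neg] at h
      rcases hr'.dvd_or_dvd h with h | h
      · rcases hr'.dvd_or_dvd h with h | h
        · exact V.not_dvd_bad (h.trans Φ.c_dvd_bad)
        · exact not_natCast_dvd_of_isCoprime V.isCoprime_a_r V.prime (hr'.dvd_of_dvd_pow h) dvd_rfl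
      · exact V.not_dvd_bad (h.trans Φ.B_zero_dvd_bad)
    exact sub_eq_zero.1 (eq_zero_of_pow_eq_zero ((mul_eq_zero.1 h1.symm).resolve_left
      (mul_ne_zero hlam (pow_ne_zero _ hz0))))

theorem exists_alternating_discr_modEq (hdisc : Φ.DiscrFormula) (hirr : Φ.IrreducibleMembers)
    (hprim : Φ.PrimitiveMembers) :
    ∃ S₀ : Finset ℕ, (∀ q ∈ S₀, q.Prime) ∧
      ∀ p : ℕ, p.Prime → p ∉ S₀ → ∀ k : ℤ, ¬ ((p : ℤ) ∣ k) →
        ∃ f : Polynomial ℚ, Irreducible f ∧ f.natDegree = n ∧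
          (∃ (K : Type) (_ : Field K) (_ : Algebra ℚ K),
            Polynomial.IsSplittingField ℚ K f ∧
            Nonempty ((K ≃ₐ[ℚ] K) ≃* alternatingGroup (Fin n))) ∧
          (∃ (F : Type) (_ : Field F) (_ : NumberField F) (x : F),
            Polynomial.aeval x f = 0 ∧ Module.finrank ℚ F = n ∧
            (NumberField.discr F : ℤ) ≡ k ^ 2 [ZMOD (p : ℤ)]) := by
  obtain ⟨J, hJb, hJ⟩ := exists_cofactor hdisc
  refine ⟨Φ.bad.natAbs.primeFactors, fun q => Nat.prime_of_mem_primeFactors,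
    fun p hp hpS k hpk => ?_⟩
  have hp' := Nat.prime_iff_prime_int.1 hp
  have hpb : ¬ (p : ℤ) ∣ Φ.bad := fun h => hpS (Nat.mem_primeFactors.2
    ⟨hp, Int.natCast_dvd.1 h, Int.natAbs_ne_zero.2 Φ.bad_ne_zero⟩)
  have hpJ : ¬ (p : ℤ) ∣ J := fun h => hpb (h.trans (Int.natCast_dvd.2 hJb))
  have hps : ¬ (p : ℤ) ∣ Φ.s := fun h => hpb (h.trans Φ.s_dvd_bad)
  have hpsJk : ¬ (p : ℤ) ∣ Φ.s * J * k := fun h => by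
    rcases hp'.dvd_or_dvd h with h | h
    · exact (hp'.dvd_or_dvd h).elim hps hpJ
    · exact hpk h
  obtain ⟨u, v, huv⟩ := hp'.coprime_iff_not_dvd.2 hpsJk
  have hpΔ : ¬ (p : ℤ) ∣ Φ.κ * (1 - Φ.c) := fun h => hpb (h.trans Φ.κ_mul_dvd_bad)
  have hpt : ¬ (p : ℤ) ∣ v * (Φ.κ * (1 - Φ.c)) := fun h => by
    rcases hp'.dvd_or_dvd h with h | h
    · refine hp'.not_isUnit (isUnit_of_dvd_one (huv ▸ dvd_add (dvd_mul_left _ _) (h.mul_right _)))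
    · exact hpΔ h
  have hc0 : Φ.c ≠ 0 := ne_zero_of_dvd_ne_zero Φ.bad_ne_zero Φ.c_dvd_bad
  have hpc : ¬ p ∣ 8 * Φ.c.natAbs := fun h => by
    rcases hp.dvd_mul.1 h with h | h
    · have h2 : (p : ℤ) ∣ 2 := by
        exact_mod_cast hp.dvd_of_dvd_pow (show p ∣ 2 ^ 3 from h)
      exact hpb (h2.trans Φ.two_dvd_bad)
    · exact hpb ((Int.natCast_dvd.2 h).trans Φ.c_dvd_bad)
  obtain ⟨r, hr, hrN, hrt, hry⟩ := exists_prime_modEq hc0 hp hpc hpt (Φ.bad.natAbs + p)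
  have hrb : ¬ (r : ℤ) ∣ Φ.bad := fun h => by
    have := Nat.le_of_dvd (Int.natAbs_pos.2 Φ.bad_ne_zero) (Int.natCast_dvd.1 h)
    omega
  obtain ⟨a, D, V, hpa, hpD⟩ := Φ.exists_valid hp hr hrb (by omega) hry
  have hirr' := hirr a V.one_lt V.bad_dvd_sub_one V.squarefree_a
  have hdeg : ((Φ.poly a).map (algebraMap ℤ ℚ)).natDegree = n := by
    rw [(Φ.monic_poly a).natDegree_map, natDegree_poly]
  set f : ℚ[X] := (Φ.poly a).map (algebraMap ℤ ℚ) with hfdef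
  refine ⟨f, hirr', hdeg, ?_, ?_⟩
  · have hK : @IsSplittingField ℚ f.SplittingField _ _ DivisionRing.toRatAlgebra f := by
      convert IsSplittingField.splittingField f
      exact Subsingleton.elim _ _
    have hfd : FiniteDimensional ℚ f.SplittingField := IsSplittingField.finiteDimensional _ f
    have : NumberField f.SplittingField := { to_finiteDimensional := hfd }
    exact ⟨f.SplittingField, inferInstance, DivisionRing.toRatAlgebra, hK,
      V.nonempty_gal_mulEquiv hdisc hirr hprim hK⟩
  · obtain ⟨F, _, _, x, hmin, hn⟩ := exists_minpoly_eq (Φ.monic_poly a)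
      ((Φ.monic_poly a).irreducible_iff_irreducible_map_fraction_map.2 hirr')
    rw [natDegree_poly] at hn
    refine ⟨F, inferInstance, inferInstance, x, ?_, hn, ?_⟩
    · rw [hfdef, aeval_map_algebraMap, ← hmin, aeval_algebraMap_apply, minpoly.aeval, map_zero]
    have h2 := V.discr_modEq hdisc hmin hn (hJ a r D V _ x hmin hn) hpa hpD
    have h3 : k * (Φ.s * J * r) ≡ Φ.κ * (1 - Φ.c) [ZMOD p] := by
      calc k * (Φ.s * J * r) ≡ k * (Φ.s * J * (v * (Φ.κ * (1 - Φ.c)))) [ZMOD p] := by gcongr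
        _ = (u * p + v * (Φ.s * J * k)) * (Φ.κ * (1 - Φ.c)) + p * (-u * (Φ.κ * (1 - Φ.c))) := by
          ring
        _ ≡ Φ.κ * (1 - Φ.c) + 0 [ZMOD p] := by
          rw [huv, one_mul]
          exact Int.ModEq.add_left _ (Int.modEq_zero_iff_dvd.2 (dvd_mul_right _ _))
        _ = _ := add_zero _
    have h4 : (Φ.s * J * r) ^ 2 * discr F ≡ (Φ.s * J * r) ^ 2 * k ^ 2 [ZMOD p] := by
      refine h2.trans ?_
      have h5 := (h3.pow 2).symm
      rwa [mul_pow k, mul_comm (k ^ 2)] at h5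
    have h6 : ¬ (p : ℤ) ∣ Φ.s * J * r := fun h => hpΔ ((Int.ModEq.dvd_iff h3).1 (h.mul_left _))
    rw [Int.modEq_iff_dvd, ← mul_sub] at h4
    exact Int.modEq_iff_dvd.2 ((hp'.dvd_or_dvd h4).resolve_left fun h => h6 (hp'.dvd_of_dvd_pow h))

end Family
theorem norm_intCast {F : Type*} [Field F] [NumberField F] (k : ℤ) :
    Algebra.norm ℤ (k : 𝓞 F) = k ^ Module.finrank ℚ F := by
  rw [← eq_intCast (algebraMap ℤ (𝓞 F)), Algebra.norm_algebraMap, RingOfIntegers.rank]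

theorem exists_irreducible_factor {q w : ℕ} {f : ℤ[X]} (hm : f.Monic)
    (hf : ¬ (q : ℤ) ^ (w * f.natDegree) ∣ f.eval 0) :
    ∃ h : ℤ[X], h.Monic ∧ Irreducible h ∧ h ∣ f ∧ ¬ (q : ℤ) ^ (w * h.natDegree) ∣ h.eval 0 := by
  induction hd : f.natDegree using Nat.strong_induction_on generalizing f with
  | _ d ih =>
    by_cases hi : Irreducible f
    · exact ⟨f, hm, hi, dvd_rfl, hf⟩
    · have hf1 : f ≠ 1 := by
        rintro rfl
        simp at hf
      rw [hm.irreducible_iff_natDegree' ] at hi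
      simp only [not_and, not_forall] at hi
      obtain ⟨g₁, g₂, hg₁, hg₂, rfl, hlt⟩ := hi hf1
      rw [not_not, Finset.mem_Ioc, hg₁.natDegree_mul hg₂] at hlt
      rw [hg₁.natDegree_mul hg₂] at hf hd
      by_cases h1 : (q : ℤ) ^ (w * g₁.natDegree) ∣ g₁.eval 0
      · by_cases h2 : (q : ℤ) ^ (w * g₂.natDegree) ∣ g₂.eval 0
        · exact absurd (by rw [mul_add, pow_add, eval_mul]; exact mul_dvd_mul h1 h2) hf
        · obtain ⟨h, ha, hb, hc, he⟩ := ih _ (by omega) hg₂ h2 rfl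
          exact ⟨h, ha, hb, hc.mul_left _, he⟩
      · obtain ⟨h, ha, hb, hc, he⟩ := ih _ (by omega) hg₁ h1 rfl
        exact ⟨h, ha, hb, hc.mul_right _, he⟩

theorem exists_ord_lt {F : Type*} [Field F] [NumberField F] {x : 𝓞 F} {q w : ℕ} (hq : q.Prime)
    (h : ¬ (q : ℤ) ^ (w * Module.finrank ℚ F) ∣ Algebra.norm ℤ x) :
    x ≠ 0 ∧ ∃ P : Ideal (𝓞 F), P.IsPrime ∧ (q : 𝓞 F) ∈ P ∧ ord P x < w * ord P (q : 𝓞 F) := by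
  have hx : x ≠ 0 := by
    rintro rfl
    simp at h
  have hq0 : (q : 𝓞 F) ≠ 0 := by exact_mod_cast hq.ne_zero
  refine ⟨hx, ?_⟩
  by_contra! hP
  refine h ?_
  have hdvd : (q : 𝓞 F) ^ w ∣ x := by
    refine dvd_of_ord_le (pow_ne_zero _ hq0) hx fun P hPp hP0 hqP => ?_
    rw [ord_pow hP0 hq0]
    exact hP P hPp (hPp.mem_of_pow_mem _ hqP)
  have h2 := _root_.map_dvd (Algebra.norm ℤ) hdvd
  rwa [map_pow, ← Int.cast_natCast, norm_intCast, ← pow_mul, mul_comm] at h2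

theorem ord_add_pow_mul {R : Type*} [CommRing R] [IsDedekindDomain R] {P : Ideal R} [P.IsPrime]
    (hP : P ≠ ⊥) {y t z : R} {w : ℕ} (hy : y ≠ 0) (ht : t ≠ 0) (h : ord P y < w * ord P t) :
    ord P (y + t ^ w * z) = ord P y := by
  by_cases hz : z = 0
  · rw [hz, mul_zero, add_zero]
  · refine ord_add_eq hy (mul_ne_zero (pow_ne_zero _ ht) hz) ?_
    rw [ord_mul hP (pow_ne_zero _ ht) hz, ord_pow hP ht]
    omega

theorem dvd_of_mul_eq_mul {N t e E : ℕ} (hN : Odd N) (he : e = 1 ∨ e = 2) (h : N * t = e * E) :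
    N ∣ E := by
  have hco : N.Coprime e := by
    rcases he with rfl | rfl
    · exact Nat.coprime_one_right N
    · exact hN.coprime_two_right
  exact hco.dvd_of_dvd_mul_left ⟨t, h.symm⟩

/-- Every `N ≥ 2` can be written as a prime power times a cofactor, the exponent being `1` or `2`
up to an even number. -/
theorem exists_prime_pow_mul {N : ℤ} (hN : 2 ≤ N) :
    ∃ (q w e j : ℕ) (u : ℤ), q.Prime ∧ N = q ^ w * u ∧ ¬ (q : ℤ) ∣ u ∧ w = 2 * j + e ∧
      (e = 1 ∨ e = 2) := by
  obtain ⟨q, hq, hqN⟩ := Nat.exists_prime_and_dvd (n := N.natAbs) (by omega)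
  have hqN' : (q : ℤ) ∣ N := Int.natCast_dvd.2 hqN
  have hf : FiniteMultiplicity (q : ℤ) N :=
    Int.finiteMultiplicity_iff.2 ⟨by simpa using hq.ne_one, by omega⟩
  obtain ⟨u, h1, h2⟩ := hf.exists_eq_pow_mul_and_not_dvd
  set w := multiplicity (q : ℤ) N
  have hw : w ≠ 0 := by
    intro h0
    rw [h0, pow_zero, one_mul] at h1
    exact h2 (h1 ▸ hqN')
  refine ⟨q, w, 2 - w % 2, (w - (2 - w % 2)) / 2, u, hq, h1, h2, ?_, ?_⟩ <;> omega

/-- A number field with a prime of ramification index less than, but close to, the degree has no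
proper intermediate fields. -/
theorem eq_bot_or_eq_top_of_ramificationIdx {F : Type*} [Field F] [NumberField F] (P : Ideal (𝓞 F))
    [P.IsPrime] (hlt : P.ramificationIdx ℤ < Module.finrank ℚ F)
    (h : ∀ d, d ∣ Module.finrank ℚ F → d ≠ 1 → Module.finrank ℚ F < P.ramificationIdx ℤ + d)
    (E : IntermediateField ℚ F) : E = ⊥ ∨ E = ⊤ := by
  have h1 := Ideal.ramificationIdx_tower (R := ℤ) (P.under (𝓞 E)) P
  have h2 := ramificationIdx_le_finrank (A := ℤ) (P.under (𝓞 E))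
  have h3 := ramificationIdx_le_finrank (A := 𝓞 E) P
  rw [RingOfIntegers.rank] at h2
  rw [← IsFractionRing.finrank_eq (𝓞 E) E (𝓞 F) F] at h3
  have h4 := Module.finrank_mul_finrank ℚ E F
  rw [h1] at hlt h
  rw [← IntermediateField.finrank_eq_one_iff, ← IntermediateField.finrank_eq_one_iff_eq_top]
  by_contra! hne
  rw [← h4] at hlt h
  have h5 := h _ (dvd_mul_right _ _) hne.1
  have h6 := h _ (dvd_mul_left _ _) hne.2
  generalize Module.finrank ℚ E = a at *
  generalize Module.finrank E F = b at *
  generalize (P.under (𝓞 E)).ramificationIdx ℤ = e₁ at *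
  generalize P.ramificationIdx (𝓞 E) = e₂ at *
  rcases h2.lt_or_eq with h2 | rfl
  · nlinarith
  · rcases h3.lt_or_eq with h3 | rfl
    · nlinarith
    · exact lt_irrefl _ hlt

namespace Family

variable {n : ℕ} {Φ : Family n} {F : Type} [Field F] [NumberField F] {x : 𝓞 F} {a : ℤ}

/-- The norm of the different of a root. -/
theorem norm_aeval_derivative (hf : minpoly ℤ x = Φ.poly a) (hn : Module.finrank ℚ F = n)
    (ha : a ≠ 0) : Algebra.norm ℤ (aeval x (derivative (Φ.poly a))) * Algebra.norm ℤ x *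
      Algebra.norm ℤ (aeval x Φ.ℓ) =
        Φ.lam ^ n * Algebra.norm ℤ (x - (Φ.ρ : 𝓞 F)) ^ 2 * (Φ.c * a ^ 2) ^ n := by
  have h1 := congrArg (Algebra.norm ℤ) (Φ.pow_mul_aeval_ℓ (aeval_eq_zero hf))
  have h2 := congrArg (Algebra.norm ℤ) (Φ.aeval_derivative_mul (aeval_eq_zero hf))
  simp only [map_mul, map_pow, norm_intCast, hn] at h1 h2
  have hc0 : Φ.c ≠ 0 := ne_zero_of_dvd_ne_zero Φ.bad_ne_zero Φ.c_dvd_bad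
  have hB0 := ne_zero_of_dvd_ne_zero Φ.bad_ne_zero Φ.B_zero_dvd_bad
  have hx0 : Algebra.norm ℤ x ≠ 0 := by
    rw [norm_root hf hn]
    exact mul_ne_zero (pow_ne_zero _ (by norm_num))
      (neg_ne_zero.2 (mul_ne_zero (mul_ne_zero hc0 (pow_ne_zero _ ha)) hB0))
  obtain ⟨k, hk⟩ : ∃ k, 2 * Φ.m = k + 1 := ⟨2 * Φ.m - 1, by have := Φ.two_le_m; omega⟩
  rw [hk, pow_succ] at h1
  rw [hk, Nat.add_sub_cancel] at h2
  refine mul_left_cancel₀ (pow_ne_zero k hx0) ?_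
  linear_combination Algebra.norm ℤ (aeval x (derivative (Φ.poly a))) * h1 +
    (Φ.c * a ^ 2) ^ n * h2

end Family
theorem not_pow_dvd_pow_mul {q u : ℤ} (hq : Prime q) {v N : ℕ} (h : v < N) (hu : ¬ q ∣ u) :
    ¬ q ^ N ∣ q ^ v * u := fun hd => by
  obtain ⟨k, rfl⟩ : ∃ k, N = v + (k + 1) := ⟨N - v - 1, by omega⟩
  rw [pow_add, mul_dvd_mul_iff_left (pow_ne_zero _ hq.ne_zero)] at hd
  exact hu ((dvd_pow_self _ k.succ_ne_zero).trans hd)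

theorem irreducible_of_natDegree_le {f h : ℤ[X]} (hf : f.Monic) (hh : h.Monic)
    (hi : Irreducible h) (hd : h ∣ f) (hle : f.natDegree ≤ h.natDegree) : Irreducible f :=
  eq_of_monic_of_dvd_of_natDegree_le hh hf hd hle ▸ hi

theorem exists_root_of_natDegree_eq_succ {f h : ℤ[X]} (hf : f.Monic) (hh : h.Monic) (hd : h ∣ f)
    (hdeg : f.natDegree = h.natDegree + 1) : ∃ t : ℤ, f.eval t = 0 := by
  obtain ⟨k, rfl⟩ := hd
  have hk := hh.of_mul_monic_left hf
  rw [hh.natDegree_mul hk, Nat.add_left_cancel_iff] at hdeg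
  refine ⟨-k.coeff 0, ?_⟩
  rw [eval_mul, hk.eq_X_add_C hdeg]
  simp

/-- A monic polynomial whose value at `0` is not too divisible by `q` has an irreducible factor with
a root of small norm. -/
theorem exists_factor_root {q w : ℕ} {f : ℤ[X]} (hm : f.Monic)
    (hf : ¬ (q : ℤ) ^ (w * f.natDegree) ∣ f.eval 0) :
    ∃ h : ℤ[X], h.Monic ∧ Irreducible h ∧ h ∣ f ∧
      ∃ (F : Type) (_ : Field F) (_ : NumberField F) (x : 𝓞 F), aeval x f = 0 ∧
        Module.finrank ℚ F = h.natDegree ∧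
        ¬ (q : ℤ) ^ (w * Module.finrank ℚ F) ∣ Algebra.norm ℤ x := by
  obtain ⟨h, hhm, hhi, hhd, hh⟩ := exists_irreducible_factor hm hf
  obtain ⟨F, _, _, x, hx, hn⟩ := exists_minpoly_eq hhm hhi
  refine ⟨h, hhm, hhi, hhd, F, inferInstance, inferInstance, x, ?_, hn, ?_⟩
  · obtain ⟨k, rfl⟩ := hhd
    rw [map_mul, ← hx, minpoly.aeval, zero_mul]
  · have h0 := norm_sub_intCast hx hn rfl 0
    rw [Int.cast_zero, sub_zero] at h0
    rw [h0, hn]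
    rcases neg_one_pow_eq_or ℤ h.natDegree with h1 | h1 <;> simpa [h1] using hh

theorem sub_pow_three_dvd {R : Type*} [CommRing R] (x y : R) (k : ℕ) (b : ℤ)
    (hb : 2 * b = (k + 2) * (k + 1)) :
    (x - y) ^ 3 ∣ x ^ (k + 2) - (y ^ (k + 2) + (k + 2) * y ^ (k + 1) * (x - y) +
      b * y ^ k * (x - y) ^ 2) := by
  induction k generalizing b with
  | zero =>
    obtain rfl : b = 1 := by push_cast at hb; omega
    exact ⟨0, by norm_num; ring⟩
  | succ k ih =>
    obtain ⟨z, hz⟩ := ih (b - (k + 2)) (by push_cast at hb; linear_combination hb)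
    refine ⟨x * z + (b - (k + 2)) * y ^ k, ?_⟩
    push_cast at hz ⊢
    linear_combination x * hz

theorem eval_cofactor_ne_zero {A B g : ℤ[X]} {ρ lam : ℤ} {k : ℕ} (hg : A - B = (X - C ρ) ^ 3 * g)
    (hw : derivative A * B - A * derivative B = C lam * X ^ k * (X - C ρ) ^ 2)
    (hne : lam * ρ ^ k ≠ 0) : g.eval ρ ≠ 0 := fun h0 => by
  have h := congrArg derivative hg
  rw [derivative_sub, derivative_mul, derivative_X_sub_C_pow] at h
  have h1 : (X - C ρ) ^ 2 * ((3 * g + (X - C ρ) * derivative g) * B -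
      (X - C ρ) * g * derivative B) = (X - C ρ) ^ 2 * (C lam * X ^ k) := by
    simp only [eq_intCast, Nat.cast_ofNat, Nat.add_one_sub_one] at h hg hw ⊢
    linear_combination -B * h + derivative B * hg + hw
  have h2 := congrArg (eval ρ) (mul_left_cancel₀ (pow_ne_zero 2 (X_sub_C_ne_zero ρ)) h1)
  refine hne ?_
  simpa [h0] using h2.symm

namespace Family

/-- Constructor for `Family`, where the cofactor in the fibre over `1` is obtained from a
divisibility. -/
noncomputable def ofDvd {n m : ℕ} {ℓ B : ℤ[X]} {c ρ lam κ s : ℤ} (hm : 2 ≤ m) (hℓ : ℓ.Monic)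
    (hℓn : 2 * m + ℓ.natDegree = n) (hB : B.degree < n)
    (hdvd : (X - C ρ) ^ 3 ∣ X ^ (2 * m) * ℓ - B)
    (hw : derivative (X ^ (2 * m) * ℓ) * B - X ^ (2 * m) * ℓ * derivative B =
      C lam * X ^ (2 * m - 1) * (X - C ρ) ^ 2) (hc : c ≠ 0) (hc1 : c ≠ 1) (hρ : ρ ≠ 0)
    (hlam : lam ≠ 0) (hB0 : B.eval 0 ≠ 0) (hℓ0 : ℓ.eval 0 ≠ 0) (hBρ : B.eval ρ ≠ 0)
    (hκ : κ ≠ 0) (hs : s ≠ 0) : Family n where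
  m := m
  ℓ := ℓ
  B := B
  g := hdvd.choose
  c := c
  ρ := ρ
  lam := lam
  κ := κ
  s := s
  two_le_m := hm
  monic_ℓ := hℓ
  natDegree_ℓ := hℓn
  degree_B := hB
  sub_eq := hdvd.choose_spec
  wronskian := hw
  monic_g := by
    refine ((monic_X_sub_C ρ).pow 3).of_mul_monic_left ?_
    rw [← hdvd.choose_spec]
    refine ((monic_X_pow _).mul hℓ).sub_of_left ?_
    rwa [degree_eq_natDegree ((monic_X_pow _).mul hℓ).ne_zero,
      (monic_X_pow _).natDegree_mul hℓ, natDegree_X_pow, hℓn]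
  natDegree_g := by
    have h1 : (X ^ (2 * m) * ℓ).degree = (n : WithBot ℕ) := by
      rw [degree_eq_natDegree ((monic_X_pow _).mul hℓ).ne_zero,
        (monic_X_pow _).natDegree_mul hℓ, natDegree_X_pow, hℓn]
    have h2 : ((X - C ρ) ^ 3 * hdvd.choose).degree = (n : WithBot ℕ) := by
      rw [← hdvd.choose_spec, degree_sub_eq_left_of_degree_lt (by rwa [h1]), h1]
    have h3 := natDegree_eq_of_degree_eq_some h2
    have h4 : hdvd.choose ≠ 0 := by
      intro h0
      rw [h0, mul_zero, degree_zero] at h2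
      exact absurd h2 (WithBot.bot_ne_coe)
    rw [((monic_X_sub_C ρ).pow 3).natDegree_mul' h4, natDegree_pow, natDegree_X_sub_C] at h3
    omega
  ne_zero := by
    have hg : hdvd.choose.eval ρ ≠ 0 :=
      eval_cofactor_ne_zero hdvd.choose_spec hw (mul_ne_zero hlam (pow_ne_zero _ hρ))
    have hc1' : 1 - c ≠ 0 := sub_ne_zero.2 hc1.symm
    simp only [ne_eq, mul_eq_zero, not_or]
    exact ⟨⟨⟨⟨⟨⟨⟨⟨⟨two_ne_zero, hc⟩, hlam⟩, hB0⟩, hℓ0⟩, hBρ⟩, hg⟩, hκ⟩, hs⟩, hc1'⟩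

variable {n : ℕ} (Φ : Family n)

theorem eval_poly_ne_zero (hℓ : Φ.ℓ = 1) {a : ℤ} (ha : 1 < a) (hab : Φ.bad ∣ a - 1)
    (hsq : Squarefree a) (t : ℤ) : (Φ.poly a).eval t ≠ 0 := by
  intro h
  obtain ⟨q, hq, hqa⟩ := Nat.exists_prime_and_dvd (n := a.natAbs) (by omega)
  replace hqa : (q : ℤ) ∣ a := Int.natCast_dvd.2 hqa
  have hq' := Nat.prime_iff_prime_int.1 hq
  have hqb := not_natCast_dvd_of_isCoprime (isCoprime_of_dvd_sub_one hab) hq hqa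
  obtain ⟨u, rfl, hu⟩ := exists_eq_mul_of_squarefree hsq hq hqa
  have h1 : t ^ (2 * Φ.m) = q ^ 2 * (Φ.c * u ^ 2 * Φ.B.eval t) := by
    simp only [poly, eval_sub, eval_mul, eval_pow, eval_X, eval_C, hℓ, eval_one] at h
    linear_combination h
  have ht : (q : ℤ) ∣ t :=
    hq'.dvd_of_dvd_pow (h1 ▸ (dvd_pow_self _ two_ne_zero).mul_right _)
  have hB : ¬ (q : ℤ) ∣ Φ.B.eval t := fun h2 => hqb <| .trans
    ((dvd_sub_right h2).1 (ht.trans (by simpa using sub_dvd_eval_sub t 0 Φ.B))) Φ.B_zero_dvd_bad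
  refine not_pow_dvd_pow_mul (v := 2) (N := 2 * Φ.m) (u := Φ.c * u ^ 2 * Φ.B.eval t) hq'
    (by have := Φ.two_le_m; omega) (fun h2 => ?_) (h1 ▸ pow_dvd_pow_of_dvd ht _)
  rcases hq'.dvd_or_dvd h2 with h2 | h2
  · rcases hq'.dvd_or_dvd h2 with h2 | h2
    · exact hqb (h2.trans Φ.c_dvd_bad)
    · exact hu (hq'.dvd_of_dvd_pow h2)
  · exact hB h2

end Family
/-- The denominator of the family of degree `2 * m`. -/
noncomputable def evenB (m : ℤ) : ℤ[X] :=
  C (m * (2 * m - 1)) * X ^ 2 - C (2 * m * (2 * m - 2)) * X + C ((2 * m - 1) * (m - 1))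

theorem eval_evenB (m t : ℤ) : (evenB m).eval t =
    m * (2 * m - 1) * t ^ 2 - 2 * m * (2 * m - 2) * t + (2 * m - 1) * (m - 1) := by
  simp [evenB]

theorem evenB_dvd {m : ℕ} (hm : 2 ≤ m) : (X - C 1) ^ 3 ∣ X ^ (2 * m) * 1 - evenB m := by
  obtain ⟨k, rfl⟩ : ∃ k, m = k + 1 := ⟨m - 1, by omega⟩
  obtain ⟨z, hz⟩ := sub_pow_three_dvd (X : ℤ[X]) 1 (2 * k) ((k + 1) * (2 * k + 1))
    (by push_cast; ring)
  refine ⟨z, ?_⟩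
  simp only [evenB, eq_intCast] at hz ⊢
  push_cast at hz ⊢
  linear_combination hz

theorem evenB_wronskian {m : ℕ} (hm : 2 ≤ m) :
    derivative (X ^ (2 * m) * 1) * evenB m - X ^ (2 * m) * 1 * derivative (evenB m) =
      C (m * (2 * m - 1) * (2 * m - 2) : ℤ) * X ^ (2 * m - 1) * (X - C 1) ^ 2 := by
  obtain ⟨k, rfl⟩ : ∃ k, m = k + 1 := ⟨m - 1, by omega⟩
  rw [show 2 * (k + 1) = 2 * k + 1 + 1 by ring, Nat.add_sub_cancel, mul_one, evenB]
  simp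
  ring

theorem evenB_degree_lt {m : ℕ} (hm : 2 ≤ m) : (evenB m).degree < (2 * m : ℕ) := by
  refine lt_of_le_of_lt (b := ((2 : ℕ) : WithBot ℕ)) ?_ (by exact_mod_cast (by omega))
  unfold evenB
  compute_degree
  norm_num

/-- The family of degree `2 * m`. -/
noncomputable def evenFamily {m : ℕ} (hm : 2 ≤ m) {c s : ℤ} (hc : c ≠ 0) (hc1 : c ≠ 1)
    (hs : s ^ 2 * c = (-1) ^ (m + 1) * ((2 * m - 1) * (m - 1))) : Family (2 * m) :=
  have h0 : ((2 * m - 1) * (m - 1) : ℤ) ≠ 0 := mul_ne_zero (by omega) (by omega)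
  have hlam : (m * (2 * m - 1) * (2 * m - 2) : ℤ) ≠ 0 :=
    mul_ne_zero (mul_ne_zero (by omega) (by omega)) (by omega)
  .ofDvd (κ := (m * (2 * m - 1) * (2 * m - 2) : ℤ) ^ m * c ^ (m - 1)) (s := s) hm monic_one
    (by simp) (evenB_degree_lt hm) (evenB_dvd hm) (evenB_wronskian hm) hc hc1 one_ne_zero hlam
    (by rw [eval_evenB]; convert h0 using 1; ring) (by simp)
    (by rw [eval_evenB]; convert one_ne_zero (α := ℤ) using 1; ring)
    (mul_ne_zero (pow_ne_zero _ hlam) (pow_ne_zero _ hc)) (by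
      rintro rfl
      rw [zero_pow two_ne_zero, zero_mul] at hs
      exact mul_ne_zero (pow_ne_zero _ (by norm_num)) h0 hs.symm)

section

variable {m : ℕ} (hm : 2 ≤ m) {c s : ℤ} (hc : c ≠ 0) (hc1 : c ≠ 1)
    (hs : s ^ 2 * c = (-1) ^ (m + 1) * ((2 * m - 1) * (m - 1)))

theorem evenFamily_discrFormula : (evenFamily hm hc hc1 hs).DiscrFormula := by
  intro a ha F _ _ x hf hn
  have hs' := hs
  have h1 := Family.norm_aeval_derivative hf hn (by omega)
  have h2 := Family.norm_root hf hn
  have h3 := Family.norm_root_sub_ρ hf hn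
  have h4 := norm_derivative_eq x (Family.natDegree_minpoly hf |>.trans hn.symm)
  rw [hf, hn] at h4
  rw [← h4]
  have hB0 : (evenFamily hm hc hc1 hs).B.eval 0 = (2 * m - 1) * (m - 1) := by
    rw [show (evenFamily hm hc hc1 hs).B = evenB m from rfl, eval_evenB]; ring
  have hB1 : (evenFamily hm hc hc1 hs).B.eval (evenFamily hm hc hc1 hs).ρ = 1 := by
    rw [show (evenFamily hm hc hc1 hs).B = evenB m from rfl,
      show (evenFamily hm hc hc1 hs).ρ = 1 from rfl, eval_evenB]; ring
  have h0 : ((2 * m - 1) * (m - 1) : ℤ) ≠ 0 := mul_ne_zero (by omega) (by omega)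
  rw [h2, h3, hB0, hB1, show (evenFamily hm hc hc1 hs).ℓ = 1 from rfl, map_one, map_one,
    show (evenFamily hm hc hc1 hs).c = c from rfl,
    show (evenFamily hm hc hc1 hs).lam = m * (2 * m - 1) * (2 * m - 2) from rfl,
    (even_two_mul m).neg_one_pow] at h1
  rw [show (evenFamily hm hc hc1 hs).c = c from rfl, show (evenFamily hm hc hc1 hs).s = s from rfl,
    show (evenFamily hm hc hc1 hs).m = m from rfl, show (evenFamily hm hc hc1 hs).κ =
    (m * (2 * m - 1) * (2 * m - 2)) ^ m * c ^ (m - 1) from rfl]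
  have hsign : (-1 : ℤ) ^ (2 * m * (2 * m - 1) / 2) = (-1) ^ m := by
    rw [mul_assoc, Nat.mul_div_cancel_left _ two_pos, pow_mul]
    rcases neg_one_pow_eq_or ℤ m with h | h <;> rw [h]
    · simp
    · exact (show Odd (2 * m - 1) from ⟨m - 1, by omega⟩).neg_one_pow
  rw [hsign]
  generalize Algebra.norm ℤ (aeval x (derivative ((evenFamily hm hc hc1 hs).poly a))) = N at h1 ⊢
  obtain ⟨k, rfl⟩ : ∃ k, m = k + 1 := ⟨m - 1, by omega⟩
  rw [show 2 * (k + 1) = 2 * k + 1 + 1 by ring, Nat.add_sub_cancel] at *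
  rw [Nat.add_sub_cancel]
  refine mul_left_cancel₀ (mul_ne_zero hc (mul_ne_zero hc (pow_ne_zero 2 (show a ≠ 0 by omega)))) ?_
  refine mul_left_cancel₀ h0 ?_
  have he : ((-1 : ℤ) ^ (k + 1)) ^ 2 = 1 := by rw [← pow_mul, mul_comm, pow_mul]; simp
  push_cast at *
  generalize ((k : ℤ) + 1) * (2 * (k + 1) - 1) * (2 * (k + 1) - 2) = lam at *
  generalize (2 * ((k : ℤ) + 1) - 1) * (k + 1 - 1) = b at *
  rw [pow_succ _ (k + 1)] at hs'
  generalize (-1 : ℤ) ^ (k + 1) = ε at *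
  linear_combination (ε * N * b * c * a ^ 2) * hs' + b * h1 - N * c * a ^ 2 * b ^ 2 * he
end
section

variable {m q w e : ℕ} (hm : 2 ≤ m) {c u u' a : ℤ} (hq : q.Prime) (hN : (2 * m - 1 : ℤ) = q ^ w * u)
  (hw : w ≠ 0) (hc : c = q ^ e * u') (hu' : ¬ (q : ℤ) ∣ u') (he : e = 1 ∨ e = 2)
  (hqa : ¬ (q : ℤ) ∣ a)

include hm hq hN hw hc hu' he hqa

/-- A root of small norm of a member of the family of degree `2 * m` forces a ramification index
divisible by `2 * m - 1`. -/
theorem dvd_ramificationIdx_of_pow_eq_evenB {F : Type*} [Field F] [NumberField F] {x : 𝓞 F}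
    (hx : x ^ (2 * m) = ((c * a ^ 2 : ℤ) : 𝓞 F) * aeval x (evenB m))
    (hnorm : ¬ (q : ℤ) ^ (w * Module.finrank ℚ F) ∣ Algebra.norm ℤ x) :
    ∃ P : Ideal (𝓞 F), P.IsPrime ∧ (q : 𝓞 F) ∈ P ∧ 2 * m - 1 ∣ P.ramificationIdx ℤ := by
  obtain ⟨hx0, P, hP, hqP, hlt⟩ := exists_ord_lt hq hnorm
  refine ⟨P, hP, hqP, ?_⟩
  have hP0 := ne_bot_of_natCast_mem hq hqP
  have hq' := Nat.prime_iff_prime_int.1 hq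
  have hq0 : (q : 𝓞 F) ≠ 0 := by exact_mod_cast hq.ne_zero
  have hca : (c * a ^ 2 : ℤ) = q ^ e * (u' * a ^ 2) := by rw [hc]; ring
  have hua : ¬ (q : ℤ) ∣ u' * a ^ 2 := fun h =>
    (hq'.dvd_or_dvd h).elim hu' fun h => hqa (hq'.dvd_of_dvd_pow h)
  have hxP : x ∈ P := by
    refine hP.mem_of_pow_mem (2 * m) (hx ▸ P.mul_mem_right _ ?_)
    rw [intCast_mem_iff hq hqP, hca]
    exact (dvd_pow_self _ (by omega)).mul_right _
  set b : ℤ := 2 * m * (2 * m - 2) with hb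
  have hqb : ¬ (q : ℤ) ∣ b := fun h => by
    have h2 : (q : ℤ) ∣ (2 * m - 1) ^ 2 - b :=
      dvd_sub (hN ▸ (((dvd_pow_self _ hw).mul_right _).pow two_ne_zero)) h
    rw [hb, show ((2 * m - 1 : ℤ) ^ 2 - 2 * m * (2 * m - 2)) = 1 by ring] at h2
    exact hq'.not_isUnit (isUnit_of_dvd_one h2)
  have hbP : (b : 𝓞 F) ∉ P := fun h => hqb ((intCast_mem_iff hq hqP b).1 h)
  have hb0 : (b : 𝓞 F) ≠ 0 := fun h => hbP (h ▸ P.zero_mem)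
  have hB : aeval x (evenB m) = -(b * x) + (q : 𝓞 F) ^ w * (u * (m * x ^ 2 + (m - 1))) := by
    have h2 := congrArg (Int.cast : ℤ → 𝓞 F) hN
    have h3 := congrArg (Int.cast : ℤ → 𝓞 F) hb
    push_cast at h2 h3
    simp only [evenB, eq_intCast]
    push_cast
    simp only [map_add, map_sub, map_mul, map_pow, aeval_X, map_natCast, map_ofNat, map_one]
    linear_combination (m * x ^ 2 + (m - 1)) * h2 + x * h3
  have hbx : ord P (-(b * x)) = ord P x := by
    rw [ord_neg, ord_mul hP0 hb0 hx0, (ord_eq_zero_iff hb0).2 hbP, zero_add]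
  have hBx : ord P (aeval x (evenB m)) = ord P x := by
    rw [hB, ord_add_pow_mul hP0 (neg_ne_zero.2 (mul_ne_zero hb0 hx0)) hq0 (by rwa [hbx]), hbx]
  have hx1 := (ord_pos_iff hx0).2 hxP
  have hB0 : aeval x (evenB m) ≠ 0 := fun h => by
    rw [h, mul_zero] at hx
    exact pow_ne_zero _ hx0 hx
  have hca0 : ((c * a ^ 2 : ℤ) : 𝓞 F) ≠ 0 := fun h => by
    rw [h, zero_mul] at hx
    exact pow_ne_zero _ hx0 hx
  have h1 := congrArg (ord P) hx
  rw [ord_pow hP0 hx0, ord_mul hP0 hca0 hB0, hBx, ord_intCast hq hqP hca hua,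
    ord_natCast_eq_ramificationIdx hq hqP] at h1
  refine dvd_of_mul_eq_mul (t := ord P x) ⟨m - 1, by omega⟩ he ?_
  obtain ⟨k, hk⟩ : ∃ k, 2 * m = k + 1 := ⟨2 * m - 1, by omega⟩
  rw [hk] at h1 ⊢
  rw [Nat.add_sub_cancel]
  linarith

end
section

variable {m q w e : ℕ} (hm : 2 ≤ m) {c s u u' : ℤ} (hc0 : c ≠ 0) (hc1 : c ≠ 1)
  (hs : s ^ 2 * c = (-1) ^ (m + 1) * ((2 * m - 1) * (m - 1)))
  (hq : q.Prime) (hN : (2 * m - 1 : ℤ) = q ^ w * u) (hu : ¬ (q : ℤ) ∣ u)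
  (hew : e ≤ w) (hc : c = q ^ e * u') (hu' : ¬ (q : ℤ) ∣ u') (he : e = 1 ∨ e = 2)

theorem evenFamily_pow_eq {R : Type*} [CommRing R] {x : R} {a : ℤ}
    (hx : aeval x ((evenFamily hm hc0 hc1 hs).poly a) = 0) :
    x ^ (2 * m) = ((c * a ^ 2 : ℤ) : R) * aeval x (evenB m) := by
  have h := Family.pow_mul_aeval_ℓ _ hx
  rwa [show (evenFamily hm hc0 hc1 hs).ℓ = 1 from rfl, map_one, mul_one] at h

theorem evenFamily_eval_zero (a : ℤ) :
    ((evenFamily hm hc0 hc1 hs).poly a).eval 0 = -(c * a ^ 2 * ((2 * m - 1) * (m - 1))) := by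
  rw [Family.eval_zero_poly, show (evenFamily hm hc0 hc1 hs).B = evenB m from rfl, eval_evenB,
    show (evenFamily hm hc0 hc1 hs).c = c from rfl]
  ring

include hq hc he in
theorem not_dvd_of_evenFamily_bad_dvd {a : ℤ} (hab : (evenFamily hm hc0 hc1 hs).bad ∣ a - 1) :
    ¬ (q : ℤ) ∣ a := fun h => by
  have h1 : (q : ℤ) ∣ c := hc ▸ (dvd_pow_self _ (by omega)).mul_right _
  have h2 := dvd_sub h (h1.trans ((Family.c_dvd_bad _).trans hab))
  rw [sub_sub_cancel] at h2
  exact (Nat.prime_iff_prime_int.1 hq).not_isUnit (isUnit_of_dvd_one h2)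

include hq hN hu hew hc hu' he

theorem evenFamily_not_dvd_eval_zero {a : ℤ} (hqa : ¬ (q : ℤ) ∣ a) :
    ¬ (q : ℤ) ^ (w * (2 * m)) ∣ ((evenFamily hm hc0 hc1 hs).poly a).eval 0 := by
  have hq' := Nat.prime_iff_prime_int.1 hq
  rw [evenFamily_eval_zero, dvd_neg, show c * a ^ 2 * ((2 * m - 1) * (m - 1)) =
    q ^ (e + w) * (u' * a ^ 2 * (u * (m - 1))) by rw [hN, hc]; ring]
  refine not_pow_dvd_pow_mul hq' (by nlinarith [show 0 < w by omega, Nat.mul_le_mul_left w hm]) fun h => ?_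
  rcases hq'.dvd_or_dvd h with h | h
  · exact (hq'.dvd_or_dvd h).elim hu' fun h => hqa (hq'.dvd_of_dvd_pow h)
  · refine (hq'.dvd_or_dvd h).elim hu fun h => ?_
    have h1 : (q : ℤ) ∣ 2 * m - 1 := hN ▸ (dvd_pow_self _ (by omega)).mul_right _
    have h2 := dvd_sub h1 (h.mul_left 2)
    rw [show (2 * m - 1 - 2 * (m - 1) : ℤ) = 1 by ring] at h2
    exact hq'.not_isUnit (isUnit_of_dvd_one h2)

theorem evenFamily_irreducibleMembers : (evenFamily hm hc0 hc1 hs).IrreducibleMembers := by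
  intro a ha hab hsq
  have hqa := not_dvd_of_evenFamily_bad_dvd hm hc0 hc1 hs hq hc he hab
  have hf := (evenFamily hm hc0 hc1 hs).monic_poly a
  have hfn := (evenFamily hm hc0 hc1 hs).natDegree_poly a
  refine hf.irreducible_iff_irreducible_map_fraction_map.1 ?_
  obtain ⟨h, hh, hhi, hhd, F, _, _, x, hx, hn, hnorm⟩ := exists_factor_root (w := w) hf
    (by rw [hfn]; exact evenFamily_not_dvd_eval_zero hm hc0 hc1 hs hq hN hu hew hc hu' he hqa)
  obtain ⟨P, hP, hqP, hd⟩ := dvd_ramificationIdx_of_pow_eq_evenB hm hq hN (by omega) hc hu' he hqa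
    (evenFamily_pow_eq hm hc0 hc1 hs hx) hnorm
  have h1 := ramificationIdx_le_finrank (A := ℤ) P
  rw [RingOfIntegers.rank, hn] at h1
  have h2 := Nat.le_of_dvd
    (ord_natCast_eq_ramificationIdx hq hqP ▸ ord_natCast_pos hq hqP) hd
  have h3 := natDegree_le_of_dvd hhd hf.ne_zero
  rcases (show h.natDegree = 2 * m - 1 ∨ 2 * m ≤ h.natDegree by omega) with h4 | h4
  · obtain ⟨t, ht⟩ := exists_root_of_natDegree_eq_succ hf hh hhd (by omega)
    exact absurd ht (Family.eval_poly_ne_zero _ rfl ha hab hsq t)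
  · exact irreducible_of_natDegree_le hf hh hhi hhd (by omega)

theorem evenFamily_primitiveMembers : (evenFamily hm hc0 hc1 hs).PrimitiveMembers := by
  intro a ha hab hsq F _ _ x hf hn E
  have hqa := not_dvd_of_evenFamily_bad_dvd hm hc0 hc1 hs hq hc he hab
  have hnorm : ¬ (q : ℤ) ^ (w * Module.finrank ℚ F) ∣ Algebra.norm ℤ x := by
    have h0 := norm_sub_intCast hf hn (Family.natDegree_poly _ _) 0
    rw [Int.cast_zero, sub_zero, (even_two_mul m).neg_one_pow, one_mul] at h0
    rw [h0, hn]
    exact evenFamily_not_dvd_eval_zero hm hc0 hc1 hs hq hN hu hew hc hu' he hqa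
  obtain ⟨P, hP, hqP, hd⟩ := dvd_ramificationIdx_of_pow_eq_evenB hm hq hN (by omega) hc hu' he hqa
    (evenFamily_pow_eq hm hc0 hc1 hs (Family.aeval_eq_zero hf)) hnorm
  have h1 := ramificationIdx_le_finrank (A := ℤ) P
  rw [RingOfIntegers.rank, hn] at h1
  have h2 := ord_natCast_eq_ramificationIdx hq hqP ▸ ord_natCast_pos hq hqP
  have h3 : P.ramificationIdx ℤ = 2 * m - 1 := by
    obtain ⟨k, hk⟩ := hd
    rw [hk] at h1 h2 ⊢
    have : k < 2 := by
      by_contra! hk2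
      have := Nat.mul_le_mul_left (2 * m - 1) hk2
      omega
    obtain rfl : k = 1 := by
      have := Nat.pos_of_mul_pos_left h2
      omega
    exact mul_one _
  refine eq_bot_or_eq_top_of_ramificationIdx P (by omega) (fun d hd hd1 => ?_) E
  have : d ≠ 0 := by rintro rfl; rw [zero_dvd_iff] at hd; omega
  omega

end

theorem exists_alternating_discr_modEq_even {m : ℕ} (hm : 2 ≤ m) :
    ∃ S₀ : Finset ℕ, (∀ q ∈ S₀, q.Prime) ∧
      ∀ p : ℕ, p.Prime → p ∉ S₀ → ∀ k : ℤ, ¬ ((p : ℤ) ∣ k) →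
        ∃ f : Polynomial ℚ, Irreducible f ∧ f.natDegree = 2 * m ∧
          (∃ (K : Type) (_ : Field K) (_ : Algebra ℚ K),
            Polynomial.IsSplittingField ℚ K f ∧
            Nonempty ((K ≃ₐ[ℚ] K) ≃* alternatingGroup (Fin (2 * m)))) ∧
          (∃ (F : Type) (_ : Field F) (_ : NumberField F) (x : F),
            Polynomial.aeval x f = 0 ∧ Module.finrank ℚ F = 2 * m ∧
            (NumberField.discr F : ℤ) ≡ k ^ 2 [ZMOD (p : ℤ)]) := by
  obtain ⟨q, w, e, j, u, hq, hN, hu, hw, he⟩ := exists_prime_pow_mul (N := 2 * m - 1) (by omega)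
  have hq' := Nat.prime_iff_prime_int.1 hq
  have hqN : (q : ℤ) ∣ 2 * m - 1 := hN ▸ (dvd_pow_self _ (by omega)).mul_right _
  have hu' : ¬ (q : ℤ) ∣ (-1) ^ (m + 1) * (u * (m - 1)) := int_not_dvd_neg_one_pow_mul fun h => by
    refine (hq'.dvd_or_dvd h).elim hu fun h => ?_
    have h2 := dvd_sub hqN (h.mul_left 2)
    rw [show (2 * m - 1 - 2 * (m - 1) : ℤ) = 1 by ring] at h2
    exact hq'.not_isUnit (isUnit_of_dvd_one h2)
  set u' : ℤ := (-1) ^ (m + 1) * (u * (m - 1)) with hu'def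
  have hs : ((q : ℤ) ^ j) ^ 2 * (q ^ e * u') = (-1) ^ (m + 1) * ((2 * m - 1) * (m - 1)) := by
    rw [hN, hw, hu'def]
    ring
  have hc0 : (q : ℤ) ^ e * u' ≠ 0 := mul_ne_zero (pow_ne_zero _ hq'.ne_zero)
    fun h => hu' (h ▸ dvd_zero _)
  have hc1 : (q : ℤ) ^ e * u' ≠ 1 := fun h => hq'.not_isUnit <| isUnit_of_dvd_one <|
    h ▸ (dvd_pow_self _ (by omega)).mul_right _
  exact Family.exists_alternating_discr_modEq (evenFamily_discrFormula hm hc0 hc1 hs)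
    (evenFamily_irreducibleMembers hm hc0 hc1 hs hq hN hu (by omega) rfl hu' he)
    (evenFamily_primitiveMembers hm hc0 hc1 hs hq hN hu (by omega) rfl hu' he)

/-- The denominator of the family of degree `2 * m + 1`. -/
noncomputable def oddB (m : ℕ) : ℤ[X] :=
  C ((2 * m - 1 : ℤ) ^ (2 * m - 1)) * (C ((2 * m - 1 : ℤ) ^ 2) - C (2 * m + 1 : ℤ) * X)

theorem eval_oddB (m : ℕ) (t : ℤ) : (oddB m).eval t =
    (2 * m - 1) ^ (2 * m - 1) * ((2 * m - 1) ^ 2 - (2 * m + 1) * t) := by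
  simp [oddB]

theorem aeval_oddB {R : Type*} [CommRing R] (m : ℕ) (x : R) : aeval x (oddB m) =
    ((2 * m - 1 : ℤ) : R) ^ (2 * m - 1) *
      (((2 * m - 1 : ℤ) : R) ^ 2 - ((2 * m + 1 : ℤ) : R) * x) := by
  rw [oddB, map_mul, map_sub, map_mul, aeval_C, aeval_C, aeval_C, aeval_X]
  simp only [algebraMap_int_eq, eq_intCast, Int.cast_pow]

theorem oddB_dvd {m : ℕ} (hm : 2 ≤ m) :
    (X - C (2 * m - 1 : ℤ)) ^ 3 ∣ X ^ (2 * m) * (X - C (2 * m + 1 : ℤ)) - oddB m := by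
  obtain ⟨k, rfl⟩ : ∃ k, m = k + 1 := ⟨m - 1, by omega⟩
  obtain ⟨z₁, h₁⟩ := sub_pow_three_dvd (X : ℤ[X]) (C (2 * ((k + 1 : ℕ) : ℤ) - 1)) (2 * k + 1)
    ((2 * k + 3) * (k + 1)) (by push_cast; ring)
  obtain ⟨z₂, h₂⟩ := sub_pow_three_dvd (X : ℤ[X]) (C (2 * ((k + 1 : ℕ) : ℤ) - 1)) (2 * k)
    ((k + 1) * (2 * k + 1)) (by push_cast; ring)
  refine ⟨z₁ - (2 * k + 3) * z₂, ?_⟩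
  rw [oddB, show 2 * (k + 1) - 1 = 2 * k + 1 by omega]
  simp only [eq_intCast] at h₁ h₂ ⊢
  push_cast at h₁ h₂ ⊢
  linear_combination h₁ - (2 * k + 3) * h₂

theorem oddB_wronskian {m : ℕ} (hm : 2 ≤ m) :
    derivative (X ^ (2 * m) * (X - C (2 * m + 1 : ℤ))) * oddB m -
      X ^ (2 * m) * (X - C (2 * m + 1 : ℤ)) * derivative (oddB m) =
      C (-(2 * m * (2 * m + 1) * (2 * m - 1) ^ (2 * m - 1)) : ℤ) * X ^ (2 * m - 1) *
        (X - C (2 * m - 1 : ℤ)) ^ 2 := by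
  obtain ⟨k, rfl⟩ : ∃ k, m = k + 1 := ⟨m - 1, by omega⟩
  rw [oddB, show 2 * (k + 1) = 2 * k + 1 + 1 by ring, Nat.add_sub_cancel]
  simp only [derivative_mul, derivative_sub, derivative_X_pow, derivative_C, derivative_X,
    Nat.add_sub_cancel]
  simp only [eq_intCast]
  push_cast
  ring

theorem oddB_degree_lt {m : ℕ} (hm : 2 ≤ m) : (oddB m).degree < (2 * m + 1 : ℕ) := by
  refine lt_of_le_of_lt (b := ((1 : ℕ) : WithBot ℕ)) ?_ (by exact_mod_cast (by omega))
  unfold oddB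
  compute_degree
  norm_num

/-- The family of degree `2 * m + 1`. -/
noncomputable def oddFamily {m : ℕ} (hm : 2 ≤ m) {c s : ℤ} (hc : c ≠ 0) (hc1 : c ≠ 1)
    (hs : s ^ 2 * c = (-1) ^ m * ((2 * m + 1) * (2 * m - 1))) : Family (2 * m + 1) :=
  have h0 : (2 * m + 1 : ℤ) ≠ 0 := by omega
  have h1 : (2 * m - 1 : ℤ) ≠ 0 := by omega
  have h2 : (2 * m : ℤ) ≠ 0 := by omega
  .ofDvd (κ := (2 * m) ^ m * (2 * m + 1) ^ (m + 1) * (2 * m - 1) ^ (2 * m ^ 2) * c ^ (m - 1))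
    (s := s) hm (monic_X_sub_C (2 * m + 1 : ℤ)) (by rw [natDegree_X_sub_C]) (oddB_degree_lt hm)
    (oddB_dvd hm) (oddB_wronskian hm) hc hc1 h1
    (neg_ne_zero.2 (mul_ne_zero (mul_ne_zero h2 h0) (pow_ne_zero _ h1)))
    (by
      rw [eval_oddB, mul_zero, sub_zero]
      exact mul_ne_zero (pow_ne_zero _ h1) (pow_ne_zero _ h1))
    (by rw [eval_sub, eval_X, eval_C, zero_sub]; exact neg_ne_zero.2 h0)
    (by
      rw [eval_oddB]
      refine mul_ne_zero (pow_ne_zero _ h1) ?_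
      rw [show (2 * m - 1 : ℤ) ^ 2 - (2 * m + 1) * (2 * m - 1) = (-2) * (2 * m - 1) by ring]
      exact mul_ne_zero (by norm_num) h1)
    (mul_ne_zero (mul_ne_zero (mul_ne_zero (pow_ne_zero _ h2) (pow_ne_zero _ h0))
      (pow_ne_zero _ h1)) (pow_ne_zero _ hc)) (by
      rintro rfl
      rw [zero_pow two_ne_zero, zero_mul] at hs
      exact mul_ne_zero (pow_ne_zero _ (by norm_num)) (mul_ne_zero h0 h1) hs.symm)

section

variable {m : ℕ} (hm : 2 ≤ m) {c s : ℤ} (hc : c ≠ 0) (hc1 : c ≠ 1)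
    (hs : s ^ 2 * c = (-1) ^ m * ((2 * m + 1) * (2 * m - 1)))

theorem oddFamily_eval_zero (a : ℤ) : ((oddFamily hm hc hc1 hs).poly a).eval 0 =
    -(c * a ^ 2 * (2 * m - 1) ^ (2 * m + 1)) := by
  rw [Family.eval_zero_poly, show (oddFamily hm hc hc1 hs).B = oddB m from rfl, eval_oddB,
    show (oddFamily hm hc hc1 hs).c = c from rfl, mul_zero, sub_zero, ← pow_add,
    show 2 * m - 1 + 2 = 2 * m + 1 by omega]

theorem oddFamily_eval_two_mul_add_one (a : ℤ) :
    ((oddFamily hm hc hc1 hs).poly a).eval (2 * m + 1 : ℤ) =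
      -(c * a ^ 2 * ((2 * m - 1) ^ (2 * m - 1) * ((2 * m - 1) ^ 2 - (2 * m + 1) ^ 2))) := by
  rw [Family.poly, show (oddFamily hm hc hc1 hs).B = oddB m from rfl,
    show (oddFamily hm hc hc1 hs).c = c from rfl,
    show (oddFamily hm hc hc1 hs).ℓ = X - C (2 * m + 1 : ℤ) from rfl, eval_sub, eval_mul, eval_mul,
    eval_oddB, eval_sub, eval_X, eval_C, eval_C]
  ring

theorem oddFamily_pow_mul_eq {R : Type*} [CommRing R] {x : R} {a : ℤ}
    (hx : aeval x ((oddFamily hm hc hc1 hs).poly a) = 0) :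
    x ^ (2 * m) * (x - ((2 * m + 1 : ℤ) : R)) = ((c * a ^ 2 * (2 * m - 1) ^ (2 * m - 1) : ℤ) : R) *
      (((2 * m - 1 : ℤ) : R) ^ 2 - ((2 * m + 1 : ℤ) : R) * x) := by
  have h := Family.pow_mul_aeval_ℓ _ hx
  rw [show (oddFamily hm hc hc1 hs).ℓ = X - C (2 * m + 1 : ℤ) from rfl, map_sub, aeval_X, aeval_C,
    show (oddFamily hm hc hc1 hs).B = oddB m from rfl, aeval_oddB, ← mul_assoc, ← Int.cast_pow,
    ← Int.cast_mul] at h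
  exact h

section

variable {F : Type} [Field F] [NumberField F] {x : 𝓞 F} {a : ℤ}
  (hf : minpoly ℤ x = (oddFamily hm hc hc1 hs).poly a) (hn : Module.finrank ℚ F = 2 * m + 1)
include hf hn

theorem norm_root_oddFamily : Algebra.norm ℤ x = c * a ^ 2 * (2 * m - 1) ^ (2 * m + 1) := by
  have h0 := norm_sub_intCast hf hn (Family.natDegree_poly _ _) 0
  rw [Int.cast_zero, sub_zero, (odd_two_mul_add_one m).neg_one_pow, oddFamily_eval_zero] at h0
  rw [h0]
  ring

theorem norm_root_oddFamily_sub : Algebra.norm ℤ (x - ((2 * m + 1 : ℤ) : 𝓞 F)) =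
    c * a ^ 2 * ((2 * m - 1) ^ (2 * m - 1) * ((2 * m - 1) ^ 2 - (2 * m + 1) ^ 2)) := by
  rw [norm_sub_intCast hf hn (Family.natDegree_poly _ _), (odd_two_mul_add_one m).neg_one_pow,
    oddFamily_eval_two_mul_add_one]
  ring

end

theorem oddFamily_discrFormula : (oddFamily hm hc hc1 hs).DiscrFormula := by
  intro a ha F _ _ x hf hn
  have hs' := hs
  have h1 := Family.norm_aeval_derivative hf hn (by omega)
  have h2 := norm_root_oddFamily hm hc hc1 hs hf hn
  have h3 := Family.norm_root_sub_ρ hf hn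
  have h5 := norm_root_oddFamily_sub hm hc hc1 hs hf hn
  have h4 := norm_derivative_eq x (Family.natDegree_minpoly hf |>.trans hn.symm)
  rw [hf, hn] at h4
  rw [← h4]
  have hBρ : (oddFamily hm hc hc1 hs).B.eval (oddFamily hm hc hc1 hs).ρ =
      -2 * (2 * m - 1) ^ (2 * m - 1) * (2 * m - 1) := by
    rw [show (oddFamily hm hc hc1 hs).B = oddB m from rfl,
      show (oddFamily hm hc hc1 hs).ρ = 2 * m - 1 from rfl, eval_oddB]
    ring
  rw [h3, hBρ, h2, show (oddFamily hm hc hc1 hs).ℓ = X - C (2 * m + 1 : ℤ) from rfl, map_sub,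
    aeval_X, aeval_C, algebraMap_int_eq, eq_intCast, h5,
    show (oddFamily hm hc hc1 hs).c = c from rfl, show (oddFamily hm hc hc1 hs).lam =
      -(2 * m * (2 * m + 1) * (2 * m - 1) ^ (2 * m - 1)) from rfl,
    (odd_two_mul_add_one m).neg_one_pow, (odd_two_mul_add_one m).neg_pow] at h1
  rw [show (oddFamily hm hc hc1 hs).c = c from rfl, show (oddFamily hm hc hc1 hs).s = s from rfl,
    show (oddFamily hm hc hc1 hs).m = m from rfl, show (oddFamily hm hc hc1 hs).κ =
      (2 * m) ^ m * (2 * m + 1) ^ (m + 1) * (2 * m - 1) ^ (2 * m ^ 2) * c ^ (m - 1) from rfl]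
  have hsign : (-1 : ℤ) ^ ((2 * m + 1) * (2 * m + 1 - 1) / 2) = (-1) ^ m := by
    rw [Nat.add_sub_cancel, mul_left_comm, Nat.mul_div_cancel_left _ two_pos, pow_mul,
      (odd_two_mul_add_one m).neg_one_pow]
  rw [hsign]
  generalize Algebra.norm ℤ (aeval x (derivative ((oddFamily hm hc hc1 hs).poly a))) = N at h1 ⊢
  obtain ⟨k, rfl⟩ : ∃ k, m = k + 1 := ⟨m - 1, by omega⟩
  rw [Nat.add_sub_cancel] 
  have hν : 2 * ((k + 1 : ℕ) : ℤ) - 1 ≠ 0 := by omega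
  have hμ : 2 * ((k + 1 : ℕ) : ℤ) ≠ 0 := by omega
  have he : ((-1 : ℤ) ^ (k + 1)) ^ 2 = 1 := by rw [← pow_mul, mul_comm, pow_mul]; simp
  have ha0 : a ≠ 0 := by omega
  have hdiff : (2 * ((k + 1 : ℕ) : ℤ) - 1) ^ 2 - (2 * ((k + 1 : ℕ) : ℤ) + 1) ^ 2 =
    -4 * (2 * ((k + 1 : ℕ) : ℤ)) := by ring
  rw [hdiff] at h1
  clear h2 h3 h4 h5 hBρ hf hsign hdiff
  generalize 2 * ((k + 1 : ℕ) : ℤ) - 1 = ν at *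
  generalize 2 * ((k + 1 : ℕ) : ℤ) + 1 = n' at *
  generalize 2 * ((k + 1 : ℕ) : ℤ) = μ at *
  generalize (-1 : ℤ) ^ (k + 1) = ε at *
  rw [show 2 * (k + 1) - 1 = 2 * k + 1 by omega] at *
  set K : ℤ := c * a ^ 2 * ν ^ (2 * k + 3) * (c * a ^ 2 * (ν ^ (2 * k + 1) * (-4 * μ))) with hK
  refine mul_left_cancel₀ (show c * K ≠ 0 from ?_) ?_
  · have := pow_ne_zero 2 ha0
    have := pow_ne_zero (2 * k + 3) hν
    have := pow_ne_zero (2 * k + 1) hν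
    simp_all
  · rw [hK]
    linear_combination (ε * N * K) * hs' + n' * ν * h1 + n' * ν * N * K * he
end
theorem not_dvd_of_isCoprime_of_dvd {q a b : ℤ} (hq : Prime q) (h : IsCoprime a b) (ha : q ∣ a) :
    ¬ q ∣ b := fun hb => hq.not_isUnit (h.isUnit_of_dvd' ha hb)

section

variable {m q w e : ℕ} {n ν u v k : ℤ} (hq : q.Prime) (hco : IsCoprime n ν) (he : e = 1 ∨ e = 2)
  {F : Type*} [Field F] [NumberField F] {x : 𝓞 F}

include hq hco he

/-- A root of small norm of a member of the family of degree `2 * m + 1` forces a ramification index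
divisible by `2 * m + 1`. -/
theorem dvd_ramificationIdx_of_pow_mul_sub_eq (hn : n = q ^ w * u) (hw : w ≠ 0)
    (hk : k = q ^ e * v) (hv : ¬ (q : ℤ) ∣ v)
    (hx : x ^ (2 * m) * (x - (n : 𝓞 F)) = (k : 𝓞 F) * ((ν : 𝓞 F) ^ 2 - (n : 𝓞 F) * x))
    (hnorm : ¬ (q : ℤ) ^ (w * Module.finrank ℚ F) ∣ Algebra.norm ℤ x) :
    ∃ P : Ideal (𝓞 F), P.IsPrime ∧ (q : 𝓞 F) ∈ P ∧ 2 * m + 1 ∣ P.ramificationIdx ℤ := by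
  obtain ⟨hx0, P, hP, hqP, hlt⟩ := exists_ord_lt hq hnorm
  refine ⟨P, hP, hqP, ?_⟩
  have hP0 := ne_bot_of_natCast_mem hq hqP
  have hq' := Nat.prime_iff_prime_int.1 hq
  have hq0 : (q : 𝓞 F) ≠ 0 := by exact_mod_cast hq.ne_zero
  have hqn : (q : ℤ) ∣ n := hn ▸ (dvd_pow_self _ hw).mul_right _
  have hnP : (n : 𝓞 F) ∈ P := (intCast_mem_iff hq hqP n).2 hqn
  have hνP : (ν : 𝓞 F) ∉ P := fun h =>
    not_dvd_of_isCoprime_of_dvd hq' hco hqn ((intCast_mem_iff hq hqP ν).1 h)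
  have hkP : (k : 𝓞 F) ∈ P :=
    (intCast_mem_iff hq hqP k).2 (hk ▸ (dvd_pow_self _ (by omega)).mul_right _)
  have hxP : x ∈ P := by
    rcases hP.mem_or_mem (hx ▸ P.mul_mem_right _ hkP) with h | h
    · exact hP.mem_of_pow_mem _ h
    · exact (Submodule.sub_mem_iff_left _ hnP).1 h
  have hyP : (ν : 𝓞 F) ^ 2 - n * x ∉ P := fun h =>
    hνP (hP.mem_of_pow_mem _ ((Submodule.sub_mem_iff_left _ (P.mul_mem_left _ hxP)).1 h))
  have hy0 : (ν : 𝓞 F) ^ 2 - n * x ≠ 0 := fun h => hyP (h ▸ P.zero_mem)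
  have hxn : ord P (x - (n : 𝓞 F)) = ord P x := by
    rw [show x - (n : 𝓞 F) = x + (q : 𝓞 F) ^ w * (-u) by rw [hn]; push_cast; ring,
      ord_add_pow_mul hP0 hx0 hq0 hlt]
  have hk0 : (k : 𝓞 F) ≠ 0 := by
    rw [hk]
    refine Int.cast_ne_zero.2 (mul_ne_zero (pow_ne_zero _ hq'.ne_zero) ?_)
    rintro rfl
    exact hv (dvd_zero _)
  have hxn0 : x - (n : 𝓞 F) ≠ 0 := right_ne_zero_of_mul (hx ▸ mul_ne_zero hk0 hy0)
  have h1 := congrArg (ord P) hx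
  rw [ord_mul hP0 (pow_ne_zero _ hx0) hxn0, ord_pow hP0 hx0, ord_mul hP0 hk0 hy0,
    (ord_eq_zero_iff hy0).2 hyP, hxn, ord_intCast hq hqP hk hv,
    ord_natCast_eq_ramificationIdx hq hqP] at h1
  exact dvd_of_mul_eq_mul (t := ord P x) ⟨m, rfl⟩ he (by linarith)

/-- A root of a member of the family of degree `2 * m + 1` is highly divisible by `q`, unless there
is a ramification index divisible by `2 * m - 1`. -/
theorem pow_dvd_of_forall_not_dvd_ramificationIdx (hm : 2 ≤ m) (hν : ν = q ^ w * u) (hw : w ≠ 0)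
    (hk : k = q ^ (e + w * (2 * m - 1)) * v) (hv : ¬ (q : ℤ) ∣ v)
    (hx : x ^ (2 * m) * (x - (n : 𝓞 F)) = (k : 𝓞 F) * ((ν : 𝓞 F) ^ 2 - (n : 𝓞 F) * x))
    (hx0 : x ≠ 0) (hxn0 : x - (n : 𝓞 F) ≠ 0)
    (h : ∀ P : Ideal (𝓞 F), P.IsPrime → (q : 𝓞 F) ∈ P → ¬ 2 * m - 1 ∣ P.ramificationIdx ℤ) :
    (q : 𝓞 F) ^ (2 * w * (2 * m - 1)) ∣ x ^ (2 * m - 1) * (x - (n : 𝓞 F)) ^ 2 := by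
  have hq' := Nat.prime_iff_prime_int.1 hq
  have hq0 : (q : 𝓞 F) ≠ 0 := by exact_mod_cast hq.ne_zero
  have hk0 : (k : 𝓞 F) ≠ 0 := by
    rw [hk]
    refine Int.cast_ne_zero.2 (mul_ne_zero (pow_ne_zero _ hq'.ne_zero) ?_)
    rintro rfl
    exact hv (dvd_zero _)
  have hy0 : (ν : 𝓞 F) ^ 2 - n * x ≠ 0 :=
    right_ne_zero_of_mul (hx ▸ mul_ne_zero (pow_ne_zero _ hx0) hxn0)
  refine dvd_of_ord_le (pow_ne_zero _ hq0)
    (mul_ne_zero (pow_ne_zero _ hx0) (pow_ne_zero _ hxn0)) fun P hP hP0 hqP => ?_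
  replace hqP := hP.mem_of_pow_mem _ hqP
  have hqν : (q : ℤ) ∣ ν := hν ▸ (dvd_pow_self _ hw).mul_right _
  have hνP : (ν : 𝓞 F) ∈ P := (intCast_mem_iff hq hqP ν).2 hqν
  have hnP : (n : 𝓞 F) ∉ P := fun h =>
    not_dvd_of_isCoprime_of_dvd hq' hco.symm hqν ((intCast_mem_iff hq hqP n).1 h)
  have hn0 : (n : 𝓞 F) ≠ 0 := fun h => hnP (h ▸ P.zero_mem)
  have h1 := congrArg (ord P) hx
  rw [ord_mul hP0 (pow_ne_zero _ hx0) hxn0, ord_pow hP0 hx0, ord_mul hP0 hk0 hy0,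
    ord_intCast hq hqP hk hv] at h1
  rw [ord_pow hP0 hq0, ord_mul hP0 (pow_ne_zero _ hx0) (pow_ne_zero _ hxn0), ord_pow hP0 hx0,
    ord_pow hP0 hxn0]
  by_cases hxP : x ∈ P
  · rw [(ord_eq_zero_iff hxn0).2 fun h => hnP ((Submodule.sub_mem_iff_right _ hxP).1 h)] at h1 ⊢
    rcases lt_or_ge (ord P x) (2 * w * ord P (q : 𝓞 F)) with hlt | hle
    · have hnx : ord P (-(n * x)) = ord P x := by
        rw [ord_neg, ord_mul hP0 hn0 hx0, (ord_eq_zero_iff hn0).2 hnP, zero_add]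
      have hy : ord P ((ν : 𝓞 F) ^ 2 - n * x) = ord P x := by
        rw [show (ν : 𝓞 F) ^ 2 - n * x = -(n * x) + (q : 𝓞 F) ^ (2 * w) * u ^ 2 by
          rw [hν]; push_cast; ring, ord_add_pow_mul hP0 (neg_ne_zero.2 (mul_ne_zero hn0 hx0)) hq0
          (by rwa [hnx]), hnx]
      rw [hy, ord_natCast_eq_ramificationIdx hq hqP] at h1
      refine absurd (dvd_of_mul_eq_mul (t := ord P x - w * P.ramificationIdx ℤ) (e := e)
        ⟨m - 1, by omega⟩ he ?_) (h P hP hqP)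
      obtain ⟨k, hk⟩ : ∃ k, 2 * m = k + 1 := ⟨2 * m - 1, by omega⟩
      rw [hk] at h1 ⊢
      rw [Nat.add_sub_cancel] at h1 ⊢
      rw [Nat.mul_sub]
      refine Nat.sub_eq_of_eq_add ?_
      linarith
    · nlinarith [Nat.mul_le_mul_left (2 * m - 1) hle]
  · have hyP : (ν : 𝓞 F) ^ 2 - n * x ∉ P := fun h => by
      rcases hP.mem_or_mem ((Submodule.sub_mem_iff_right _ (P.pow_mem_of_mem hνP 2 two_pos)).1 h)
        with h | h
      exacts [hnP h, hxP h]
    rw [(ord_eq_zero_iff hy0).2 hyP, (ord_eq_zero_iff hx0).2 hxP] at h1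
    rw [(ord_eq_zero_iff hx0).2 hxP]
    have : ord P (x - (n : 𝓞 F)) = (e + w * (2 * m - 1)) * ord P (q : 𝓞 F) := by linarith
    rw [this]
    nlinarith [Nat.zero_le (e * ord P (q : 𝓞 F))]

end
theorem isCoprime_two_mul_add_one_two_mul_sub_one (m : ℤ) : IsCoprime (2 * m + 1) (2 * m - 1) :=
  ⟨m, -(m + 1), by ring⟩

section

variable {m q w e : ℕ} (hm : 2 ≤ m) {c s u t a : ℤ} (hc0 : c ≠ 0) (hc1 : c ≠ 1)
  (hs : s ^ 2 * c = (-1) ^ m * ((2 * m + 1) * (2 * m - 1)))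
  (hq : q.Prime) (hew : e ≤ w) (hc : c = q ^ e * t) (ht : ¬ (q : ℤ) ∣ t) (he : e = 1 ∨ e = 2)

include hq hc ht he

theorem not_dvd_of_oddFamily_bad_dvd (hab : (oddFamily hm hc0 hc1 hs).bad ∣ a - 1) :
    ¬ (q : ℤ) ∣ t * a ^ 2 := fun h => by
  have hq' := Nat.prime_iff_prime_int.1 hq
  have h := hq'.dvd_of_dvd_pow ((hq'.dvd_or_dvd h).resolve_left ht)
  have h1 : (q : ℤ) ∣ c := hc ▸ (dvd_pow_self _ (by omega)).mul_right _
  have h2 := dvd_sub h (h1.trans ((Family.c_dvd_bad _).trans hab))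
  rw [sub_sub_cancel] at h2
  exact hq'.not_isUnit (isUnit_of_dvd_one h2)

include hew

theorem oddFamily_irreducibleMembers (hN : (2 * m + 1 : ℤ) = q ^ w * u) :
    (oddFamily hm hc0 hc1 hs).IrreducibleMembers := by
  intro a ha hab hsq
  have hq' := Nat.prime_iff_prime_int.1 hq
  have hqt := not_dvd_of_oddFamily_bad_dvd hm hc0 hc1 hs hq hc ht he hab
  have hqν : ¬ (q : ℤ) ∣ 2 * m - 1 := not_dvd_of_isCoprime_of_dvd hq'
    (isCoprime_two_mul_add_one_two_mul_sub_one m) (hN ▸ (dvd_pow_self _ (by omega)).mul_right _)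
  have hv : ∀ i, ¬ (q : ℤ) ∣ t * a ^ 2 * (2 * m - 1) ^ i := fun i h =>
    (hq'.dvd_or_dvd h).elim hqt fun h => hqν (hq'.dvd_of_dvd_pow h)
  have hf := (oddFamily hm hc0 hc1 hs).monic_poly a
  have hfn := (oddFamily hm hc0 hc1 hs).natDegree_poly a
  have hf0 : ¬ (q : ℤ) ^ (w * ((oddFamily hm hc0 hc1 hs).poly a).natDegree) ∣
      ((oddFamily hm hc0 hc1 hs).poly a).eval 0 := by
    rw [hfn, oddFamily_eval_zero, dvd_neg, show c * a ^ 2 * (2 * m - 1) ^ (2 * m + 1) =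
      q ^ e * (t * a ^ 2 * (2 * m - 1) ^ (2 * m + 1)) by rw [hc]; ring]
    exact not_pow_dvd_pow_mul hq' (by nlinarith [show 0 < w by omega]) (hv _)
  refine hf.irreducible_iff_irreducible_map_fraction_map.1 ?_
  obtain ⟨h, hh, hhi, hhd, F, _, _, x, hx, hn, hnorm⟩ := exists_factor_root (w := w) hf hf0
  obtain ⟨P, hP, hqP, hd⟩ := dvd_ramificationIdx_of_pow_mul_sub_eq hq
    (isCoprime_two_mul_add_one_two_mul_sub_one m) he hN (by omega) (by rw [hc]; ring)
    (hv (2 * m - 1)) (oddFamily_pow_mul_eq hm hc0 hc1 hs hx) hnorm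
  have h1 := ramificationIdx_le_finrank (A := ℤ) P
  rw [RingOfIntegers.rank, hn] at h1
  have h2 := Nat.le_of_dvd
    (ord_natCast_eq_ramificationIdx hq hqP ▸ ord_natCast_pos hq hqP) hd
  exact irreducible_of_natDegree_le hf hh hhi hhd (by omega)

theorem oddFamily_primitiveMembers (hN : (2 * m - 1 : ℤ) = q ^ w * u) (hu : ¬ (q : ℤ) ∣ u) :
    (oddFamily hm hc0 hc1 hs).PrimitiveMembers := by
  intro a ha hab hsq F _ _ x hf hn E
  have hq' := Nat.prime_iff_prime_int.1 hq
  have hqt := not_dvd_of_oddFamily_bad_dvd hm hc0 hc1 hs hq hc ht he hab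
  have hco := isCoprime_two_mul_add_one_two_mul_sub_one m
  have hqν : (q : ℤ) ∣ 2 * m - 1 := hN ▸ (dvd_pow_self _ (by omega)).mul_right _
  have hqn : ¬ (q : ℤ) ∣ 2 * m + 1 := not_dvd_of_isCoprime_of_dvd hq' hco.symm hqν
  have hv : ∀ i, ¬ (q : ℤ) ∣ t * a ^ 2 * u ^ i := fun i h =>
    (hq'.dvd_or_dvd h).elim hqt fun h => hu (hq'.dvd_of_dvd_pow h)
  have hv' : ¬ (q : ℤ) ∣ t * a ^ 2 * u ^ (2 * m - 1) * ((2 * m - 1) ^ 2 - (2 * m + 1) ^ 2) :=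
    fun h => (hq'.dvd_or_dvd h).elim (hv _) fun h =>
      hqn (hq'.dvd_of_dvd_pow ((dvd_sub_right (hqν.pow two_ne_zero)).1 h))
  have h1 := norm_root_oddFamily hm hc0 hc1 hs hf hn
  have h2 := norm_root_oddFamily_sub hm hc0 hc1 hs hf hn
  rw [show c * a ^ 2 * (2 * m - 1) ^ (2 * m + 1) = q ^ (e + w * (2 * m + 1)) *
    (t * a ^ 2 * u ^ (2 * m + 1)) by rw [hN, hc]; ring] at h1
  rw [show c * a ^ 2 * ((2 * m - 1) ^ (2 * m - 1) * ((2 * m - 1) ^ 2 - (2 * m + 1) ^ 2)) =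
    q ^ (e + w * (2 * m - 1)) *
      (t * a ^ 2 * u ^ (2 * m - 1) * ((2 * m - 1) ^ 2 - (2 * m + 1) ^ 2)) by
    rw [hc, pow_add, pow_mul]
    conv_lhs => enter [2, 1, 1]; rw [hN]
    ring] at h2
  obtain ⟨P, hP, hqP, hd⟩ : ∃ P : Ideal (𝓞 F), P.IsPrime ∧ (q : 𝓞 F) ∈ P ∧
      2 * m - 1 ∣ P.ramificationIdx ℤ := by
    by_contra! hcon
    have hx0 : x ≠ 0 := by
      rintro rfl
      rw [Algebra.norm_zero] at h1
      exact mul_ne_zero (pow_ne_zero _ hq'.ne_zero) (fun h => hv _ (by rw [h]; exact dvd_zero _)) h1.symm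
    have hxn0 : x - ((2 * m + 1 : ℤ) : 𝓞 F) ≠ 0 := by
      intro h
      rw [h, Algebra.norm_zero] at h2
      exact mul_ne_zero (pow_ne_zero _ hq'.ne_zero) (fun h => hv' (by rw [h]; exact dvd_zero _)) h2.symm
    have h3 := _root_.map_dvd (Algebra.norm ℤ) <| pow_dvd_of_forall_not_dvd_ramificationIdx
      (v := t * a ^ 2 * u ^ (2 * m - 1)) hq hco he hm hN (by omega)
      (by
        rw [hc, pow_add, pow_mul]
        conv_lhs => enter [2, 1]; rw [hN]
        ring) (hv _) (oddFamily_pow_mul_eq hm hc0 hc1 hs (Family.aeval_eq_zero hf)) hx0 hxn0 hcon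
    rw [map_mul, map_pow, map_pow, map_pow, h1, h2, ← Int.cast_natCast (R := 𝓞 F), norm_intCast, hn,
      mul_pow (_ ^ (e + w * (2 * m + 1))), mul_pow (_ ^ (e + w * (2 * m - 1))), mul_mul_mul_comm,
      ← pow_mul, ← pow_mul, ← pow_mul, ← pow_add] at h3
    refine not_pow_dvd_pow_mul hq' ?_ (fun h => ?_) h3
    · obtain ⟨k, hk⟩ : ∃ k, m = k + 2 := ⟨m - 2, by omega⟩
      rw [show 2 * m - 1 = 2 * k + 3 by omega, show 2 * m + 1 = 2 * k + 5 by omega]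
      have hw : 0 < w := by omega
      nlinarith [Nat.mul_le_mul_right (2 * k + 5) hew, Nat.zero_le (w * k ^ 2),
        Nat.zero_le (w * k)]
    · rcases hq'.dvd_or_dvd h with h | h
      · exact hv _ (hq'.dvd_of_dvd_pow h)
      · exact hv' (hq'.dvd_of_dvd_pow h)
  have h1 := ramificationIdx_le_finrank (A := ℤ) P
  rw [RingOfIntegers.rank, hn] at h1
  have h2 := ord_natCast_eq_ramificationIdx hq hqP ▸ ord_natCast_pos hq hqP
  have h3 : P.ramificationIdx ℤ = 2 * m - 1 := by
    obtain ⟨k, hk⟩ := hd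
    rw [hk] at h1 h2 ⊢
    have : k < 2 := by
      by_contra! hk2
      have := Nat.mul_le_mul_left (2 * m - 1) hk2
      omega
    obtain rfl : k = 1 := by
      have := Nat.pos_of_mul_pos_left h2
      omega
    exact mul_one _
  refine eq_bot_or_eq_top_of_ramificationIdx P (by omega) (fun d hd hd1 => ?_) E
  have hd2 := (odd_two_mul_add_one m).of_dvd_nat (hn ▸ hd)
  have : d ≠ 2 := by rintro rfl; exact absurd hd2 (by decide)
  have := hd2.pos
  omega

end

theorem exists_alternating_discr_modEq_odd {m : ℕ} (hm : 2 ≤ m) :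
    ∃ S₀ : Finset ℕ, (∀ q ∈ S₀, q.Prime) ∧
      ∀ p : ℕ, p.Prime → p ∉ S₀ → ∀ k : ℤ, ¬ ((p : ℤ) ∣ k) →
        ∃ f : Polynomial ℚ, Irreducible f ∧ f.natDegree = 2 * m + 1 ∧
          (∃ (K : Type) (_ : Field K) (_ : Algebra ℚ K),
            Polynomial.IsSplittingField ℚ K f ∧
            Nonempty ((K ≃ₐ[ℚ] K) ≃* alternatingGroup (Fin (2 * m + 1)))) ∧
          (∃ (F : Type) (_ : Field F) (_ : NumberField F) (x : F),
            Polynomial.aeval x f = 0 ∧ Module.finrank ℚ F = 2 * m + 1 ∧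
            (NumberField.discr F : ℤ) ≡ k ^ 2 [ZMOD (p : ℤ)]) := by
  obtain ⟨q, w, e, j, u, hq, hN, hu, hw, he⟩ := exists_prime_pow_mul (N := 2 * m + 1) (by omega)
  obtain ⟨q₁, w₁, e₁, j₁, u₁, hq₁, hN₁, hu₁, hw₁, he₁⟩ :=
    exists_prime_pow_mul (N := 2 * m - 1) (by omega)
  have hq' := Nat.prime_iff_prime_int.1 hq
  have hq₁' := Nat.prime_iff_prime_int.1 hq₁
  have hco := isCoprime_two_mul_add_one_two_mul_sub_one m
  have hqν := not_dvd_of_isCoprime_of_dvd hq' hco (hN ▸ (dvd_pow_self _ (by omega)).mul_right _)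
  have hqn := not_dvd_of_isCoprime_of_dvd hq₁' hco.symm
    (hN₁ ▸ (dvd_pow_self _ (by omega)).mul_right _)
  have hν : (q₁ : ℤ) ^ e₁ * u₁ ∣ 2 * m - 1 :=
    hN₁ ▸ mul_dvd_mul_right (pow_dvd_pow _ (by omega)) _
  have hn : (q : ℤ) ^ e * u ∣ 2 * m + 1 := hN ▸ mul_dvd_mul_right (pow_dvd_pow _ (by omega)) _
  have ht : ¬ (q : ℤ) ∣ (-1) ^ m * (u * (q₁ ^ e₁ * u₁)) := int_not_dvd_neg_one_pow_mul fun h =>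
    (hq'.dvd_or_dvd h).elim hu fun h => hqν (h.trans hν)
  have ht₁ : ¬ (q₁ : ℤ) ∣ (-1) ^ m * (u₁ * (q ^ e * u)) := int_not_dvd_neg_one_pow_mul fun h =>
    (hq₁'.dvd_or_dvd h).elim hu₁ fun h => hqn (h.trans hn)
  obtain ⟨c, hc⟩ : ∃ c : ℤ, c = q ^ e * ((-1) ^ m * (u * (q₁ ^ e₁ * u₁))) := ⟨_, rfl⟩
  have hc' : c = q₁ ^ e₁ * ((-1) ^ m * (u₁ * (q ^ e * u))) := by rw [hc]; ring
  have hs : ((q : ℤ) ^ j * q₁ ^ j₁) ^ 2 * c = (-1) ^ m * ((2 * m + 1) * (2 * m - 1)) := by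
    rw [hN, hN₁, hw, hw₁, hc]
    ring
  have hc0 : c ≠ 0 := hc ▸ mul_ne_zero (pow_ne_zero _ hq'.ne_zero) fun h => ht (h ▸ dvd_zero _)
  have hc1 : c ≠ 1 := fun h => hq'.not_isUnit <| isUnit_of_dvd_one <|
    h ▸ hc ▸ (dvd_pow_self _ (by omega)).mul_right _
  exact Family.exists_alternating_discr_modEq (oddFamily_discrFormula hm hc0 hc1 hs)
    (oddFamily_irreducibleMembers hm hc0 hc1 hs hq (by omega) hc ht he hN)
    (oddFamily_primitiveMembers hm hc0 hc1 hs hq₁ (by omega) hc' ht₁ he₁ hN₁ hu₁)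

end AltDisc

theorem stmt_16 (habc : AbcConjecture) (n : ℕ) (hn : 4 ≤ n) :
    ∃ S₀ : Finset ℕ, (∀ q ∈ S₀, q.Prime) ∧
      ∀ p : ℕ, p.Prime → p ∉ S₀ → ∀ k : ℤ, ¬ ((p : ℤ) ∣ k) →
        ∃ f : Polynomial ℚ, Irreducible f ∧ f.natDegree = n ∧
          (∃ (K : Type) (_ : Field K) (_ : Algebra ℚ K),
            Polynomial.IsSplittingField ℚ K f ∧
            Nonempty ((K ≃ₐ[ℚ] K) ≃* alternatingGroup (Fin n))) ∧
          (∃ (F : Type) (_ : Field F) (_ : NumberField F) (x : F),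
            Polynomial.aeval x f = 0 ∧ Module.finrank ℚ F = n ∧
            (NumberField.discr F : ℤ) ≡ k ^ 2 [ZMOD (p : ℤ)]) := by
  rcases Nat.even_or_odd' n with ⟨m, rfl | rfl⟩
  · exact AltDisc.exists_alternating_discr_modEq_even (by omega)
  · exact AltDisc.exists_alternating_discr_modEq_odd (by omega)
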